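/- Let $1<p<\infty$. There exist positive constants $\mu_1,\mu_2,\kappa_1,\kappa_2$ depending only on $p$ such that for every bounded measurable function $f\in L_p(\mathbb{T})$ and every $n\in\mathbb{N}$: $\|f-L_n(f)\|_p\le\mu_1\|f_{1/(2n+1)}-f\|_{\ell_p(X_{2n+1}^L)}+\kappa_1\,\omega_2(f,1/n)_p$, and $\max(\Omega_1(f,n),\Omega_2(f,n))\le\|f-L_n(f)\|_p$, where $\Omega_1(f,n)=\kappa_2\,\omega_2(f,1/n)_p-\mu_1\|f_{1/(2n+1)}-f\|_{\ell_p(X_{2n+1}^L)}$ and $\Omega_2(f,n)=\mu_2\|f_{1/(2n+1)}-f\|_{\ell_p(X_{2n+1}^L)}-\kappa_1\,\omega_2(f,1/n)_p$. -/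

import Mathlib

open MeasureTheory Filter Finset

noncomputable def LpNorm (p : ℝ) (f : ℝ → ℝ) : ℝ :=
  (∫ x in (0:ℝ)..1, |f x| ^ p) ^ (1 / p)

def MemLpT (p : ℝ) (f : ℝ → ℝ) : Prop :=
  Function.Periodic f 1 ∧ Measurable f ∧
    IntervalIntegrable (fun x => |f x| ^ p) MeasureTheory.volume 0 1

noncomputable def Delta (r : ℕ) (h : ℝ) (f : ℝ → ℝ) (x : ℝ) : ℝ :=
  ∑ ν ∈ Finset.range (r + 1), ((-1 : ℝ) ^ ν * (r.choose ν : ℝ)) * f (x + ((r : ℝ) - (ν : ℝ)) * h)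

noncomputable def omegaMod (r : ℕ) (p : ℝ) (f : ℝ → ℝ) (δ : ℝ) : ℝ :=
  sSup {y | ∃ h : ℝ, 0 < h ∧ h < δ ∧ y = LpNorm p (Delta r h f)}

noncomputable def steklov (r : ℕ) (δ : ℝ) (f : ℝ → ℝ) (x : ℝ) : ℝ :=
  (-1 : ℝ) ^ (r + 1) * (((2 * r).choose r : ℝ))⁻¹ * (2 / δ) *
    ∫ t in (-(δ / 2))..(δ / 2),
      ∑ ν ∈ Finset.range r,
        (-1 : ℝ) ^ ν * (((2 * r).choose ν : ℝ)) * f (x + (((r : ℝ) - (ν : ℝ)) / (r : ℝ)) * t)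

noncomputable def ellp (p : ℝ) (n : ℕ) (x : ℕ → ℝ) (f : ℝ → ℝ) : ℝ :=
  ((1 / (n : ℝ)) * ∑ k ∈ Finset.range n, |f (x k)| ^ p) ^ (1 / p)

def SobolevW (s : ℕ) (g : ℝ → ℝ) : Prop :=
  Function.Periodic g 1 ∧ ContDiff ℝ (s : ℕ∞) g

noncomputable def localMod (r : ℕ) (f : ℝ → ℝ) (x δ : ℝ) : ℝ :=
  sSup {y | ∃ t h : ℝ, t ∈ Set.Icc (x - r * δ / 2) (x + r * δ / 2) ∧
    (t + r * h) ∈ Set.Icc (x - r * δ / 2) (x + r * δ / 2) ∧ y = |Delta r h f t|}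

noncomputable def tauMod (r : ℕ) (p : ℝ) (f : ℝ → ℝ) (δ : ℝ) : ℝ :=
  (∫ x in (0:ℝ)..1, localMod r f x δ ^ p) ^ (1 / p)

def IsTrigPoly (n : ℕ) (T : ℝ → ℝ) : Prop :=
  ∃ c : ℤ → ℂ, ∀ x : ℝ, (T x : ℂ) =
    ∑ ℓ ∈ Finset.Icc (-(n : ℤ)) (n : ℤ),
      c ℓ * Complex.exp (2 * Real.pi * Complex.I * (ℓ : ℂ) * (x : ℂ))

noncomputable def tildeE (n : ℕ) (p : ℝ) (f : ℝ → ℝ) : ℝ :=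
  sInf {y | ∃ Q q : ℝ → ℝ, IsTrigPoly n Q ∧ IsTrigPoly n q ∧
    (∀ x, q x ≤ f x ∧ f x ≤ Q x) ∧ y = LpNorm p (fun x => Q x - q x)}

noncomputable def dirichlet (n : ℕ) (x : ℝ) : ℝ :=
  ∑ ℓ ∈ Finset.Icc (-(n : ℤ)) (n : ℤ), Real.cos (2 * Real.pi * (ℓ : ℝ) * x)

noncomputable def lagrange (n : ℕ) (f : ℝ → ℝ) (x : ℝ) : ℝ :=
  (1 / (2 * (n : ℝ) + 1)) * ∑ k ∈ Finset.range (2 * n + 1),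
    f ((k : ℝ) / (2 * (n : ℝ) + 1)) * dirichlet n (x - (k : ℝ) / (2 * (n : ℝ) + 1))

def NodesOK (γ : ℝ) (X : ℕ → ℕ → ℝ) : Prop :=
  ∀ n : ℕ, 1 ≤ n →
    (0 ≤ X n 0) ∧ (∀ k, k + 1 < n → X n k < X n (k + 1)) ∧ (X n (n - 1) < 1) ∧
    (∀ k, k + 1 < n → γ / (n : ℝ) ≤ X n (k + 1) - X n k) ∧
    (γ / (n : ℝ) ≤ 1 + X n 0 - X n (n - 1))

def NodesOrd (X : ℕ → ℕ → ℝ) : Prop :=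
  ∀ n : ℕ, 1 ≤ n →
    (0 ≤ X n 0) ∧ (∀ k, k + 1 < n → X n k < X n (k + 1)) ∧ (X n (n - 1) < 1)

def SamplingForm (p : ℝ) (X : ℕ → ℕ → ℝ) (φ : ℕ → ℕ → ℝ → ℝ)
    (G : ℕ → (ℝ → ℝ) → ℝ → ℝ) : Prop :=
  (∀ n k, MemLpT p (φ n k)) ∧
  ∀ (n : ℕ) (f : ℝ → ℝ) (x : ℝ), G n f x = ∑ k ∈ Finset.range n, f (X n k) * φ n k x

def CondC1 (p K1 : ℝ) (X : ℕ → ℕ → ℝ) (G : ℕ → (ℝ → ℝ) → ℝ → ℝ) : Prop :=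
  ∀ f : ℝ → ℝ, MemLpT p f → ∀ n : ℕ, 1 ≤ n → LpNorm p (G n f) ≤ K1 * ellp p n (X n) f

def CondC1' (p K2 : ℝ) (X : ℕ → ℕ → ℝ) (G : ℕ → (ℝ → ℝ) → ℝ → ℝ) : Prop :=
  ∀ f : ℝ → ℝ, MemLpT p f → ∀ n : ℕ, 1 ≤ n → K2 * ellp p n (X n) f ≤ LpNorm p (G n f)

def CondC2' (p K3 : ℝ) (s : ℕ) (G : ℕ → (ℝ → ℝ) → ℝ → ℝ) : Prop :=
  ∀ g : ℝ → ℝ, SobolevW s g → ∀ n : ℕ, 1 ≤ n →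
    LpNorm p (fun x => g x - G n g x) ≤ K3 / (n : ℝ) ^ s * LpNorm p (iteratedDeriv s g)

def CondC3 (p K5 : ℝ) (s : ℕ) (G : ℕ → (ℝ → ℝ) → ℝ → ℝ) : Prop :=
  ∀ f : ℝ → ℝ, MemLpT p f → ∀ n : ℕ, 1 ≤ n →
    SobolevW s (G n f) ∧
    (1 / (n : ℝ) ^ s) * LpNorm p (iteratedDeriv s (G n f)) ≤
      K5 * omegaMod s p (G n f) (1 / (n : ℝ))

noncomputable def Gprev (G : ℕ → (ℝ → ℝ) → ℝ → ℝ) (f : ℝ → ℝ) (ν : ℕ) : ℝ → ℝ :=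
  if ν = 0 then fun _ => 0 else G (2 ^ (ν - 1)) f

def CondC4 (p K4 : ℝ) (s : ℕ) (G : ℕ → (ℝ → ℝ) → ℝ → ℝ) (f : ℝ → ℝ) : Prop :=
  ∀ ν : ℕ,
    SobolevW s (fun x => G (2 ^ ν) f x - Gprev G f ν x) ∧
    LpNorm p (iteratedDeriv s (fun x => G (2 ^ ν) f x - Gprev G f ν x)) ≤
      K4 * 2 ^ (s * ν) * LpNorm p (fun x => G (2 ^ ν) f x - Gprev G f ν x)

noncomputable def Kfun (s : ℕ) (p : ℝ) (n : ℕ) (x : ℕ → ℝ) (f : ℝ → ℝ) : ℝ :=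
  sInf {y | ∃ g : ℝ → ℝ, SobolevW s g ∧
    y = ellp p n x (fun t => f t - g t) + LpNorm p (fun t => f t - g t) +
        (1 / (n : ℝ) ^ s) * LpNorm p (iteratedDeriv s g)}

open MeasureTheory Filter Finset

/-- bounded, measurable, 1-periodic functions -/
structure BP (f : ℝ → ℝ) : Prop where
  per : Function.Periodic f 1
  meas : Measurable f
  bdd : ∃ M : ℝ, ∀ x, |f x| ≤ M

/-- bounded measurable -/
structure BM (f : ℝ → ℝ) : Prop where
  meas : Measurable f
  bdd : ∃ M : ℝ, ∀ x, |f x| ≤ M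

theorem BP.bm {f : ℝ → ℝ} (h : BP f) : BM f := ⟨h.meas, h.bdd⟩

theorem BM.add {f g : ℝ → ℝ} (hf : BM f) (hg : BM g) : BM (fun x => f x + g x) := by
  obtain ⟨M, hM⟩ := hf.bdd
  obtain ⟨M', hM'⟩ := hg.bdd
  exact ⟨hf.meas.add hg.meas, M + M', fun x => (abs_add_le _ _).trans (add_le_add (hM x) (hM' x))⟩

theorem BM.mul {f g : ℝ → ℝ} (hf : BM f) (hg : BM g) : BM (fun x => f x * g x) := by
  obtain ⟨M, hM⟩ := hf.bdd
  obtain ⟨M', hM'⟩ := hg.bdd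
  refine ⟨hf.meas.mul hg.meas, M * M', fun x => ?_⟩
  rw [abs_mul]
  exact mul_le_mul (hM x) (hM' x) (abs_nonneg _) ((abs_nonneg _).trans (hM x))

theorem BM.const (c : ℝ) : BM (fun _ => c) := ⟨measurable_const, |c|, fun _ => le_rfl⟩

theorem BM.const_mul {f : ℝ → ℝ} (hf : BM f) (c : ℝ) : BM (fun x => c * f x) :=
  (BM.const c).mul hf

theorem BM.sub {f g : ℝ → ℝ} (hf : BM f) (hg : BM g) : BM (fun x => f x - g x) := by
  have := hf.add (hg.const_mul (-1))
  convert this using 2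
  ring

theorem BM.abs {f : ℝ → ℝ} (hf : BM f) : BM (fun x => |f x|) := by
  obtain ⟨M, hM⟩ := hf.bdd
  exact ⟨hf.meas.abs, M, fun x => by rw [abs_abs]; exact hM x⟩

theorem BM.comp {f g : ℝ → ℝ} (hf : BM f) (hg : Measurable g) : BM (fun x => f (g x)) := by
  obtain ⟨M, hM⟩ := hf.bdd
  exact ⟨hf.meas.comp hg, M, fun x => hM _⟩

theorem BM.shift {f : ℝ → ℝ} (hf : BM f) (h : ℝ) : BM (fun x => f (x + h)) :=
  hf.comp (measurable_id.add_const h)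

theorem BM.rpow_abs {f : ℝ → ℝ} (hf : BM f) {p : ℝ} (hp : 0 ≤ p) : BM (fun x => |f x| ^ p) := by
  obtain ⟨M, hM⟩ := hf.bdd
  refine ⟨hf.meas.abs.pow_const p, M ^ p, fun x => ?_⟩
  rw [abs_of_nonneg (by positivity)]
  exact Real.rpow_le_rpow (abs_nonneg _) (hM x) hp

theorem BM.sum {ι : Type*} (s : Finset ι) {f : ι → ℝ → ℝ} (hf : ∀ i ∈ s, BM (f i)) :
    BM (fun x => ∑ i ∈ s, f i x) := by
  classical
  induction s using Finset.induction_on with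
  | empty => simpa using BM.const 0
  | insert a s ha ih =>
    simp only [Finset.sum_insert ha]
    exact (hf a (by simp)).add (ih fun i hi => hf i (by simp [hi]))

theorem BP.add {f g : ℝ → ℝ} (hf : BP f) (hg : BP g) : BP (fun x => f x + g x) :=
  ⟨fun x => by simp [hf.per x, hg.per x], (hf.bm.add hg.bm).1, (hf.bm.add hg.bm).2⟩

theorem BP.sub {f g : ℝ → ℝ} (hf : BP f) (hg : BP g) : BP (fun x => f x - g x) :=
  ⟨fun x => by simp [hf.per x, hg.per x], (hf.bm.sub hg.bm).1, (hf.bm.sub hg.bm).2⟩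

theorem BP.const_mul {f : ℝ → ℝ} (hf : BP f) (c : ℝ) : BP (fun x => c * f x) :=
  ⟨fun x => by simp [hf.per x], (hf.bm.const_mul c).1, (hf.bm.const_mul c).2⟩

theorem BP.shift {f : ℝ → ℝ} (hf : BP f) (h : ℝ) : BP (fun x => f (x + h)) :=
  ⟨fun x => by
    have := hf.per (x + h)
    rw [← this]; congr 1; ring, (hf.bm.shift h).1, (hf.bm.shift h).2⟩

theorem BP.abs {f : ℝ → ℝ} (hf : BP f) : BP (fun x => |f x|) :=
  ⟨fun x => by simp [hf.per x], (hf.bm.abs).1, (hf.bm.abs).2⟩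

theorem BP.rpow_abs {f : ℝ → ℝ} (hf : BP f) {p : ℝ} (hp : 0 ≤ p) : BP (fun x => |f x| ^ p) :=
  ⟨fun x => by simp [hf.per x], (hf.bm.rpow_abs hp).1, (hf.bm.rpow_abs hp).2⟩

theorem BP.sum {ι : Type*} (s : Finset ι) {f : ι → ℝ → ℝ} (hf : ∀ i ∈ s, BP (f i)) :
    BP (fun x => ∑ i ∈ s, f i x) :=
  ⟨fun x => Finset.sum_congr rfl fun i hi => (hf i hi).per x,
    (BM.sum s fun i hi => (hf i hi).bm).1, (BM.sum s fun i hi => (hf i hi).bm).2⟩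

theorem BM.intervalIntegrable {f : ℝ → ℝ} (hf : BM f) (a b : ℝ) :
    IntervalIntegrable f volume a b := by
  obtain ⟨M, hM⟩ := hf.bdd
  have : IntervalIntegrable (fun _ : ℝ => M) volume a b := intervalIntegrable_const
  exact this.mono_fun hf.meas.aestronglyMeasurable (ae_of_all _ fun x => by
    simpa using (hM x).trans (le_abs_self M))

theorem BM.integrable {f : ℝ → ℝ} (hf : BM f) {μ : Measure ℝ} [IsFiniteMeasure μ] :
    Integrable f μ := by
  obtain ⟨M, hM⟩ := hf.bdd
  exact Integrable.of_bound hf.meas.aestronglyMeasurable M (ae_of_all _ fun x => by simpa using hM x)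

/-- unit interval measure -/
noncomputable abbrev mI : Measure ℝ := volume.restrict (Set.Ioc (0:ℝ) 1)

instance : IsProbabilityMeasure mI := ⟨by simp [mI]⟩

theorem BM.memLp {f : ℝ → ℝ} (hf : BM f) {μ : Measure ℝ} [IsFiniteMeasure μ] (q : ENNReal) :
    MemLp f q μ := by
  obtain ⟨M, hM⟩ := hf.bdd
  exact MemLp.of_bound hf.meas.aestronglyMeasurable M (ae_of_all _ fun x => by simpa using hM x)

theorem LpNorm_eq_integral (p : ℝ) (f : ℝ → ℝ) : LpNorm p f = (∫ x, |f x| ^ p ∂mI) ^ (1 / p) := by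
  rw [LpNorm, intervalIntegral.integral_of_le zero_le_one]

theorem LpNorm_eq {p : ℝ} (hp : 1 < p) {f : ℝ → ℝ} (hf : BM f) :
    LpNorm p f = (eLpNorm f (ENNReal.ofReal p) mI).toReal := by
  rw [MemLp.eLpNorm_eq_integral_rpow_norm (by simp; linarith) (by simp) (hf.memLp _),
    LpNorm_eq_integral, ENNReal.toReal_ofReal (show (0:ℝ) ≤ p by linarith), ENNReal.toReal_ofReal (by positivity)]
  simp

theorem LpNorm_nonneg (p : ℝ) (f : ℝ → ℝ) : 0 ≤ LpNorm p f := by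
  rw [LpNorm_eq_integral]; positivity

theorem LpNorm_rpow {p : ℝ} (hp : 1 < p) (f : ℝ → ℝ) : LpNorm p f ^ p = ∫ x in (0:ℝ)..1, |f x| ^ p := by
  have h : 0 ≤ ∫ x in (0:ℝ)..1, |f x| ^ p := by
    rw [intervalIntegral.integral_of_le zero_le_one]; positivity
  rw [LpNorm, ← Real.rpow_mul h, one_div, inv_mul_cancel₀ (by linarith), Real.rpow_one]

theorem LpNorm_le_of_rpow {p : ℝ} (hp : 1 < p) {f : ℝ → ℝ} {c : ℝ} (hc : 0 ≤ c)
    (h : ∫ x in (0:ℝ)..1, |f x| ^ p ≤ c ^ p) : LpNorm p f ≤ c := by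
  rw [← LpNorm_rpow hp] at h
  exact (Real.rpow_le_rpow_iff (LpNorm_nonneg _ _) hc (by linarith)).1 h

theorem LpNorm_add_le {p : ℝ} (hp : 1 < p) {f g : ℝ → ℝ} (hf : BM f) (hg : BM g) :
    LpNorm p (fun x => f x + g x) ≤ LpNorm p f + LpNorm p g := by
  rw [LpNorm_eq hp hf, LpNorm_eq hp hg, LpNorm_eq hp (hf.add hg)]
  rw [← ENNReal.toReal_add (hf.memLp _).eLpNorm_ne_top (hg.memLp _).eLpNorm_ne_top]
  apply ENNReal.toReal_mono (ENNReal.add_ne_top.2 ⟨(hf.memLp _).eLpNorm_ne_top, (hg.memLp _).eLpNorm_ne_top⟩)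
  exact eLpNorm_add_le hf.meas.aestronglyMeasurable hg.meas.aestronglyMeasurable
    (by simpa using hp.le)

theorem LpNorm_const_mul {p : ℝ} (hp : 1 < p) (f : ℝ → ℝ) (c : ℝ) :
    LpNorm p (fun x => c * f x) = |c| * LpNorm p f := by
  simp only [LpNorm_eq_integral, abs_mul]
  simp_rw [Real.mul_rpow (abs_nonneg _) (abs_nonneg _)]
  rw [integral_const_mul, Real.mul_rpow (by positivity) (by positivity), ← Real.rpow_mul (abs_nonneg _),
    mul_one_div_cancel (by linarith), Real.rpow_one]

theorem LpNorm_mono {p : ℝ} (hp : 1 < p) {f g : ℝ → ℝ} (hg : BM g)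
    (h : ∀ x, |f x| ≤ |g x|) : LpNorm p f ≤ LpNorm p g := by
  simp only [LpNorm_eq_integral]
  apply Real.rpow_le_rpow (by positivity) _ (by positivity)
  apply integral_mono_of_nonneg (ae_of_all _ fun x => by positivity)
    (hg.rpow_abs (by linarith)).integrable
  exact ae_of_all _ fun x => Real.rpow_le_rpow (abs_nonneg _) (h x) (by linarith)

theorem LpNorm_sub_le {p : ℝ} (hp : 1 < p) {f g : ℝ → ℝ} (hf : BM f) (hg : BM g) :
    LpNorm p (fun x => f x - g x) ≤ LpNorm p f + LpNorm p g := by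
  have := LpNorm_add_le hp hf (hg.const_mul (-1))
  rw [LpNorm_const_mul hp] at this
  simpa [sub_eq_add_neg] using this

theorem LpNorm_sub_comm (p : ℝ) (f g : ℝ → ℝ) :
    LpNorm p (fun x => f x - g x) = LpNorm p (fun x => g x - f x) := by
  simp only [LpNorm, abs_sub_comm]

theorem LpNorm_sum_le {p : ℝ} (hp : 1 < p) {ι : Type*} (s : Finset ι) {f : ι → ℝ → ℝ}
    (hf : ∀ i ∈ s, BM (f i)) :
    LpNorm p (fun x => ∑ i ∈ s, f i x) ≤ ∑ i ∈ s, LpNorm p (f i) := by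
  classical
  induction s using Finset.induction_on with
  | empty =>
    simp only [Finset.sum_empty, LpNorm_eq_integral, abs_zero]
    rw [Real.zero_rpow (by linarith)]
    simp [Real.zero_rpow (show p⁻¹ ≠ 0 by positivity)]
  | insert a s ha ih =>
    simp only [Finset.sum_insert ha]
    refine (LpNorm_add_le hp (hf a (by simp)) (BM.sum s fun i hi => hf i (by simp [hi]))).trans ?_
    gcongr
    exact ih fun i hi => hf i (by simp [hi])

theorem integral_shift {f : ℝ → ℝ} (hf : Function.Periodic f 1) (h : ℝ) :
    ∫ x in (0:ℝ)..1, f (x + h) = ∫ x in (0:ℝ)..1, f x := by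
  rw [intervalIntegral.integral_comp_add_right]
  have := hf.intervalIntegral_add_eq (0 + h) 0
  simpa [add_comm] using this

theorem LpNorm_shift (p : ℝ) {f : ℝ → ℝ} (hf : Function.Periodic f 1) (h : ℝ) :
    LpNorm p (fun x => f (x + h)) = LpNorm p f := by
  unfold LpNorm
  rw [integral_shift (f := fun x => |f x| ^ p) (fun x => by simp [hf x])]

theorem LpNorm_le_of_bound {p : ℝ} (hp : 1 < p) {f : ℝ → ℝ} {c : ℝ} (hc : 0 ≤ c)
    (h : ∀ x, |f x| ≤ c) : LpNorm p f ≤ c := by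
  refine (LpNorm_mono hp (BM.const c) (fun x => (h x).trans (le_abs_self c))).trans ?_
  rw [LpNorm_eq_integral, abs_of_nonneg hc]
  simp only [integral_const, probReal_univ, smul_eq_mul, one_mul]
  rw [← Real.rpow_mul hc, mul_one_div_cancel (by linarith), Real.rpow_one]

/-- infinite series bound -/
theorem LpNorm_hasSum_le {p : ℝ} (hp : 1 < p) {f : ℕ → ℝ → ℝ} {F : ℝ → ℝ} {m w : ℕ → ℝ}
    (hf : ∀ i, BM (f i)) (hF : BM F) (hsum : ∀ x, HasSum (fun i => f i x) (F x))
    (hm : Summable m) (hfm : ∀ i x, |f i x| ≤ m i)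
    {B : ℝ} (hw : HasSum w B) (hfw : ∀ i, LpNorm p (f i) ≤ w i) :
    LpNorm p F ≤ B := by
  have hm0 : ∀ i, 0 ≤ m i := fun i => (abs_nonneg _).trans (hfm i 0)
  have hw0 : ∀ i, 0 ≤ w i := fun i => (LpNorm_nonneg _ _).trans (hfw i)
  have key : ∀ k : ℕ, LpNorm p F ≤ B + ∑' i, m (i + k) := by
    intro k
    have h1 : BM (fun x => ∑ i ∈ Finset.range k, f i x) := BM.sum _ fun i _ => hf i
    have h2 : F = fun x => (∑ i ∈ Finset.range k, f i x) + (F x - ∑ i ∈ Finset.range k, f i x) := by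
      ext x; ring
    rw [h2]
    refine (LpNorm_add_le hp h1 (hF.sub h1)).trans (add_le_add ?_ ?_)
    · refine (LpNorm_sum_le hp _ fun i _ => hf i).trans ((Finset.sum_le_sum fun i _ => hfw i).trans ?_)
      exact sum_le_hasSum _ (fun i _ => hw0 i) hw
    · apply LpNorm_le_of_bound hp (tsum_nonneg fun i => hm0 _)
      intro x
      have hs := (hsum x)
      have : F x - ∑ i ∈ Finset.range k, f i x = ∑' i, f (i + k) x := by
        rw [← hs.tsum_eq, ← hs.summable.sum_add_tsum_nat_add k]; ring
      rw [this]
      have hs2 : Summable fun i => |f (i + k) x| :=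
        Summable.of_nonneg_of_le (fun _ => abs_nonneg _) (fun i => hfm _ _) ((summable_nat_add_iff k).2 hm)
      have := norm_tsum_le_tsum_norm (f := fun i => f (i + k) x) (by simpa using hs2)
      simp only [Real.norm_eq_abs] at this
      exact this.trans (hs2.tsum_le_tsum (fun i => hfm _ _) ((summable_nat_add_iff k).2 hm))
  have hlim : Tendsto (fun k : ℕ => B + ∑' i, m (i + k)) atTop (nhds (B + 0)) :=
    (tendsto_sum_nat_add m).const_add B
  simpa using ge_of_tendsto' hlim key

open MeasureTheory Filter Finset

theorem jensen_weighted {p : ℝ} (hp : 1 < p) {ν : Measure ℝ} [IsFiniteMeasure ν] {h c : ℝ → ℝ}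
    (hh : BM h) (hc : BM c) (hc1 : ∀ t, 1 ≤ c t) :
    |∫ t, h t ∂ν| ^ p ≤ (∫ t, c t ∂ν) ^ (p - 1) * ∫ t, c t ^ (1 - p) * |h t| ^ p ∂ν := by
  have hp0 : 0 < p := by linarith
  have hp1 : 0 < p - 1 := by linarith
  set q := p / (p - 1) with hq
  have hpq : p.HolderConjugate q := Real.HolderConjugate.conjExponent hp
  have hc0 : ∀ t, 0 < c t := fun t => lt_of_lt_of_le one_pos (hc1 t)
  obtain ⟨M, hM⟩ := hc.bdd
  have bm1 : BM (fun t => c t ^ (1 / p - 1) * |h t|) := by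
    refine BM.mul ⟨hc.meas.pow_const _, 1, fun t => ?_⟩ hh.abs
    rw [abs_of_nonneg (Real.rpow_nonneg (hc0 t).le _)]
    apply Real.rpow_le_one_of_one_le_of_nonpos (hc1 t)
    rw [sub_nonpos, div_le_one hp0]; exact hp.le
  have bm2 : BM (fun t => c t ^ (1 - 1 / p)) := by
    have : (0:ℝ) ≤ 1 - 1 / p := by rw [sub_nonneg, div_le_one hp0]; exact hp.le
    have h3 := hc.rpow_abs this
    simpa [abs_of_pos (hc0 _)] using h3
  have H := integral_mul_le_Lp_mul_Lq_of_nonneg (μ := ν) hpq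
    (f := fun t => c t ^ (1 / p - 1) * |h t|) (g := fun t => c t ^ (1 - 1 / p))
    (ae_of_all _ fun t => mul_nonneg (Real.rpow_nonneg (hc0 t).le _) (abs_nonneg _))
    (ae_of_all _ fun t => Real.rpow_nonneg (hc0 t).le _) (bm1.memLp _) (bm2.memLp _)
  have e1 : ∀ t, c t ^ (1 / p - 1) * |h t| * c t ^ (1 - 1 / p) = |h t| := by
    intro t
    rw [mul_right_comm, ← Real.rpow_add (hc0 t)]; simp
  have e2 : ∀ t, (c t ^ (1 / p - 1) * |h t|) ^ p = c t ^ (1 - p) * |h t| ^ p := by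
    intro t
    rw [Real.mul_rpow (Real.rpow_nonneg (hc0 t).le _) (abs_nonneg _), ← Real.rpow_mul (hc0 t).le]
    congr 2; field_simp
  have e3 : ∀ t, (c t ^ (1 - 1 / p)) ^ q = c t := by
    intro t
    rw [← Real.rpow_mul (hc0 t).le]
    have : (1 - 1 / p) * q = 1 := by rw [hq]; field_simp
    rw [this, Real.rpow_one]
  simp only [e1, e2, e3] at H
  have h0 : |∫ t, h t ∂ν| ≤ ∫ t, |h t| ∂ν := abs_integral_le_integral_abs
  have hA : 0 ≤ ∫ t, c t ^ (1 - p) * |h t| ^ p ∂ν :=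
    integral_nonneg fun t => mul_nonneg (Real.rpow_nonneg (hc0 t).le _) (by positivity)
  have hB : 0 ≤ ∫ t, c t ∂ν := integral_nonneg fun t => (hc0 t).le
  have := Real.rpow_le_rpow (abs_nonneg _) (h0.trans H) hp0.le
  refine this.trans (le_of_eq ?_)
  rw [Real.mul_rpow (by positivity) (by positivity), ← Real.rpow_mul hA, ← Real.rpow_mul hB]
  have : 1 / q * p = p - 1 := by rw [hq]; field_simp
  rw [this, one_div_mul_cancel hp0.ne', Real.rpow_one, mul_comm]

/-- bounded jointly measurable kernels -/
structure BK (g : ℝ → ℝ → ℝ) : Prop where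
  meas : Measurable (Function.uncurry g)
  bdd : ∃ M : ℝ, ∀ x t, |g x t| ≤ M

theorem BK.left {g : ℝ → ℝ → ℝ} (h : BK g) (x : ℝ) : BM (g x) := by
  obtain ⟨M, hM⟩ := h.bdd
  exact ⟨h.meas.comp measurable_prodMk_left, M, hM x⟩

theorem BK.right {g : ℝ → ℝ → ℝ} (h : BK g) (t : ℝ) : BM (fun x => g x t) := by
  obtain ⟨M, hM⟩ := h.bdd
  exact ⟨h.meas.comp measurable_prodMk_right, M, fun x => hM x t⟩

theorem BK.integrable {g : ℝ → ℝ → ℝ} (h : BK g) {μ ν : Measure ℝ} [IsFiniteMeasure μ]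
    [IsFiniteMeasure ν] : Integrable (Function.uncurry g) (μ.prod ν) := by
  obtain ⟨M, hM⟩ := h.bdd
  exact Integrable.of_bound h.meas.aestronglyMeasurable M (ae_of_all _ fun x => by
    simpa [Function.uncurry] using hM x.1 x.2)

theorem BK.bm_integral {g : ℝ → ℝ → ℝ} (h : BK g) {ν : Measure ℝ} [IsFiniteMeasure ν] :
    BM (fun x => ∫ t, g x t ∂ν) := by
  obtain ⟨M, hM⟩ := h.bdd
  refine ⟨(h.meas.stronglyMeasurable.integral_prod_right (ν := ν)).measurable, M * ν.real Set.univ,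
    fun x => ?_⟩
  have := norm_integral_le_of_norm_le_const (μ := ν) (f := g x) (C := M) (ae_of_all _ fun t => by
    simpa using hM x t)
  simpa using this

theorem BK.bm_integral' {g : ℝ → ℝ → ℝ} (h : BK g) {ν : Measure ℝ} [IsFiniteMeasure ν] :
    BM (fun t => ∫ x, g x t ∂ν) := by
  have : BK (fun t x => g x t) := ⟨h.meas.comp measurable_swap, by
    obtain ⟨M, hM⟩ := h.bdd; exact ⟨M, fun x t => hM t x⟩⟩
  exact this.bm_integral

theorem BK.rpow {g : ℝ → ℝ → ℝ} (h : BK g) {p : ℝ} (hp : 0 ≤ p) : BK (fun x t => |g x t| ^ p) := by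
  obtain ⟨M, hM⟩ := h.bdd
  refine ⟨?_, M ^ p, fun x t => ?_⟩
  · have := (h.meas.abs).pow_const p
    exact this
  rw [abs_of_nonneg (by positivity)]
  exact Real.rpow_le_rpow (abs_nonneg _) (hM x t) hp

theorem minkowski_weighted {p : ℝ} (hp : 1 < p) {ν : Measure ℝ} [IsFiniteMeasure ν] {g : ℝ → ℝ → ℝ}
    {c : ℝ → ℝ} (hg : BK g) (hc : BM c) (hc1 : ∀ t, 1 ≤ c t) :
    ∫ x in (0:ℝ)..1, |∫ t, g x t ∂ν| ^ p ≤
      (∫ t, c t ∂ν) ^ (p - 1) * ∫ t, c t ^ (1 - p) * (∫ x in (0:ℝ)..1, |g x t| ^ p) ∂ν := by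
  have hp0 : 0 ≤ p := by linarith
  have hc0 : ∀ t, 0 < c t := fun t => lt_of_lt_of_le one_pos (hc1 t)
  simp only [intervalIntegral.integral_of_le (zero_le_one (α := ℝ))]
  have bk : BK (fun x t => c t ^ (1 - p) * |g x t| ^ p) := by
    obtain ⟨M, hM⟩ := hg.bdd
    refine ⟨?_, M ^ p, fun x t => ?_⟩
    · exact ((hc.meas.pow_const (1-p)).comp measurable_snd).mul (hg.rpow hp0).meas
    · rw [abs_of_nonneg (mul_nonneg (Real.rpow_nonneg (hc0 t).le _) (by positivity))]
      have h1 : c t ^ (1 - p) ≤ 1 := Real.rpow_le_one_of_one_le_of_nonpos (hc1 t) (by linarith)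
      have h2 : |g x t| ^ p ≤ M ^ p := Real.rpow_le_rpow (abs_nonneg _) (hM x t) hp0
      calc _ ≤ 1 * |g x t| ^ p := by gcongr
        _ ≤ _ := by rwa [one_mul]
  calc _ ≤ ∫ x, (∫ t, c t ∂ν) ^ (p - 1) * ∫ t, c t ^ (1 - p) * |g x t| ^ p ∂ν ∂mI := by
        apply integral_mono
        · exact (hg.bm_integral.rpow_abs hp0).integrable
        · exact (bk.bm_integral.const_mul _).integrable
        · intro x
          exact jensen_weighted hp (hg.left x) hc hc1
    _ = _ := by
        rw [integral_const_mul, integral_integral_swap (f := fun x t => c t ^ (1 - p) * |g x t| ^ p) bk.integrable]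
        congr 2
        ext t
        rw [integral_const_mul]

theorem minkowski_LpNorm {p : ℝ} (hp : 1 < p) {ν : Measure ℝ} [IsFiniteMeasure ν] {g : ℝ → ℝ → ℝ}
    {c : ℝ → ℝ} (hg : BK g) (hc : BM c) (hc1 : ∀ t, 1 ≤ c t) {A : ℝ} (hA : 0 ≤ A)
    (h : ∀ᵐ t ∂ν, LpNorm p (fun x => g x t) ≤ c t * A) :
    LpNorm p (fun x => ∫ t, g x t ∂ν) ≤ (∫ t, c t ∂ν) * A := by
  have hc0 : ∀ t, 0 < c t := fun t => lt_of_lt_of_le one_pos (hc1 t)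
  have hB : 0 ≤ ∫ t, c t ∂ν := integral_nonneg fun t => (hc0 t).le
  have hp0 : 0 < p := by linarith
  apply LpNorm_le_of_rpow hp (by positivity)
  refine (minkowski_weighted hp hg hc hc1).trans ?_
  have h1 : ∫ t, c t ^ (1 - p) * (∫ x in (0:ℝ)..1, |g x t| ^ p) ∂ν ≤ ∫ t, c t * A ^ p ∂ν := by
    apply integral_mono_of_nonneg
    · refine ae_of_all _ fun t => mul_nonneg (Real.rpow_nonneg (hc0 t).le _) ?_
      rw [intervalIntegral.integral_of_le zero_le_one]; positivity
    · exact (hc.mul (BM.const _)).integrable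
    · filter_upwards [h] with t ht
      rw [← LpNorm_rpow hp]
      calc c t ^ (1 - p) * LpNorm p (fun x => g x t) ^ p ≤ c t ^ (1 - p) * (c t * A) ^ p := by
            gcongr
            · exact Real.rpow_nonneg (hc0 t).le _
            · exact LpNorm_nonneg _ _
        _ = _ := by
            rw [Real.mul_rpow (hc0 t).le hA, ← mul_assoc, ← Real.rpow_add (hc0 t)]
            simp
  rw [integral_mul_const] at h1
  calc _ ≤ (∫ t, c t ∂ν) ^ (p - 1) * ((∫ t, c t ∂ν) * A ^ p) := by gcongr
    _ = _ := by
      rw [Real.mul_rpow hB hA, ← mul_assoc]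
      congr 1
      rcases hB.eq_or_lt with h0 | h0
      · rw [← h0, Real.zero_rpow hp0.ne', mul_zero]
      · conv_lhs => rw [← Real.rpow_one (∫ t, c t ∂ν), ← Real.rpow_mul hB]
        rw [← Real.rpow_add h0]; congr 1; ring

/-- unweighted version on the unit interval in the second variable -/
theorem jensen_kernel {p : ℝ} (hp : 1 < p) {g : ℝ → ℝ → ℝ} (hg : BK g) :
    ∫ x in (0:ℝ)..1, |∫ t in (0:ℝ)..1, g x t| ^ p ≤
      ∫ t in (0:ℝ)..1, ∫ x in (0:ℝ)..1, |g x t| ^ p := by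
  have := minkowski_weighted hp (ν := mI) hg (BM.const 1) (fun _ => le_rfl)
  simpa [intervalIntegral.integral_of_le (zero_le_one (α := ℝ))] using this

open MeasureTheory Filter Finset

theorem hasSum_of_eq {f g : ℕ → ℝ} {a b : ℝ} (h : HasSum f a) (hfg : ∀ k, g k = f k) (hab : b = a) :
    HasSum g b := by
  rw [hab, funext hfg]; exact h

/-- trigonometric polynomial with given coefficients -/
noncomputable def tp (n : ℕ) (a b : ℕ → ℝ) (x : ℝ) : ℝ :=
  ∑ l ∈ Finset.range (n + 1),
    (a l * Real.cos (2 * Real.pi * l * x) + b l * Real.sin (2 * Real.pi * l * x))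

theorem cos_per (l : ℕ) (x : ℝ) :
    Real.cos (2 * Real.pi * l * (x + 1)) = Real.cos (2 * Real.pi * l * x) := by
  rw [show 2 * Real.pi * l * (x + 1) = 2 * Real.pi * l * x + l * (2 * Real.pi) by ring,
    Real.cos_add_nat_mul_two_pi]

theorem sin_per (l : ℕ) (x : ℝ) :
    Real.sin (2 * Real.pi * l * (x + 1)) = Real.sin (2 * Real.pi * l * x) := by
  rw [show 2 * Real.pi * l * (x + 1) = 2 * Real.pi * l * x + l * (2 * Real.pi) by ring,
    Real.sin_add_nat_mul_two_pi]

theorem tp_bound (n : ℕ) (a b : ℕ → ℝ) (x : ℝ) :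
    |tp n a b x| ≤ ∑ l ∈ Finset.range (n + 1), (|a l| + |b l|) := by
  unfold tp
  refine (Finset.abs_sum_le_sum_abs _ _).trans (Finset.sum_le_sum fun l _ => ?_)
  refine (abs_add_le _ _).trans ?_
  rw [abs_mul, abs_mul]
  have := Real.abs_cos_le_one (2 * Real.pi * l * x)
  have := Real.abs_sin_le_one (2 * Real.pi * l * x)
  gcongr
  · exact mul_le_of_le_one_right (abs_nonneg _) (by assumption)
  · exact mul_le_of_le_one_right (abs_nonneg _) (by assumption)

theorem tp_bp (n : ℕ) (a b : ℕ → ℝ) : BP (tp n a b) := by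
  refine ⟨fun x => ?_, ?_, _, tp_bound n a b⟩
  · simp only [tp, cos_per, sin_per]
  · unfold tp; fun_prop

theorem tp_sub (n : ℕ) (a b a' b' : ℕ → ℝ) (x : ℝ) :
    tp n a b x - tp n a' b' x = tp n (fun l => a l - a' l) (fun l => b l - b' l) x := by
  simp only [tp, ← Finset.sum_sub_distrib]
  exact Finset.sum_congr rfl fun l _ => by ring

theorem tp_mul (n : ℕ) (c : ℝ) (a b : ℕ → ℝ) (x : ℝ) :
    c * tp n a b x = tp n (fun l => c * a l) (fun l => c * b l) x := by
  simp only [tp, Finset.mul_sum]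
  exact Finset.sum_congr rfl fun l _ => by ring

theorem tp_avg (n : ℕ) (a b : ℕ → ℝ) (x h : ℝ) :
    (tp n a b (x + h) + tp n a b (x + -h)) / 2 =
      tp n (fun l => Real.cos (2 * Real.pi * l * h) * a l)
        (fun l => Real.cos (2 * Real.pi * l * h) * b l) x := by
  simp only [tp, ← Finset.sum_add_distrib, Finset.sum_div]
  refine Finset.sum_congr rfl fun l _ => ?_
  simp only [mul_add, Real.cos_add, Real.sin_add, mul_neg, Real.cos_neg, Real.sin_neg]
  ring

theorem tp_congr (n : ℕ) {a b a' b' : ℕ → ℝ} (ha : ∀ l ≤ n, a l = a' l) (hb : ∀ l ≤ n, b l = b' l)  :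
    tp n a b = tp n a' b' := by
  ext x
  refine Finset.sum_congr rfl fun l hl => ?_
  rw [ha l (by simpa [Nat.lt_succ_iff] using hl), hb l (by simpa [Nat.lt_succ_iff] using hl)]

/-- `φ` is a multiplier of norm at most `B` on trigonometric polynomials of degree `n`. -/
def Mult (p : ℝ) (n : ℕ) (φ : ℕ → ℝ) (B : ℝ) : Prop :=
  ∀ a b : ℕ → ℝ, LpNorm p (tp n (fun l => φ l * a l) (fun l => φ l * b l)) ≤ B * LpNorm p (tp n a b)

theorem tp_hasSum (n : ℕ) (a b : ℕ → ℝ) {c : ℕ → ℕ → ℝ} {φ : ℕ → ℝ}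
    (h : ∀ l ≤ n, HasSum (fun k => c k l) (φ l)) (x : ℝ) :
    HasSum (fun k => tp n (fun l => c k l * a l) (fun l => c k l * b l) x)
      (tp n (fun l => φ l * a l) (fun l => φ l * b l) x) := by
  unfold tp
  apply hasSum_sum
  intro l hl
  have := (h l (by simpa [Nat.lt_succ_iff] using hl)).mul_right
    (a l * Real.cos (2 * Real.pi * l * x) + b l * Real.sin (2 * Real.pi * l * x))
  refine hasSum_of_eq this (fun k => by ring) (by ring)

/-- general series of multipliers -/
theorem mult_hasSum {p : ℝ} (hp : 1 < p) {n : ℕ} {c : ℕ → ℕ → ℝ} {w : ℕ → ℝ} {φ : ℕ → ℝ} {B : ℝ}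
    (hc : ∀ k, Mult p n (c k) (w k)) (hcw : ∀ k, ∀ l ≤ n, |c k l| ≤ w k)
    (hw : HasSum w B) (h : ∀ l ≤ n, HasSum (fun k => c k l) (φ l)) : Mult p n φ B := by
  intro a b
  refine LpNorm_hasSum_le hp (f := fun k => tp n (fun l => c k l * a l) (fun l => c k l * b l))
    (m := fun k => w k * ∑ l ∈ Finset.range (n + 1), (|a l| + |b l|))
    (w := fun k => w k * LpNorm p (tp n a b))
    (fun i => (tp_bp _ _ _).bm) (tp_bp _ _ _).bm (tp_hasSum n a b h) (hw.summable.mul_right _) ?_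
    (hw.mul_right _) (fun k => hc k a b)
  intro k x
  refine (tp_bound _ _ _ _).trans ?_
  rw [Finset.mul_sum]
  refine Finset.sum_le_sum fun l hl => ?_
  rw [abs_mul, abs_mul, ← mul_add]
  gcongr
  exact hcw k l (by simpa [Nat.lt_succ_iff] using hl)

theorem mult_comp {p : ℝ} {n : ℕ} {φ ψ : ℕ → ℝ} {B C : ℝ} (hB : 0 ≤ B)
    (hφ : Mult p n φ B) (hψ : Mult p n ψ C) : Mult p n (fun l => φ l * ψ l) (B * C) := by
  intro a b
  have h1 := hφ (fun l => ψ l * a l) (fun l => ψ l * b l)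
  have h2 := hψ a b
  simp only [mul_assoc] at h1 ⊢
  exact h1.trans (mul_le_mul_of_nonneg_left h2 hB)

theorem mult_const {p : ℝ} (hp : 1 < p) (n : ℕ) (c : ℝ) : Mult p n (fun _ => c) |c| := by
  intro a b
  rw [← LpNorm_const_mul hp]
  apply le_of_eq; congr 1; ext x; rw [tp_mul]

theorem mult_cos {p : ℝ} (hp : 1 < p) (n : ℕ) (h : ℝ) :
    Mult p n (fun l => Real.cos (2 * Real.pi * l * h)) 1 := by
  intro a b
  have h1 : LpNorm p (fun x => (1/2) * (tp n a b (x + h) + tp n a b (x + -h))) ≤ 1 * LpNorm p (tp n a b) := by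
    rw [LpNorm_const_mul hp]
    have := LpNorm_add_le hp ((tp_bp n a b).shift h).bm ((tp_bp n a b).shift (-h)).bm
    rw [LpNorm_shift p (tp_bp n a b).per, LpNorm_shift p (tp_bp n a b).per] at this
    rw [abs_of_pos (by norm_num)]
    linarith
  refine le_trans (le_of_eq ?_) h1
  congr 1; ext x; rw [← tp_avg]; ring

theorem hasSum_sq {s : ℝ} (h0 : 0 ≤ s) (h1 : s ≤ 1 / 2) :
    HasSum (fun j : ℕ => (1 / Real.pi ^ 2) * ((-1) ^ j * (1 / (j:ℝ) ^ 2)) * Real.cos (2 * Real.pi * j * s))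
      (s ^ 2 - 1 / 12) := by
  have := hasSum_one_div_nat_pow_mul_cos (k := 1) one_ne_zero (x := s + 1 / 2)
    ⟨by linarith, by linarith⟩
  have h2 : Polynomial.eval (s + 1 / 2) (Polynomial.map (algebraMap ℚ ℝ) (Polynomial.bernoulli (2 * 1)))
      = s ^ 2 - 1 / 12 := by
    have hb : Polynomial.bernoulli 2 = Polynomial.X ^ 2 - Polynomial.X + Polynomial.C (1/6 : ℚ) := by
      rw [Polynomial.bernoulli_def]
      simp only [Finset.sum_range_succ, Finset.sum_range_zero]
      simp [bernoulli_one, bernoulli_two, Polynomial.monomial_one_right_eq_X_pow]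
      norm_num [← Polynomial.C_mul_X_eq_monomial]
      ring
    rw [mul_one, hb]
    simp
    ring
  rw [h2] at this
  have h3 := this.mul_left (1 / Real.pi ^ 2)
  refine hasSum_of_eq h3 (fun j => ?_) ?_
  · have : Real.cos (2 * Real.pi * j * (s + 1 / 2)) = (-1) ^ j * Real.cos (2 * Real.pi * j * s) := by
      rw [show 2 * Real.pi * j * (s + 1 / 2) = 2 * Real.pi * j * s + j * Real.pi by ring,
        Real.cos_add_nat_mul_pi]
    rw [this]; ring
  · have := Real.pi_pos
    norm_num [Nat.factorial]
    field_simp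

/-- normalized frequency -/
noncomputable def fr (n l : ℕ) : ℝ := (l : ℝ) / (2 * (n : ℝ) + 1)

theorem fr_nonneg (n l : ℕ) : 0 ≤ fr n l := by unfold fr; positivity

theorem fr_le {n l : ℕ} (h : l ≤ n) : fr n l ≤ 1 / 2 := by
  unfold fr
  rw [div_le_div_iff₀ (by positivity) (by norm_num)]
  have : (l : ℝ) ≤ n := by exact_mod_cast h
  linarith

theorem mult_sq {p : ℝ} (hp : 1 < p) (n : ℕ) : Mult p n (fun l => fr n l ^ 2) (1 / 4) := by
  have hpi := Real.pi_pos
  have key : Mult p n (fun l => fr n l ^ 2 - 1 / 12) (1 / 6) := by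
    refine mult_hasSum hp (w := fun j => 1 / Real.pi ^ 2 * (1 / (j:ℝ) ^ 2))
      (c := fun j l => (1 / Real.pi ^ 2) * ((-1) ^ j * (1 / (j:ℝ) ^ 2)) * Real.cos (2 * Real.pi * j * fr n l))
      ?_ ?_ ?_ ?_
    · intro j
      have h1 := mult_comp (abs_nonneg _) (mult_const hp n ((1 / Real.pi ^ 2) * ((-1) ^ j * (1 / (j:ℝ) ^ 2))))
        (mult_cos hp n (j / (2 * (n:ℝ) + 1)))
      convert h1 using 1
      · ext l
        congr 2
        unfold fr; ring
      · rw [abs_mul, abs_mul, abs_pow, abs_neg, abs_one, one_pow, mul_one, one_mul, abs_of_pos (by positivity),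
          abs_of_nonneg (by positivity)]
    · intro j l _
      rw [abs_mul, abs_mul, abs_mul, abs_pow, abs_neg, abs_one, one_pow, one_mul,
        abs_of_pos (show 0 < 1 / Real.pi ^ 2 by positivity), abs_of_nonneg (show 0 ≤ 1 / (j:ℝ) ^ 2 by positivity)]
      exact mul_le_of_le_one_right (by positivity) (Real.abs_cos_le_one _)
    · refine hasSum_of_eq (hasSum_zeta_two.mul_left (1 / Real.pi ^ 2)) (fun j => rfl) ?_
      field_simp
    · intro l hl
      exact hasSum_sq (fr_nonneg n l) (fr_le hl)
  intro a b
  have h1 := key a b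
  have h2 := mult_const hp n (1 / 12) a b
  have h3 := LpNorm_add_le hp (tp_bp n (fun l => (fr n l ^ 2 - 1 / 12) * a l) (fun l => (fr n l ^ 2 - 1 / 12) * b l)).bm
    (tp_bp n (fun l => (1 / 12) * a l) (fun l => (1 / 12) * b l)).bm
  have h4 : (fun x => tp n (fun l => (fr n l ^ 2 - 1 / 12) * a l) (fun l => (fr n l ^ 2 - 1 / 12) * b l) x +
      tp n (fun l => (1 / 12) * a l) (fun l => (1 / 12) * b l) x) =
      tp n (fun l => fr n l ^ 2 * a l) (fun l => fr n l ^ 2 * b l) := by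
    ext x
    simp only [tp, ← Finset.sum_add_distrib]
    refine Finset.sum_congr rfl fun l _ => by ring
  rw [h4] at h3
  rw [abs_of_pos (by norm_num)] at h2
  linarith

theorem mult_pow {p : ℝ} (hp : 1 < p) (n k : ℕ) : Mult p n (fun l => (fr n l ^ 2) ^ k) ((1 / 4) ^ k) := by
  induction k with
  | zero => simpa using mult_const hp n 1
  | succ k ih =>
    simp only [pow_succ _ k]
    exact mult_comp (by positivity) ih (mult_sq hp n)

/-- power series multipliers -/
theorem mult_series {p : ℝ} (hp : 1 < p) {n : ℕ} {c w : ℕ → ℝ} {φ : ℕ → ℝ} {B : ℝ}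
    (hB : HasSum w B) (hcw : ∀ k, |c k| * (1 / 4) ^ k ≤ w k)
    (h : ∀ l ≤ n, HasSum (fun k => c k * (fr n l ^ 2) ^ k) (φ l)) : Mult p n φ B := by
  refine mult_hasSum hp (w := w) (c := fun k l => c k * (fr n l ^ 2) ^ k)
    ?_ ?_ hB h
  · intro k a b
    have := mult_comp (abs_nonneg _) (mult_const hp n (c k)) (mult_pow hp n k) a b
    exact this.trans (mul_le_mul_of_nonneg_right (hcw k) (LpNorm_nonneg _ _))
  · intro k l hl
    refine le_trans ?_ (hcw k)
    rw [abs_mul]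
    gcongr
    rw [abs_of_nonneg (by positivity)]
    have := fr_le hl
    have := fr_nonneg n l
    gcongr
    nlinarith

theorem mult_inv {p : ℝ} (hp : 1 < p) {n : ℕ} {φ : ℕ → ℝ} {ρ : ℝ} (h1 : ρ < 1)
    (h : Mult p n (fun l => 1 - φ l) ρ) (a b : ℕ → ℝ) :
    LpNorm p (tp n a b) ≤ (1 - ρ)⁻¹ * LpNorm p (tp n (fun l => φ l * a l) (fun l => φ l * b l)) := by
  have h2 := h a b
  have h3 := LpNorm_add_le hp (tp_bp n (fun l => (1 - φ l) * a l) (fun l => (1 - φ l) * b l)).bm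
    (tp_bp n (fun l => φ l * a l) (fun l => φ l * b l)).bm
  have h4 : (fun x => tp n (fun l => (1 - φ l) * a l) (fun l => (1 - φ l) * b l) x +
      tp n (fun l => φ l * a l) (fun l => φ l * b l) x) = tp n a b := by
    ext x
    simp only [tp, ← Finset.sum_add_distrib]
    refine Finset.sum_congr rfl fun l _ => by ring
  rw [h4] at h3
  rw [inv_mul_eq_div, le_div_iff₀ (by linarith)]
  nlinarith

open MeasureTheory Filter Finset

/-- the dominating geometric weights -/
noncomputable def w0 (k : ℕ) : ℝ := if k = 0 then 0 else (5 / 12) ^ k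

theorem w0_hasSum : HasSum w0 (5 / 7) := by
  have h : HasSum (fun k : ℕ => (5 / 12 : ℝ) ^ k) (1 - 5 / 12)⁻¹ :=
    hasSum_geometric_of_lt_one (by norm_num) (by norm_num)
  have h2 : HasSum (fun k : ℕ => if k = 0 then (1:ℝ) else 0) 1 := hasSum_ite_eq 0 1
  refine hasSum_of_eq (h.sub h2) (fun k => ?_) (by norm_num)
  unfold w0
  split_ifs with hk
  · simp [hk]
  · simp

theorem pi_sq_le : Real.pi ^ 2 ≤ 10 := by
  have h1 := Real.pi_lt_d2
  have h2 := Real.pi_pos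
  nlinarith

theorem fact_ge (k : ℕ) : 6 ^ k ≤ (2 * k + 1).factorial := by
  induction k with
  | zero => simp
  | succ k ih =>
    rw [show 2 * (k + 1) + 1 = (2 * k + 1 + 1) + 1 by ring, Nat.factorial_succ, Nat.factorial_succ, pow_succ]
    have : 6 ≤ (2 * k + 1 + 1 + 1) * (2 * k + 1 + 1) := by nlinarith
    calc 6 ^ k * 6 ≤ (2 * k + 1).factorial * ((2 * k + 1 + 1 + 1) * (2 * k + 1 + 1)) := Nat.mul_le_mul ih this
      _ = _ := by ring

theorem fact_ge' (k : ℕ) : 6 * 6 ^ k ≤ (2 * k + 3).factorial := by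
  have := fact_ge (k + 1)
  rw [pow_succ, show 2 * (k + 1) + 1 = 2 * k + 3 by ring] at this
  omega

theorem hasSum_sinc (x : ℝ) :
    HasSum (fun k : ℕ => (-1) ^ k * (x ^ 2) ^ k / ((2 * k + 1).factorial : ℝ)) (Real.sinc x) := by
  by_cases hx : x = 0
  · subst hx
    rw [Real.sinc_zero]
    refine hasSum_of_eq (hasSum_ite_eq 0 (1:ℝ)) (fun k => ?_) rfl
    split_ifs with hk
    · simp [hk]
    · simp [hk]
  · rw [Real.sinc_of_ne_zero hx]
    refine hasSum_of_eq ((Real.hasSum_sin x).div_const x) (fun k => ?_) rfl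
    field_simp
    ring

theorem pisq_pow_bound (k : ℕ) : (Real.pi ^ 2) ^ k * (1 / 4) ^ k ≤ (5 / 2) ^ k := by
  rw [← mul_pow]
  have := pi_sq_le
  gcongr
  linarith

theorem mult_one_sub_sinc {p : ℝ} (hp : 1 < p) (n : ℕ) :
    Mult p n (fun l => 1 - Real.sinc (Real.pi * fr n l)) (5 / 7) := by
  refine mult_series hp (c := fun k => (if k = 0 then 1 else 0) - (-1) ^ k * (Real.pi ^ 2) ^ k / ((2 * k + 1).factorial : ℝ))
    w0_hasSum ?_ ?_
  · intro k
    unfold w0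
    by_cases hk : k = 0
    · simp [hk]
    · simp only [hk, if_false]
      rw [zero_sub, abs_neg, abs_div, abs_mul, abs_pow, abs_neg, abs_one, one_pow, one_mul,
        abs_of_nonneg (show 0 ≤ (Real.pi ^ 2) ^ k by positivity), abs_of_pos (by positivity), div_mul_eq_mul_div,
        div_le_iff₀ (by positivity)]
      have h1 : (6:ℝ) ^ k ≤ (2 * k + 1).factorial := by exact_mod_cast fact_ge k
      calc _ ≤ (5 / 2 : ℝ) ^ k := pisq_pow_bound k
        _ = (5 / 12) ^ k * 6 ^ k := by rw [← mul_pow]; norm_num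
        _ ≤ _ := by gcongr
  · intro l _
    refine hasSum_of_eq ((hasSum_ite_eq 0 (1:ℝ)).sub (hasSum_sinc (Real.pi * fr n l))) (fun k => ?_) rfl
    by_cases hk : k = 0
    · simp [hk]
    · simp only [hk, if_false, mul_pow]; ring

/-- normalized quotient -/
noncomputable def qφ (s : ℝ) : ℝ := ∑' j : ℕ, 6 * ((-1) ^ j * (Real.pi ^ 2) ^ j / ((2 * j + 3).factorial : ℝ)) * (s ^ 2) ^ j

theorem qφ_hasSum (s : ℝ) :
    HasSum (fun j : ℕ => 6 * ((-1) ^ j * (Real.pi ^ 2) ^ j / ((2 * j + 3).factorial : ℝ)) * (s ^ 2) ^ j) (qφ s) ∧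
    s ^ 2 * qφ s = 6 / Real.pi ^ 2 * (1 - Real.sinc (Real.pi * s)) := by
  have hpi := Real.pi_pos
  have h := hasSum_sinc (Real.pi * s)
  have h1 := (hasSum_nat_add_iff' (f := fun k : ℕ => (-1) ^ k * ((Real.pi * s) ^ 2) ^ k / ((2 * k + 1).factorial : ℝ)) 1).2 h
  simp only [Finset.sum_range_one, pow_zero, mul_zero, zero_add, Nat.factorial_one, Nat.cast_one, mul_one, div_one] at h1
  have h2 := h1.mul_left (-6 / Real.pi ^ 2)
  have e : ∀ j : ℕ, -6 / Real.pi ^ 2 * ((-1) ^ (j + 1) * ((Real.pi * s) ^ 2) ^ (j + 1) / ((2 * (j + 1) + 1).factorial : ℝ))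
      = s ^ 2 * (6 * ((-1) ^ j * (Real.pi ^ 2) ^ j / ((2 * j + 3).factorial : ℝ)) * (s ^ 2) ^ j) := by
    intro j
    rw [show 2 * (j + 1) + 1 = 2 * j + 3 by ring]
    simp only [mul_pow]
    field_simp
    ring
  simp only [e] at h2
  have hs : HasSum (fun j : ℕ => 6 * ((-1) ^ j * (Real.pi ^ 2) ^ j / ((2 * j + 3).factorial : ℝ)) * (s ^ 2) ^ j) (qφ s) := by
    apply Summable.hasSum
    by_cases hs : s = 0
    · subst hs
      apply summable_of_ne_finset_zero (s := {0})
      intro j hj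
      simp at hj
      simp [hj]
    · exact (summable_mul_left_iff (by positivity)).1 h2.summable
  refine ⟨hs, ?_⟩
  have := (hs.mul_left (s ^ 2)).unique h2
  rw [this]; ring

theorem mult_one_sub_qφ {p : ℝ} (hp : 1 < p) (n : ℕ) :
    Mult p n (fun l => 1 - qφ (fr n l)) (5 / 7) := by
  refine mult_series hp (c := fun k => (if k = 0 then 1 else 0) - 6 * ((-1) ^ k * (Real.pi ^ 2) ^ k / ((2 * k + 3).factorial : ℝ)))
    w0_hasSum ?_ ?_
  · intro k
    unfold w0
    by_cases hk : k = 0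
    · simp [hk, Nat.factorial]
    · simp only [hk, if_false]
      rw [zero_sub, abs_neg, abs_mul, abs_div, abs_mul, abs_pow, abs_neg, abs_one, one_pow, one_mul,
        abs_of_nonneg (show 0 ≤ (Real.pi ^ 2) ^ k by positivity), abs_of_pos (show (0:ℝ) < (2 * k + 3).factorial by positivity), abs_of_pos (by norm_num),
        mul_assoc, div_mul_eq_mul_div, ← mul_div_assoc,
        div_le_iff₀ (by positivity)]
      have h1 : (6:ℝ) * 6 ^ k ≤ (2 * k + 3).factorial := by exact_mod_cast fact_ge' k
      calc _ ≤ 6 * (5 / 2 : ℝ) ^ k := by gcongr; exact pisq_pow_bound k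
        _ = (5 / 12) ^ k * (6 * 6 ^ k) := by rw [mul_left_comm, ← mul_pow]; norm_num
        _ ≤ _ := by gcongr
  · intro l _
    refine hasSum_of_eq ((hasSum_ite_eq 0 (1:ℝ)).sub (qφ_hasSum (fr n l)).1) (fun k => ?_) rfl
    by_cases hk : k = 0
    · simp [hk]
    · simp only [hk, if_false]; ring

theorem mult_one_sub_cosh {p : ℝ} (hp : 1 < p) (n : ℕ) :
    Mult p n (fun l => 1 - Real.cosh (fr n l)) (5 / 7) := by
  refine mult_series hp (c := fun k => (if k = 0 then 1 else 0) - 1 / ((2 * k).factorial : ℝ))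
    w0_hasSum ?_ ?_
  · intro k
    unfold w0
    by_cases hk : k = 0
    · simp [hk]
    · simp only [hk, if_false]
      rw [zero_sub, abs_neg, abs_of_pos (by positivity)]
      have h1 : (1:ℝ) ≤ (2 * k).factorial := by exact_mod_cast Nat.factorial_pos _
      have : 1 / ((2 * k).factorial : ℝ) ≤ 1 := by rw [div_le_one (by positivity)]; exact h1
      calc _ ≤ 1 * (1 / 4 : ℝ) ^ k := by gcongr
        _ ≤ _ := by rw [one_mul]; exact pow_le_pow_left₀ (by norm_num) (by norm_num) k
  · intro l _
    refine hasSum_of_eq ((hasSum_ite_eq 0 (1:ℝ)).sub (Real.hasSum_cosh (fr n l))) (fun k => ?_) rfl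
    by_cases hk : k = 0
    · simp [hk]
    · simp only [hk, if_false, ← pow_mul]; ring

/-- Second differences: `1 - cos (2 π s τ) = s² ψ`. -/
theorem second_diff_mult {p : ℝ} (hp : 1 < p) (n : ℕ) {τ : ℝ} (h0 : 0 ≤ τ) (h3 : τ ≤ 3) (a b : ℕ → ℝ) :
    LpNorm p (tp n (fun l => (1 - Real.cos (2 * Real.pi * fr n l * τ)) * a l)
        (fun l => (1 - Real.cos (2 * Real.pi * fr n l * τ)) * b l)) ≤
      (6 * Real.pi) ^ 2 * Real.cosh (3 * Real.pi) *
        LpNorm p (tp n (fun l => fr n l ^ 2 * a l) (fun l => fr n l ^ 2 * b l)) := by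
  have hpi := Real.pi_pos
  have hw : HasSum (fun j : ℕ => (6 * Real.pi) ^ 2 * ((3 * Real.pi) ^ (2 * j) / ((2 * j).factorial : ℝ)))
      ((6 * Real.pi) ^ 2 * Real.cosh (3 * Real.pi)) := (Real.hasSum_cosh _).mul_left _
  have hb : ∀ j : ℕ, |(-1) ^ j * (2 * Real.pi * τ) ^ (2 * j + 2) / ((2 * j + 2).factorial : ℝ)| * (1 / 4) ^ j
      ≤ (6 * Real.pi) ^ 2 * ((3 * Real.pi) ^ (2 * j) / ((2 * j).factorial : ℝ)) := by
    intro j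
    rw [abs_div, abs_mul, abs_pow, abs_neg, abs_one, one_pow, one_mul,
      abs_of_nonneg (show 0 ≤ (2 * Real.pi * τ) ^ (2 * j + 2) by positivity), abs_of_pos (by positivity)]
    have e : (2 * Real.pi * τ) ^ (2 * j + 2) * (1 / 4) ^ j = (2 * Real.pi * τ) ^ 2 * (Real.pi * τ) ^ (2 * j) := by
      rw [pow_add, pow_mul, pow_mul, mul_right_comm, ← mul_pow, mul_comm]
      congr 2; ring
    rw [div_mul_eq_mul_div, e, ← mul_div_assoc]
    have f1 : ((2 * j).factorial : ℝ) ≤ (2 * j + 2).factorial := by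
      exact_mod_cast Nat.factorial_le (by omega)
    have g1 : 2 * Real.pi * τ ≤ 6 * Real.pi := by nlinarith
    have g2 : Real.pi * τ ≤ 3 * Real.pi := by nlinarith
    have g3 := pow_le_pow_left₀ (by positivity) g1 2
    have g4 := pow_le_pow_left₀ (by positivity) g2 (2 * j)
    exact div_le_div₀ (by positivity) (mul_le_mul g3 g4 (by positivity) (by positivity)) (by positivity) f1
  have hlt : ∀ l ≤ n, |fr n l ^ 2| ≤ 1 / 4 := by
    intro l hl
    have := fr_le hl
    have := fr_nonneg n l
    rw [abs_of_nonneg (by positivity)]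
    nlinarith
  have hsum : ∀ l ≤ n, Summable (fun j : ℕ => (-1) ^ j * (2 * Real.pi * τ) ^ (2 * j + 2) / ((2 * j + 2).factorial : ℝ) * (fr n l ^ 2) ^ j) := by
    intro l hl
    apply Summable.of_norm_bounded hw.summable
    intro j
    refine le_trans ?_ (hb j)
    rw [norm_mul, Real.norm_eq_abs, Real.norm_eq_abs, abs_pow (fr n l ^ 2)]
    gcongr
    exact hlt l hl
  have hM : Mult p n (fun l => ∑' j : ℕ, (-1) ^ j * (2 * Real.pi * τ) ^ (2 * j + 2) / ((2 * j + 2).factorial : ℝ) * (fr n l ^ 2) ^ j) _ :=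
    mult_series hp hw hb (fun l hl => (hsum l hl).hasSum)
  have := hM (fun l => fr n l ^ 2 * a l) (fun l => fr n l ^ 2 * b l)
  refine le_trans (le_of_eq ?_) this
  have key : ∀ l ≤ n, 1 - Real.cos (2 * Real.pi * fr n l * τ) = (∑' j : ℕ, (-1) ^ j * (2 * Real.pi * τ) ^ (2 * j + 2) / ((2 * j + 2).factorial : ℝ) * (fr n l ^ 2) ^ j) * fr n l ^ 2 := by
    intro l hl
    have h := Real.hasSum_cos (2 * Real.pi * fr n l * τ)
    have h1 := (hasSum_nat_add_iff' (f := fun k : ℕ => (-1) ^ k * (2 * Real.pi * fr n l * τ) ^ (2 * k) / ((2 * k).factorial : ℝ)) 1).2 h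
    simp only [Finset.sum_range_one, pow_zero, mul_zero, Nat.factorial_zero, Nat.cast_one, mul_one, div_one] at h1
    have h2 := h1.neg
    have h3 := (hsum l hl).hasSum.mul_right (fr n l ^ 2)
    rw [neg_sub] at h2
    refine h2.unique (hasSum_of_eq h3 (fun j => ?_) rfl)
    rw [show 2 * (j + 1) = 2 * j + 2 by ring, pow_succ (-1 : ℝ) j]
    rw [show 2 * Real.pi * fr n l * τ = (2 * Real.pi * τ) * fr n l by ring, mul_pow _ (fr n l), ← pow_mul, pow_add (fr n l)]
    ring
  congr 1
  apply tp_congr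
  · intro l hl; rw [key l hl]; ring
  · intro l hl; rw [key l hl]; ring

open MeasureTheory Filter Finset

/-- number of nodes -/
noncomputable abbrev NN (n : ℕ) : ℝ := 2 * (n : ℝ) + 1

theorem NN_pos (n : ℕ) : 0 < NN n := by unfold NN; positivity

/-- half step -/
noncomputable abbrev hh (n : ℕ) : ℝ := 1 / NN n / 2

theorem hh_pos (n : ℕ) : 0 < hh n := by have := NN_pos n; positivity

/-- Steklov average with natural step -/
noncomputable def st (n : ℕ) (f : ℝ → ℝ) (x : ℝ) : ℝ := NN n * ∫ t in (-(hh n))..(hh n), f (x + t)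

theorem steklov_eq (n : ℕ) (f : ℝ → ℝ) (x : ℝ) : steklov 1 (1 / (2 * (n:ℝ) + 1)) f x = st n f x := by
  unfold steklov st
  have : (0:ℝ) < 2 * n + 1 := by positivity
  simp [NN, hh]


theorem Delta_two (h : ℝ) (f : ℝ → ℝ) (x : ℝ) :
    Delta 2 h f x = f (x + h + h) + f (x + h + -h) - 2 * f (x + h) := by
  simp only [Delta, Finset.sum_range_succ, Finset.sum_range_zero]
  norm_num
  rw [show x + 2 * h = x + h + h by ring]
  ring

theorem BP.d2 {f : ℝ → ℝ} (hf : BP f) (h : ℝ) : BP (fun x => f (x + h) + f (x + -h) - 2 * f x) :=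
  ((hf.shift h).add (hf.shift (-h))).sub (hf.const_mul 2)

theorem LpNorm_Delta_two (p : ℝ) {f : ℝ → ℝ} (hf : BP f) (h : ℝ) :
    LpNorm p (Delta 2 h f) = LpNorm p (fun x => f (x + h) + f (x + -h) - 2 * f x) := by
  rw [← LpNorm_shift p (hf.d2 h).per h]
  congr 1; ext x; exact Delta_two h f x

theorem omega_bdd {p : ℝ} (hp : 1 < p) {f : ℝ → ℝ} (hf : BP f) (δ : ℝ) :
    BddAbove {y | ∃ h : ℝ, 0 < h ∧ h < δ ∧ y = LpNorm p (Delta 2 h f)} := by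
  refine ⟨4 * LpNorm p f, ?_⟩
  rintro y ⟨h, -, -, rfl⟩
  rw [LpNorm_Delta_two p hf]
  have h1 := LpNorm_sub_le hp ((hf.shift h).add (hf.shift (-h))).bm (hf.const_mul 2).bm
  have h2 := LpNorm_add_le hp (hf.shift h).bm (hf.shift (-h)).bm
  rw [LpNorm_shift p hf.per, LpNorm_shift p hf.per] at h2
  rw [LpNorm_const_mul hp, abs_of_pos two_pos] at h1
  linarith

theorem le_omega {p : ℝ} (hp : 1 < p) {f : ℝ → ℝ} (hf : BP f) {δ h : ℝ} (h0 : 0 < h) (h1 : h < δ) :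
    LpNorm p (fun x => f (x + h) + f (x + -h) - 2 * f x) ≤ omegaMod 2 p f δ := by
  rw [← LpNorm_Delta_two p hf]
  exact le_csSup (omega_bdd hp hf δ) ⟨h, h0, h1, rfl⟩

theorem omega_nonneg (p : ℝ) (f : ℝ → ℝ) (δ : ℝ) : 0 ≤ omegaMod 2 p f δ := by
  apply Real.sSup_nonneg
  rintro y ⟨h, -, -, rfl⟩
  exact LpNorm_nonneg _ _

theorem omega_le {p : ℝ} {f : ℝ → ℝ} (hf : BP f) {δ B : ℝ} (hB : 0 ≤ B)
    (h : ∀ h, 0 < h → h < δ → LpNorm p (fun x => f (x + h) + f (x + -h) - 2 * f x) ≤ B) :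
    omegaMod 2 p f δ ≤ B := by
  apply Real.sSup_le _ hB
  rintro y ⟨t, h0, h1, rfl⟩
  rw [LpNorm_Delta_two p hf]
  exact h t h0 h1

/-- measure of symmetric interval -/
noncomputable abbrev mH (n : ℕ) : Measure ℝ := volume.restrict (Set.Ioc (-(hh n)) (hh n))

theorem st_eq (n : ℕ) (f : ℝ → ℝ) (x : ℝ) : st n f x = ∫ t, NN n * f (x + t) ∂(mH n) := by
  rw [st, intervalIntegral.integral_of_le (by have := hh_pos n; linarith), integral_const_mul]

theorem mH_real (n : ℕ) : (mH n).real Set.univ = 1 / NN n := by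
  have := hh_pos n
  have h2 := NN_pos n
  rw [measureReal_restrict_apply_univ, Real.volume_real_Ioc_of_le (by linarith)]
  unfold hh; ring

theorem BP.kernel {f : ℝ → ℝ} (hf : BP f) (c : ℝ) : BK (fun x t => c * f (x + t)) := by
  obtain ⟨M, hM⟩ := hf.bdd
  refine ⟨?_, |c| * M, fun x t => ?_⟩
  · have := (hf.meas.comp (measurable_fst.add measurable_snd)).const_mul c
    exact this
  · rw [abs_mul]; gcongr; exact hM _

theorem st_bp (n : ℕ) {f : ℝ → ℝ} (hf : BP f) : BP (st n f) := by
  have := (hf.kernel (NN n)).bm_integral (ν := mH n)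
  simp only [← st_eq] at this
  refine ⟨fun x => ?_, this.1, this.2⟩
  unfold st
  congr 2
  ext t
  rw [← hf.per (x + t)]; congr 1; ring

theorem st_sub (n : ℕ) {f g : ℝ → ℝ} (hf : BP f) (hg : BP g) (x : ℝ) :
    st n (fun x => f x - g x) x = st n f x - st n g x := by
  unfold st
  rw [intervalIntegral.integral_sub, mul_sub]
  · exact (hf.bm.comp (measurable_const_add x)).intervalIntegrable _ _
  · exact (hg.bm.comp (measurable_const_add x)).intervalIntegrable _ _

theorem st_norm {p : ℝ} (hp : 1 < p) (n : ℕ) {f : ℝ → ℝ} (hf : BP f) :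
    LpNorm p (st n f) ≤ LpNorm p f := by
  have hN := NN_pos n
  have := minkowski_LpNorm hp (ν := mH n) (hf.kernel (NN n)) (BM.const 1) (fun _ => le_rfl)
    (A := NN n * LpNorm p f) (mul_nonneg hN.le (LpNorm_nonneg _ _)) (ae_of_all _ fun t => by
      rw [LpNorm_const_mul hp, LpNorm_shift p hf.per, abs_of_pos hN, one_mul])
  simp only [← st_eq] at this
  refine this.trans (le_of_eq ?_)
  rw [integral_const, mH_real]
  simp; field_simp

theorem st_sub_self {p : ℝ} (hp : 1 < p) {n : ℕ} (hn : 1 ≤ n) {f : ℝ → ℝ} (hf : BP f) :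
    LpNorm p (fun x => st n f x - f x) ≤ omegaMod 2 p f (1 / (n:ℝ)) := by
  have hN := NN_pos n
  have hh0 := hh_pos n
  have hn' : (1:ℝ) ≤ n := by exact_mod_cast hn
  set ν : Measure ℝ := volume.restrict (Set.Ioc 0 (hh n)) with hν
  have bk : BK (fun x t => NN n * (f (x + t) + f (x + -t) - 2 * f x)) := by
    obtain ⟨M, hM⟩ := hf.bdd
    refine ⟨?_, NN n * (M + M + 2 * M), fun x t => ?_⟩
    · have h1 := hf.meas.comp (measurable_fst.add (measurable_snd (α := ℝ) (β := ℝ)))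
      have h2 := hf.meas.comp (measurable_fst.add ((measurable_snd (α := ℝ) (β := ℝ)).neg))
      have h3 := hf.meas.comp (measurable_fst : Measurable (Prod.fst : ℝ × ℝ → ℝ))
      exact ((h1.add h2).sub (h3.const_mul 2)).const_mul _
    · rw [abs_mul, abs_of_pos hN]
      have h1 := hM (x + t)
      have h2 := hM (x + -t)
      have h3 := hM x
      gcongr
      rw [abs_le] at *
      constructor <;> linarith
  have := minkowski_LpNorm hp (ν := ν) bk (BM.const 1) (fun _ => le_rfl)
    (A := NN n * omegaMod 2 p f (1 / (n:ℝ))) (mul_nonneg hN.le (omega_nonneg _ _ _)) (by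
      refine (ae_restrict_iff' measurableSet_Ioc).2 (ae_of_all _ fun t ht => ?_)
      rw [LpNorm_const_mul hp, abs_of_pos hN, one_mul]
      apply mul_le_mul_of_nonneg_left _ hN.le
      apply le_omega hp hf ht.1
      refine lt_of_le_of_lt ht.2 ?_
      unfold hh NN
      rw [div_div]
      apply one_div_lt_one_div_of_lt <;> linarith)
  have e : ∀ x, st n f x - f x = ∫ t, NN n * (f (x + t) + f (x + -t) - 2 * f x) ∂ν := by
    intro x
    rw [hν, ← intervalIntegral.integral_of_le hh0.le, intervalIntegral.integral_const_mul]
    have i1 : ∀ a b, IntervalIntegrable (fun t => f (x + t)) volume a b := fun a b =>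
      (hf.bm.comp (measurable_const_add x)).intervalIntegrable _ _
    have i2 : ∀ a b, IntervalIntegrable (fun t => f (x + -t)) volume a b := fun a b =>
      (hf.bm.comp (measurable_neg.const_add x)).intervalIntegrable _ _
    rw [intervalIntegral.integral_sub ((i1 _ _).add (i2 _ _)) intervalIntegrable_const,
      intervalIntegral.integral_add (i1 _ _) (i2 _ _), intervalIntegral.integral_const,
      intervalIntegral.integral_comp_neg (fun t => f (x + t)), neg_zero, add_comm (∫ t in (0:ℝ)..hh n, f (x + t)),
      intervalIntegral.integral_add_adjacent_intervals (i1 _ _) (i1 _ _), st, mul_sub]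
    congr 1
    simp only [sub_zero, smul_eq_mul, hh]
    field_simp
  simp only [← e] at this
  refine this.trans ?_
  rw [integral_const, hν, measureReal_restrict_apply_univ, Real.volume_real_Ioc_of_le hh0.le]
  have h4 := omega_nonneg p f (1 / (n:ℝ))
  have : (hh n - 0) • (1:ℝ) * (NN n * omegaMod 2 p f (1 / (n:ℝ))) = omegaMod 2 p f (1 / (n:ℝ)) / 2 := by
    simp only [sub_zero, smul_eq_mul, hh]
    field_simp
  rw [this]; linarith

theorem int_cos (c h x : ℝ) : ∫ t in (-h)..h, Real.cos (c * (x + t)) = 2 * h * (Real.sinc (c * h) * Real.cos (c * x)) := by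
  by_cases hc : c = 0
  · simp [hc]; ring
  by_cases hh : h = 0
  · simp [hh]
  simp only [mul_add, add_comm (c * x)]
  rw [intervalIntegral.integral_comp_mul_add _ hc, integral_cos, Real.sinc_of_ne_zero (by positivity)]
  rw [Real.sin_add, Real.sin_add, mul_neg, Real.sin_neg, Real.cos_neg, smul_eq_mul]
  field_simp
  ring

theorem int_sin (c h x : ℝ) : ∫ t in (-h)..h, Real.sin (c * (x + t)) = 2 * h * (Real.sinc (c * h) * Real.sin (c * x)) := by
  by_cases hc : c = 0
  · simp [hc]
  by_cases hh : h = 0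
  · simp [hh]
  simp only [mul_add, add_comm (c * x)]
  rw [intervalIntegral.integral_comp_mul_add _ hc, integral_sin, Real.sinc_of_ne_zero (by positivity)]
  rw [Real.cos_add, Real.cos_add, mul_neg, Real.sin_neg, Real.cos_neg, smul_eq_mul]
  field_simp
  ring

theorem st_tp (n : ℕ) (a b : ℕ → ℝ) :
    st n (tp n a b) = tp n (fun l => Real.sinc (Real.pi * fr n l) * a l) (fun l => Real.sinc (Real.pi * fr n l) * b l) := by
  ext x
  have hN := NN_pos n
  unfold st tp
  rw [intervalIntegral.integral_finsetSum]
  · rw [Finset.mul_sum]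
    refine Finset.sum_congr rfl fun l _ => ?_
    rw [intervalIntegral.integral_add, intervalIntegral.integral_const_mul, intervalIntegral.integral_const_mul,
      int_cos, int_sin]
    · rw [show 2 * Real.pi * l * hh n = Real.pi * fr n l by unfold hh fr; ring]
      have : NN n * hh n = 1 / 2 := by unfold hh; field_simp
      linear_combination 2 * (Real.sinc (Real.pi * fr n l) * a l * Real.cos (2 * Real.pi * l * x) +
        Real.sinc (Real.pi * fr n l) * b l * Real.sin (2 * Real.pi * l * x)) * this
    · exact (by fun_prop : Continuous _).intervalIntegrable _ _
    · exact (by fun_prop : Continuous _).intervalIntegrable _ _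
  · intro l _
    exact (by fun_prop : Continuous _).intervalIntegrable _ _

/-- discrete norm -/
noncomputable def el (p : ℝ) (n : ℕ) (f : ℝ → ℝ) : ℝ := ellp p (2 * n + 1) (fun k => (k : ℝ) / (2 * (n : ℝ) + 1)) f

theorem el_eq (p : ℝ) (n : ℕ) (f : ℝ → ℝ) :
    el p n f = ((1 / NN n) * ∑ k ∈ Finset.range (2 * n + 1), |f (k / NN n)| ^ p) ^ (1 / p) := by
  simp [el, ellp, NN]

theorem el_nonneg (p : ℝ) (n : ℕ) (f : ℝ → ℝ) : 0 ≤ el p n f := by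
  have := NN_pos n
  rw [el_eq]; positivity

theorem el_rpow {p : ℝ} (hp : 1 < p) (n : ℕ) (f : ℝ → ℝ) :
    el p n f ^ p = (1 / NN n) * ∑ k ∈ Finset.range (2 * n + 1), |f (k / NN n)| ^ p := by
  have := NN_pos n
  rw [el_eq, ← Real.rpow_mul (by positivity), one_div_mul_cancel (by linarith), Real.rpow_one]

theorem el_le_of_rpow {p : ℝ} (hp : 1 < p) {n : ℕ} {f : ℝ → ℝ} {c : ℝ} (hc : 0 ≤ c)
    (h : (1 / NN n) * ∑ k ∈ Finset.range (2 * n + 1), |f (k / NN n)| ^ p ≤ c ^ p) : el p n f ≤ c := by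
  rw [← el_rpow hp] at h
  exact (Real.rpow_le_rpow_iff (el_nonneg _ _ _) hc (by linarith)).1 h

theorem el_congr (p : ℝ) (n : ℕ) {f g : ℝ → ℝ} (h : ∀ k < 2 * n + 1, f (k / NN n) = g (k / NN n)) : el p n f = el p n g := by
  rw [el_eq, el_eq]
  congr 2
  exact Finset.sum_congr rfl fun k hk => by rw [h k (Finset.mem_range.1 hk)]

theorem el_sub_comm (p : ℝ) (n : ℕ) (f g : ℝ → ℝ) :
    el p n (fun x => f x - g x) = el p n (fun x => g x - f x) := by
  simp only [el_eq, abs_sub_comm]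

theorem el_add_le {p : ℝ} (hp : 1 < p) (n : ℕ) (f g : ℝ → ℝ) :
    el p n (fun x => f x + g x) ≤ el p n f + el p n g := by
  have hN := NN_pos n
  simp only [el_eq]
  have h := Real.Lp_add_le (Finset.range (2 * n + 1)) (fun k => f (k / NN n)) (fun k => g (k / NN n)) hp.le
  rw [Real.mul_rpow (by positivity) (by positivity), Real.mul_rpow (by positivity) (by positivity),
    Real.mul_rpow (by positivity) (by positivity), ← mul_add]
  exact mul_le_mul_of_nonneg_left h (by positivity)

theorem el_st {p : ℝ} (hp : 1 < p) (n : ℕ) {f : ℝ → ℝ} (hf : BP f) :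
    el p n (st n f) ≤ LpNorm p f := by
  have hN := NN_pos n
  have hh0 := hh_pos n
  apply el_le_of_rpow hp (LpNorm_nonneg _ _)
  rw [LpNorm_rpow hp]
  have bp := hf.rpow_abs (show 0 ≤ p by linarith)
  have h1 : ∀ k : ℕ, |st n f (k / NN n)| ^ p ≤ NN n * ∫ t in ((k:ℝ) / NN n - hh n)..(((k + 1 : ℕ) : ℝ) / NN n - hh n), |f t| ^ p := by
    intro k
    have := jensen_weighted hp (ν := mH n) (hf.kernel (NN n) |>.left (k / NN n)) (BM.const 1) (fun _ => le_rfl)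
    rw [← st_eq, integral_const, mH_real] at this
    refine this.trans (le_of_eq ?_)
    simp only [Real.one_rpow, one_mul, abs_mul, abs_of_pos hN, smul_eq_mul, mul_one]
    simp_rw [Real.mul_rpow hN.le (abs_nonneg _)]
    rw [integral_const_mul, ← mul_assoc, ← intervalIntegral.integral_of_le (by linarith),
      intervalIntegral.integral_comp_add_left (fun t => |f t| ^ p)]
    have e1 : (1 / NN n) ^ (p - 1) * NN n ^ p = NN n := by
      rw [one_div, Real.inv_rpow hN.le, ← Real.rpow_neg hN.le, ← Real.rpow_add hN]
      convert Real.rpow_one _ using 2; ring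
    rw [e1]
    congr 2
    push_cast
    unfold hh; field_simp; ring
  calc _ ≤ 1 / NN n * ∑ k ∈ Finset.range (2 * n + 1), NN n * ∫ t in ((k:ℝ) / NN n - hh n)..(((k + 1 : ℕ) : ℝ) / NN n - hh n), |f t| ^ p := by
        gcongr with k hk; exact h1 k
    _ = ∑ k ∈ Finset.range (2 * n + 1), ∫ t in ((k:ℝ) / NN n - hh n)..(((k + 1 : ℕ) : ℝ) / NN n - hh n), |f t| ^ p := by
        rw [← Finset.mul_sum, ← mul_assoc, one_div_mul_cancel hN.ne', one_mul]
    _ = ∫ t in (((0:ℕ):ℝ) / NN n - hh n)..(((2 * n + 1 : ℕ) : ℝ) / NN n - hh n), |f t| ^ p :=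
        intervalIntegral.sum_integral_adjacent_intervals (a := fun k : ℕ => (k:ℝ) / NN n - hh n)
          (fun k _ => bp.bm.intervalIntegrable _ _)
    _ = _ := by
        have := bp.per.intervalIntegral_add_eq (-hh n) 0
        rw [zero_add] at this
        rw [← this]
        congr 1
        · simp
        · push_cast
          rw [div_self hN.ne']; ring

theorem sinc_ne (n l : ℕ) (hl : l ≤ n) : Real.sinc (Real.pi * fr n l) ≠ 0 := by
  have h1 := fr_nonneg n l
  have h2 := fr_le hl
  have hpi := Real.pi_pos
  rcases h1.eq_or_lt with h | h
  · rw [← h]; simp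
  · rw [Real.sinc_of_ne_zero (by positivity)]
    have := Real.sin_pos_of_pos_of_lt_pi (x := Real.pi * fr n l) (by positivity) (by nlinarith)
    positivity

/-- easy Marcinkiewicz-Zygmund inequality -/
theorem easyMZ {p : ℝ} (hp : 1 < p) (n : ℕ) (a b : ℕ → ℝ) :
    el p n (tp n a b) ≤ 7 / 2 * LpNorm p (tp n a b) := by
  set a' := fun l => a l / Real.sinc (Real.pi * fr n l)
  set b' := fun l => b l / Real.sinc (Real.pi * fr n l)
  have e : tp n (fun l => Real.sinc (Real.pi * fr n l) * a' l) (fun l => Real.sinc (Real.pi * fr n l) * b' l) = tp n a b := by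
    apply tp_congr
    · intro l hl; have := sinc_ne n l hl; simp only [a']; field_simp
    · intro l hl; have := sinc_ne n l hl; simp only [b']; field_simp
  have h1 := el_st hp n (tp_bp n a' b')
  rw [st_tp, e] at h1
  have h2 := mult_inv hp (by norm_num) (mult_one_sub_sinc hp n) a' b'
  rw [e] at h2
  refine h1.trans (h2.trans (le_of_eq ?_))
  norm_num

open MeasureTheory Filter Finset

theorem pointwise_riesz {p : ℝ} (hp : 1 < p) (hp2 : p ≤ 2) :
    ∃ A B : ℝ, 0 < A ∧ 0 ≤ B ∧ ∀ z : ℂ, 0 < z.re → ‖z‖ ^ p ≤ A * z.re ^ p - B * (z ^ (p : ℂ)).re := by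
  have hpi := Real.pi_pos
  set θ : ℝ := (Real.pi / (2 * p) + Real.pi / 2) / 2 with hθ
  have e1 : p * θ = Real.pi / 4 + p * Real.pi / 4 := by rw [hθ]; field_simp; ring
  have hpθ1 : Real.pi / 2 < p * θ := by rw [e1]; nlinarith
  have hpθ2 : p * θ < p * Real.pi / 2 := by rw [e1]; nlinarith
  have hθ0 : 0 < θ := by positivity
  have hθ2 : θ < Real.pi / 2 := by nlinarith
  have hc : Real.cos (p * θ) < 0 := Real.cos_neg_of_pi_div_two_lt_of_lt hpθ1 (by nlinarith)
  have hc0 : 0 < Real.cos θ := Real.cos_pos_of_mem_Ioo ⟨by linarith, hθ2⟩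
  set B : ℝ := - 1 / Real.cos (p * θ) with hB
  have hB0 : 0 < B := by rw [hB]; exact div_pos_of_neg_of_neg (by norm_num) hc
  refine ⟨(1 + B) / Real.cos θ ^ p, B, by positivity, hB0.le, fun z hz => ?_⟩
  have hz0 : z ≠ 0 := by rintro rfl; simp at hz
  have hn : 0 < ‖z‖ := norm_pos_iff.2 hz0
  have hre : z.re = ‖z‖ * Real.cos z.arg := (Complex.norm_mul_cos_arg z).symm
  have harg : |z.arg| < Real.pi / 2 := Complex.abs_arg_lt_pi_div_two_iff.2 (Or.inl hz)
  have hca : 0 < Real.cos z.arg := by rw [hre] at hz; exact pos_of_mul_pos_right hz hn.le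
  rw [Complex.cpow_ofReal_re, hre, Real.mul_rpow hn.le hca.le]
  suffices h : 1 ≤ (1 + B) / Real.cos θ ^ p * Real.cos z.arg ^ p - B * Real.cos (z.arg * p) by
    have := mul_le_mul_of_nonneg_left h (show 0 ≤ ‖z‖ ^ p by positivity)
    linarith
  have ea : Real.cos z.arg = Real.cos |z.arg| := (Real.cos_abs _).symm
  have eb : Real.cos (z.arg * p) = Real.cos (p * |z.arg|) := by
    rw [← Real.cos_abs, abs_mul, abs_of_pos (show 0 < p by linarith), mul_comm]
  rw [ea] at hca
  rw [ea, eb]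
  rcases le_total |z.arg| θ with h | h
  · have h1 : Real.cos θ ≤ Real.cos |z.arg| := Real.cos_le_cos_of_nonneg_of_le_pi (abs_nonneg _) (by linarith) h
    have h2 : Real.cos θ ^ p ≤ Real.cos |z.arg| ^ p := Real.rpow_le_rpow hc0.le h1 (by linarith)
    have h3 : 1 + B ≤ (1 + B) / Real.cos θ ^ p * Real.cos |z.arg| ^ p := by
      rw [div_mul_eq_mul_div, le_div_iff₀ (by positivity)]
      gcongr
    have h4 := Real.cos_le_one (p * |z.arg|)
    nlinarith
  · have h1 : Real.cos (p * |z.arg|) ≤ Real.cos (p * θ) := by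
      apply Real.cos_le_cos_of_nonneg_of_le_pi (by positivity) _ (by gcongr)
      nlinarith
    have h3 : 0 ≤ (1 + B) / Real.cos θ ^ p * Real.cos |z.arg| ^ p := by positivity
    have h4 : B * Real.cos (p * θ) = -1 := by rw [hB, div_mul_cancel₀ _ hc.ne]
    nlinarith

/-- complex exponent -/
noncomputable def ss (n : ℕ) (y : ℝ) : ℂ := ((-(1 / NN n) : ℝ) : ℂ) + ((2 * Real.pi * y : ℝ) : ℂ) * Complex.I

noncomputable def uu (n : ℕ) (y : ℝ) : ℂ := Complex.exp (ss n y)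

theorem uu_norm (n : ℕ) (y : ℝ) : ‖uu n y‖ = Real.exp (-(1 / NN n)) := by
  rw [uu, Complex.norm_exp]
  congr 1
  rw [ss, Complex.add_re, Complex.re_ofReal_mul, Complex.I_re, mul_zero, add_zero, Complex.ofReal_re]

theorem uu_norm_lt (n : ℕ) (y : ℝ) : ‖uu n y‖ < 1 := by
  rw [uu_norm, Real.exp_lt_one_iff]
  have := NN_pos n
  simp; positivity

theorem uu_circle (n : ℕ) (y : ℝ) : uu n y = circleMap 0 (Real.exp (-(1 / NN n))) (2 * Real.pi * y) := by
  rw [uu, ss, Complex.exp_add, circleMap]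
  simp

/-- rotations -/
noncomputable def cc (t : ℝ) : ℂ := Complex.exp (((-(2 * Real.pi * t) : ℝ) : ℂ) * Complex.I)

theorem cc_norm (t : ℝ) : ‖cc t‖ = 1 := Complex.norm_exp_ofReal_mul_I _

theorem uu_sub (n : ℕ) (y t : ℝ) : uu n (y - t) = uu n y * cc t := by
  rw [uu, uu, cc, ← Complex.exp_add]
  congr 1
  simp only [ss]
  push_cast
  ring

theorem mean_value (n : ℕ) {F : ℂ → ℂ} (hF : DifferentiableOn ℂ F (Metric.ball 0 1)) :
    ∫ x in (0:ℝ)..1, (F (uu n x)).re = (F 0).re := by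
  have hN := NN_pos n
  have hpi := Real.pi_pos
  set r := Real.exp (-(1 / NN n)) with hr
  have r0 : 0 < r := Real.exp_pos _
  have r1 : r < 1 := by rw [hr, Real.exp_lt_one_iff]; simp; positivity
  have h1 : DiffContOnCl ℂ F (Metric.ball 0 |r|) := by
    apply DifferentiableOn.diffContOnCl
    apply hF.mono
    rw [closure_ball _ (by positivity), abs_of_pos r0]
    exact Metric.closedBall_subset_ball r1
  have h2 := h1.circleAverage
  rw [Real.circleAverage_def] at h2
  have h3 := intervalIntegral.integral_comp_mul_left (a := 0) (b := 1) (fun θ => F (circleMap 0 r θ)) (show 2 * Real.pi ≠ 0 by positivity)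
  rw [mul_zero, mul_one, h2] at h3
  simp only [← uu_circle, hr] at h3
  rw [← h3]
  have hint : IntervalIntegrable (fun x => F (uu n x)) volume 0 1 := by
    apply Continuous.intervalIntegrable
    apply hF.continuousOn.comp_continuous
    · unfold uu ss; fun_prop
    · intro x; simpa using uu_norm_lt n x
  rw [intervalIntegral.integral_of_le zero_le_one, intervalIntegral.integral_of_le zero_le_one]
  exact integral_re (𝕜 := ℂ) hint.1

theorem re_inv_pos {w : ℂ} (hw : ‖w‖ < 1) : 0 < (1 / (1 - w)).re := by
  have h1 : w.re < 1 := (Complex.re_le_norm w).trans_lt hw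
  rw [one_div, Complex.inv_re]
  apply div_pos
  · simp; exact h1
  · rw [Complex.normSq_pos]
    intro h
    have : w.re = 1 := by
      have := congrArg Complex.re h
      simp at this; linarith
    linarith

theorem one_sub_ne {w : ℂ} (hw : ‖w‖ < 1) : 1 - w ≠ 0 := by
  intro h
  rw [sub_eq_zero] at h
  rw [← h] at hw
  simp at hw

/-- `G_a` -/
noncomputable def GG (n : ℕ) (a : ℕ → ℂ) (z : ℂ) : ℂ :=
  (1 / (NN n : ℂ)) * ∑ k ∈ Finset.range (2 * n + 1), a k * (1 / (1 - z * cc (k / NN n)))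

theorem GG_diff (n : ℕ) (a : ℕ → ℂ) : DifferentiableOn ℂ (GG n a) (Metric.ball 0 1) := by
  unfold GG
  apply DifferentiableOn.const_mul
  apply DifferentiableOn.fun_sum
  intro k _
  apply DifferentiableOn.const_mul
  apply DifferentiableOn.div (by fun_prop) (by fun_prop)
  intro z hz
  apply one_sub_ne
  rw [norm_mul, cc_norm, mul_one]
  simpa using hz

/-- Poisson-type kernel -/
noncomputable def PK (n : ℕ) (y : ℝ) : ℝ := (1 / (1 - uu n y)).re

theorem PK_pos (n : ℕ) (y : ℝ) : 0 < PK n y := re_inv_pos (uu_norm_lt n y)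

theorem GG_re (n : ℕ) (a : ℕ → ℝ) (x : ℝ) :
    (GG n (fun k => (a k : ℂ)) (uu n x)).re = (1 / NN n) * ∑ k ∈ Finset.range (2 * n + 1), a k * PK n (x - k / NN n) := by
  unfold GG PK
  rw [show (1 / (NN n : ℂ)) = ((1 / NN n : ℝ) : ℂ) by push_cast; rfl, Complex.re_ofReal_mul, Complex.re_sum]
  congr 1
  refine Finset.sum_congr rfl fun k _ => ?_
  rw [Complex.re_ofReal_mul, uu_sub]

theorem PK_integral (n : ℕ) (t : ℝ) : ∫ x in (0:ℝ)..1, PK n (x - t) = 1 := by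
  have : DifferentiableOn ℂ (fun z => 1 / (1 - z * cc t)) (Metric.ball 0 1) := by
    apply DifferentiableOn.div (by fun_prop) (by fun_prop)
    intro z hz
    apply one_sub_ne
    rw [norm_mul, cc_norm, mul_one]
    simpa using hz
  have := mean_value n this
  simp only [← uu_sub] at this
  simpa [PK] using this

theorem cc_pow_sum (n : ℕ) {l : ℕ} (hl : l < 2 * n + 1) :
    ∑ k ∈ Finset.range (2 * n + 1), cc (k / NN n) ^ l = if l = 0 then (NN n : ℂ) else 0 := by
  have hN := NN_pos n
  split_ifs with h
  · simp [h, NN]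
  · have e : ∀ k : ℕ, cc (k / NN n) ^ l = (cc (l / NN n)) ^ k := by
      intro k
      rw [cc, cc, ← Complex.exp_nat_mul, ← Complex.exp_nat_mul]
      congr 1; push_cast; ring
    simp only [e]
    have h1 : cc (l / NN n) ^ (2 * n + 1) = 1 := by
      rw [cc, ← Complex.exp_nat_mul, Complex.exp_eq_one_iff]
      refine ⟨-l, ?_⟩
      have : (2 * (n:ℂ) + 1) ≠ 0 := by exact_mod_cast (show (2 * n + 1) ≠ 0 by omega)
      simp only [NN]; push_cast
      field_simp
    have h2 : cc (l / NN n) ≠ 1 := by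
      intro h2
      rw [cc, Complex.exp_eq_one_iff] at h2
      obtain ⟨m, hm⟩ := h2
      have h3 := congrArg Complex.im hm
      have hpi := Real.pi_pos
      rw [Complex.im_ofReal_mul, Complex.I_im, mul_one, show (m:ℂ) * (2 * (Real.pi : ℂ) * Complex.I) = ((m * (2 * Real.pi) : ℝ) : ℂ) * Complex.I by push_cast; ring,
        Complex.im_ofReal_mul, Complex.I_im, mul_one] at h3
      have h4' : (l : ℝ) / NN n = -m := by
        have : 2 * Real.pi * ((l : ℝ) / NN n + m) = 0 := by linarith
        rcases mul_eq_zero.1 this with h | h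
        · linarith
        · linarith
      have h4 : (l : ℝ) = -m * NN n := by rw [← h4']; field_simp
      have h5 : (l : ℤ) = -m * (2 * n + 1) := by
        have : (l:ℝ) = ((-m * (2 * n + 1) : ℤ) : ℝ) := by rw [h4]; push_cast; simp [NN]
        exact_mod_cast this
      have h6 : (2 * (n:ℤ) + 1) ∣ l := ⟨-m, by rw [h5]; ring⟩
      have h7 := Int.le_of_dvd (by omega) h6
      omega
    have := geom_sum_eq h2 (2 * n + 1)
    rw [this, h1]; simp

theorem cc_pow (n k : ℕ) : cc (k / NN n) ^ (2 * n + 1) = 1 := by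
  rw [cc, ← Complex.exp_nat_mul, Complex.exp_eq_one_iff]
  refine ⟨-k, ?_⟩
  have : (2 * (n:ℂ) + 1) ≠ 0 := by exact_mod_cast (show (2 * n + 1) ≠ 0 by omega)
  simp only [NN]; push_cast
  field_simp

theorem GG_one (n : ℕ) {z : ℂ} (hz : ‖z‖ < 1) : GG n (fun _ => 1) z = 1 / (1 - z ^ (2 * n + 1)) := by
  have hN := NN_pos n
  have hN' : (NN n : ℂ) ≠ 0 := by exact_mod_cast hN.ne'
  have hzN : ‖z ^ (2 * n + 1)‖ < 1 := by rw [norm_pow]; exact pow_lt_one₀ (norm_nonneg _) hz (by omega)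
  have h1 := one_sub_ne hzN
  rw [eq_div_iff h1, GG, mul_assoc, Finset.sum_mul]
  have : ∀ k ∈ Finset.range (2 * n + 1), 1 * (1 / (1 - z * cc (k / NN n))) * (1 - z ^ (2 * n + 1)) =
      ∑ l ∈ Finset.range (2 * n + 1), z ^ l * cc (k / NN n) ^ l := by
    intro k _
    have h2 : 1 - z * cc (k / NN n) ≠ 0 := one_sub_ne (by rw [norm_mul, cc_norm, mul_one]; exact hz)
    have h3 := mul_neg_geom_sum (z * cc (k / NN n)) (2 * n + 1)
    rw [mul_pow, cc_pow, mul_one] at h3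
    rw [← h3]
    simp only [mul_pow]
    field_simp
  rw [Finset.sum_congr rfl this, Finset.sum_comm]
  simp only [← Finset.mul_sum]
  rw [Finset.sum_congr rfl (fun l hl => by rw [cc_pow_sum n (Finset.mem_range.1 hl)])]
  simp only [mul_ite, mul_zero, Finset.sum_ite_eq', Finset.mem_range]
  rw [if_pos (by omega), pow_zero, one_mul, one_div_mul_cancel hN']

theorem PK_sum_le (n : ℕ) (x : ℝ) :
    (1 / NN n) * ∑ k ∈ Finset.range (2 * n + 1), PK n (x - k / NN n) ≤ 2 := by
  have hN := NN_pos n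
  have h := GG_re n (fun _ => 1) x
  simp only [one_mul, Complex.ofReal_one] at h
  rw [← h, GG_one n (uu_norm_lt n x)]
  refine (Complex.re_le_norm _).trans ?_
  rw [norm_div, norm_one, div_le_iff₀ (norm_pos_iff.2 (one_sub_ne (by rw [norm_pow]; exact pow_lt_one₀ (norm_nonneg _) (uu_norm_lt n x) (by omega))))]
  have h1 : ‖uu n x ^ (2 * n + 1)‖ = Real.exp (-1) := by
    rw [norm_pow, uu_norm, ← Real.exp_nat_mul]
    congr 1; unfold NN at *; push_cast; field_simp
  have h2 : 1 - ‖uu n x ^ (2 * n + 1)‖ ≤ ‖1 - uu n x ^ (2 * n + 1)‖ := by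
    have := norm_sub_norm_le (1:ℂ) (uu n x ^ (2 * n + 1))
    simpa using this
  have h3 : Real.exp (-1) ≤ 1 / 2 := by
    rw [Real.exp_neg, ← one_div]
    apply one_div_le_one_div_of_le (by norm_num)
    have := Real.add_one_le_exp (1:ℝ)
    linarith
  linarith

open MeasureTheory Filter Finset

/-- discrete norm of sequences -/
noncomputable def eb (p : ℝ) (n : ℕ) (b : ℕ → ℝ) : ℝ :=
  ((1 / NN n) * ∑ k ∈ Finset.range (2 * n + 1), |b k| ^ p) ^ (1 / p)

theorem eb_nonneg (p : ℝ) (n : ℕ) (f : ℕ → ℝ) : 0 ≤ eb p n f := by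
  have := NN_pos n
  unfold eb; positivity

theorem eb_rpow {p : ℝ} (hp : 1 < p) (n : ℕ) (f : ℕ → ℝ) :
    eb p n f ^ p = (1 / NN n) * ∑ k ∈ Finset.range (2 * n + 1), |f k| ^ p := by
  have := NN_pos n
  rw [eb, ← Real.rpow_mul (by positivity), one_div_mul_cancel (by linarith), Real.rpow_one]

theorem eb_mono {p : ℝ} (hp : 1 < p) (n : ℕ) {f g : ℕ → ℝ} (h : ∀ k, |f k| ≤ |g k|) : eb p n f ≤ eb p n g := by
  have := NN_pos n
  unfold eb
  apply Real.rpow_le_rpow (by positivity) _ (by positivity)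
  apply mul_le_mul_of_nonneg_left _ (by positivity)
  exact Finset.sum_le_sum fun k _ => Real.rpow_le_rpow (abs_nonneg _) (h k) (by linarith)

theorem jensen_fin {p : ℝ} (hp : 1 < p) (s : Finset ℕ) (w f : ℕ → ℝ) (hw : ∀ i, 0 ≤ w i) (hf : ∀ i, 0 ≤ f i) {c : ℝ}
    (hc : ∑ i ∈ s, w i ≤ c) : (∑ i ∈ s, f i * w i) ^ p ≤ c ^ (p - 1) * ∑ i ∈ s, w i * f i ^ p := by
  have h := Real.inner_le_weight_mul_Lp_of_nonneg s hp.le w f hw hf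
  have hp0 : 0 < p := by linarith
  have w0 : 0 ≤ ∑ i ∈ s, w i := Finset.sum_nonneg fun i _ => hw i
  have w1 : 0 ≤ ∑ i ∈ s, w i * f i ^ p := Finset.sum_nonneg fun i _ => mul_nonneg (hw i) (Real.rpow_nonneg (hf i) _)
  have h2 := Real.rpow_le_rpow (Finset.sum_nonneg fun i _ => mul_nonneg (hw i) (hf i)) h hp0.le
  rw [Real.mul_rpow (by positivity) (by positivity), ← Real.rpow_mul w0, ← Real.rpow_mul w1, inv_mul_cancel₀ hp0.ne', Real.rpow_one] at h2
  simp only [mul_comm (f _)]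
  refine h2.trans ?_
  apply mul_le_mul_of_nonneg_right _ w1
  rw [show (1 - p⁻¹) * p = p - 1 by field_simp]
  exact Real.rpow_le_rpow w0 hc (by linarith)

theorem GG_uu_cont (n : ℕ) (a : ℕ → ℂ) : Continuous (fun x => GG n a (uu n x)) := by
  apply (GG_diff n a).continuousOn.comp_continuous
  · unfold uu ss; fun_prop
  · intro x; simpa using uu_norm_lt n x

theorem GG_uu_bm (n : ℕ) (a : ℕ → ℂ) : BM (fun x => ‖GG n a (uu n x)‖) := by
  refine ⟨(GG_uu_cont n a).norm.measurable, ?_⟩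
  have hN := NN_pos n
  have r1 : Real.exp (-(1 / NN n)) < 1 := by rw [Real.exp_lt_one_iff]; simp; positivity
  obtain ⟨C, hC⟩ := (isCompact_closedBall (0:ℂ) (Real.exp (-(1 / NN n)))).exists_bound_of_continuousOn
    ((GG_diff n a).continuousOn.mono (Metric.closedBall_subset_ball r1))
  refine ⟨C, fun x => ?_⟩
  rw [abs_norm]
  apply hC
  simp [uu_norm]

theorem PK_cont (n : ℕ) (t : ℝ) : Continuous (fun x => PK n (x - t)) := by
  unfold PK
  refine Complex.continuous_re.comp (Continuous.div continuous_const ?_ fun x => one_sub_ne (uu_norm_lt n _))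
  unfold uu ss; fun_prop

theorem re_G_int {p : ℝ} (hp : 1 < p) (n : ℕ) (a : ℕ → ℝ) (ha : ∀ k, 0 ≤ a k) :
    ∫ x in (0:ℝ)..1, (GG n (fun k => (a k : ℂ)) (uu n x)).re ^ p ≤ 2 ^ (p - 1) * ((1 / NN n) * ∑ k ∈ Finset.range (2 * n + 1), a k ^ p) := by
  have hN := NN_pos n
  have e : ∀ x, (GG n (fun k => (a k : ℂ)) (uu n x)).re ^ p ≤
      2 ^ (p - 1) * ∑ k ∈ Finset.range (2 * n + 1), (1 / NN n) * PK n (x - k / NN n) * a k ^ p := by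
    intro x
    rw [GG_re, Finset.mul_sum]
    have := jensen_fin hp (Finset.range (2 * n + 1)) (fun k => (1 / NN n) * PK n (x - k / NN n)) a
      (fun k => mul_nonneg (by positivity) (PK_pos _ _).le) ha (c := 2) (by rw [← Finset.mul_sum]; exact PK_sum_le n x)
    refine le_trans (le_of_eq ?_) this
    congr 1
    exact Finset.sum_congr rfl fun k _ => by ring
  have c1 : Continuous (fun x => (GG n (fun k => (a k : ℂ)) (uu n x)).re ^ p) :=
    (Complex.continuous_re.comp (GG_uu_cont n _)).rpow_const (fun x => Or.inr (by linarith))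
  have c2 : ∀ k : ℕ, Continuous (fun x => (1 / NN n) * PK n (x - k / NN n) * a k ^ p) := fun k =>
    ((PK_cont n _).const_mul _).mul_const _
  refine (intervalIntegral.integral_mono zero_le_one (c1.intervalIntegrable _ _) ?_ e).trans (le_of_eq ?_)
  · exact (continuous_const.mul (continuous_finsetSum _ fun k _ => c2 k)).intervalIntegrable _ _
  · rw [intervalIntegral.integral_const_mul, intervalIntegral.integral_finsetSum (fun k _ => (c2 k).intervalIntegrable _ _)]
    congr 1
    rw [Finset.mul_sum]
    refine Finset.sum_congr rfl fun k _ => ?_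
    rw [intervalIntegral.integral_mul_const, intervalIntegral.integral_const_mul, PK_integral, mul_one]

theorem GG_nonneg_bound {p : ℝ} (hp : 1 < p) (hp2 : p ≤ 2) :
    ∃ C : ℝ, 0 < C ∧ ∀ (n : ℕ) (a : ℕ → ℝ), (∀ k, 0 ≤ a k) →
      LpNorm p (fun x => ‖GG n (fun k => (a k : ℂ)) (uu n x)‖) ≤ C * eb p n a := by
  obtain ⟨A, B, hA, hB, hAB⟩ := pointwise_riesz hp hp2
  have hp0 : 0 < p := by linarith
  refine ⟨(A * 2 ^ (p - 1)) ^ (1 / p), by positivity, fun n a ha => ?_⟩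
  have hN := NN_pos n
  apply LpNorm_le_of_rpow hp (mul_nonneg (by positivity) (eb_nonneg _ _ _))
  rw [Real.mul_rpow (by positivity) (eb_nonneg _ _ _), ← Real.rpow_mul (by positivity), one_div_mul_cancel hp0.ne', Real.rpow_one,
    eb_rpow hp]
  simp only [abs_norm, abs_of_nonneg (ha _)]
  by_cases h0 : ∀ k ∈ Finset.range (2 * n + 1), a k = 0
  · have : ∀ z, GG n (fun k => (a k : ℂ)) z = 0 := by
      intro z
      unfold GG
      rw [Finset.sum_eq_zero, mul_zero]
      intro k hk
      simp [h0 k hk]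
    simp only [this, norm_zero, Real.zero_rpow hp0.ne']
    rw [Finset.sum_eq_zero]
    · simp
    · intro k hk; rw [h0 k hk, Real.zero_rpow hp0.ne']
  push Not at h0
  obtain ⟨k0, hk0, hak0⟩ := h0
  have hpos : ∀ z ∈ Metric.ball (0:ℂ) 1, 0 < (GG n (fun k => (a k : ℂ)) z).re := by
    intro z hz
    have hP : ∀ k : ℕ, 0 < (1 / (1 - z * cc (k / NN n))).re := fun k =>
      re_inv_pos (by rw [norm_mul, cc_norm, mul_one]; simpa using hz)
    unfold GG
    rw [show (1 / (NN n : ℂ)) = ((1 / NN n : ℝ) : ℂ) by push_cast; rfl, Complex.re_ofReal_mul, Complex.re_sum]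
    apply mul_pos (by positivity)
    apply Finset.sum_pos'
    · intro k _
      rw [Complex.re_ofReal_mul]
      exact mul_nonneg (ha k) (hP k).le
    · refine ⟨k0, hk0, ?_⟩
      rw [Complex.re_ofReal_mul]
      exact mul_pos (lt_of_le_of_ne (ha k0) (Ne.symm hak0)) (hP k0)
  have hd : DifferentiableOn ℂ (fun z => GG n (fun k => (a k : ℂ)) z ^ (p : ℂ)) (Metric.ball 0 1) := by
    apply (GG_diff n _).cpow_const
    intro z hz
    exact Or.inl (hpos z hz)
  have hmv := mean_value n hd
  have hG0 : 0 ≤ (GG n (fun k => (a k : ℂ)) 0 ^ (p : ℂ)).re := by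
    have : GG n (fun k => (a k : ℂ)) 0 = (((1 / NN n) * ∑ k ∈ Finset.range (2 * n + 1), a k : ℝ) : ℂ) := by
      unfold GG; push_cast; simp
    rw [this, ← Complex.ofReal_cpow, Complex.ofReal_re]
    · apply Real.rpow_nonneg
      have := Finset.sum_nonneg (s := Finset.range (2 * n + 1)) fun k _ => ha k
      positivity
    · have := Finset.sum_nonneg (s := Finset.range (2 * n + 1)) fun k _ => ha k
      positivity
  have hub : ∀ x, uu n x ∈ Metric.ball (0:ℂ) 1 := fun x => by simpa using uu_norm_lt n x
  have c1 : Continuous (fun x => ‖GG n (fun k => (a k : ℂ)) (uu n x)‖ ^ p) :=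
    (GG_uu_cont n _).norm.rpow_const (fun x => Or.inr hp0.le)
  have c2 : Continuous (fun x => (GG n (fun k => (a k : ℂ)) (uu n x)).re ^ p) :=
    (Complex.continuous_re.comp (GG_uu_cont n _)).rpow_const (fun x => Or.inr hp0.le)
  have c3 : Continuous (fun x => (GG n (fun k => (a k : ℂ)) (uu n x) ^ (p : ℂ)).re) := by
    refine Complex.continuous_re.comp (hd.continuousOn.comp_continuous ?_ hub)
    unfold uu ss; fun_prop
  have h1 := intervalIntegral.integral_mono (μ := volume) (zero_le_one (α := ℝ)) (c1.intervalIntegrable _ _)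
    (((c2.const_mul A).sub (c3.const_mul B)).intervalIntegrable _ _) (fun x => hAB _ (hpos _ (hub x)))
  simp only [Pi.sub_apply] at h1
  rw [intervalIntegral.integral_sub ((c2.const_mul A).intervalIntegrable _ _) ((c3.const_mul B).intervalIntegrable _ _),
    intervalIntegral.integral_const_mul, intervalIntegral.integral_const_mul, hmv] at h1
  have h2 := mul_le_mul_of_nonneg_left (re_G_int hp n a ha) hA.le
  have h3 := mul_nonneg hB hG0
  refine h1.trans ?_
  linarith

theorem GG_bound {p : ℝ} (hp : 1 < p) (hp2 : p ≤ 2) :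
    ∃ C : ℝ, 0 < C ∧ ∀ (n : ℕ) (a : ℕ → ℂ),
      LpNorm p (fun x => ‖GG n a (uu n x)‖) ≤ C * eb p n (fun k => ‖a k‖) := by
  obtain ⟨C, hC, h⟩ := GG_nonneg_bound hp hp2
  refine ⟨4 * C, by positivity, fun n a => ?_⟩
  set a1 : ℕ → ℝ := fun k => max (a k).re 0
  set a2 : ℕ → ℝ := fun k => max (-(a k).re) 0
  set a3 : ℕ → ℝ := fun k => max (a k).im 0
  set a4 : ℕ → ℝ := fun k => max (-(a k).im) 0
  have hd : ∀ k, a k = (a1 k : ℂ) - a2 k + Complex.I * (a3 k - a4 k) := by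
    intro k
    have e1 : a1 k - a2 k = (a k).re := by simp only [a1, a2]; rcases le_total (a k).re 0 with h | h <;> simp [h]
    have e2 : a3 k - a4 k = (a k).im := by simp only [a3, a4]; rcases le_total (a k).im 0 with h | h <;> simp [h]
    rw [← Complex.ofReal_sub, ← Complex.ofReal_sub, e1, e2, mul_comm, Complex.re_add_im]
  have hsplit : ∀ z, GG n a z = GG n (fun k => (a1 k : ℂ)) z - GG n (fun k => (a2 k : ℂ)) z +
      Complex.I * (GG n (fun k => (a3 k : ℂ)) z - GG n (fun k => (a4 k : ℂ)) z) := by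
    intro z
    simp only [GG, ← mul_sub, ← Finset.sum_sub_distrib]
    rw [← mul_left_comm, ← mul_add, Finset.mul_sum _ _ Complex.I, ← Finset.sum_add_distrib]
    congr 1
    refine Finset.sum_congr rfl fun k _ => ?_
    rw [hd k]; ring
  have b1 := GG_uu_bm n (fun k => (a1 k : ℂ))
  have b2 := GG_uu_bm n (fun k => (a2 k : ℂ))
  have b3 := GG_uu_bm n (fun k => (a3 k : ℂ))
  have b4 := GG_uu_bm n (fun k => (a4 k : ℂ))
  have h1 : LpNorm p (fun x => ‖GG n a (uu n x)‖) ≤ LpNorm p (fun x => (‖GG n (fun k => (a1 k : ℂ)) (uu n x)‖ + ‖GG n (fun k => (a2 k : ℂ)) (uu n x)‖) + (‖GG n (fun k => (a3 k : ℂ)) (uu n x)‖ + ‖GG n (fun k => (a4 k : ℂ)) (uu n x)‖)) := by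
    apply LpNorm_mono hp ((b1.add b2).add (b3.add b4))
    intro x
    rw [abs_norm, abs_of_nonneg (by positivity), hsplit]
    refine (norm_add_le _ _).trans (add_le_add (norm_sub_le _ _) ?_)
    rw [norm_mul, Complex.norm_I, one_mul]
    exact norm_sub_le _ _
  have h2 := LpNorm_add_le hp (b1.add b2) (b3.add b4)
  have h3 := LpNorm_add_le hp b1 b2
  have h4 := LpNorm_add_le hp b3 b4
  have key : ∀ a' : ℕ → ℝ, (∀ k, 0 ≤ a' k) → (∀ k, a' k ≤ ‖a k‖) → LpNorm p (fun x => ‖GG n (fun k => (a' k : ℂ)) (uu n x)‖) ≤ C * eb p n (fun k => ‖a k‖) := by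
    intro a' h0 hle
    refine (h n a' h0).trans (mul_le_mul_of_nonneg_left ?_ hC.le)
    apply eb_mono hp
    intro k
    rw [abs_of_nonneg (h0 k), abs_norm]; exact hle k
  have k1 := key a1 (fun k => le_max_right _ _) (fun k => max_le (Complex.re_le_norm _) (norm_nonneg _))
  have k2 := key a2 (fun k => le_max_right _ _) (fun k => max_le ((neg_le_abs _).trans (Complex.abs_re_le_norm _)) (norm_nonneg _))
  have k3 := key a3 (fun k => le_max_right _ _) (fun k => max_le ((le_abs_self _).trans (Complex.abs_im_le_norm _)) (norm_nonneg _))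
  have k4 := key a4 (fun k => le_max_right _ _) (fun k => max_le ((neg_le_abs _).trans (Complex.abs_im_le_norm _)) (norm_nonneg _))
  linarith

open MeasureTheory Filter Finset

noncomputable def vv (l : ℕ) : ℝ := if l = 0 then 1 else 2

noncomputable def cA (n : ℕ) (b : ℕ → ℝ) (l : ℕ) : ℝ :=
  vv l * ((1 / NN n) * ∑ k ∈ Finset.range (2 * n + 1), b k * Real.cos (2 * Real.pi * l * (k / NN n)))

noncomputable def cB (n : ℕ) (b : ℕ → ℝ) (l : ℕ) : ℝ :=
  vv l * ((1 / NN n) * ∑ k ∈ Finset.range (2 * n + 1), b k * Real.sin (2 * Real.pi * l * (k / NN n)))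

theorem tp_phi (n : ℕ) (b φ : ℕ → ℝ) (x : ℝ) :
    tp n (fun l => φ l * cA n b l) (fun l => φ l * cB n b l) x =
      (1 / NN n) * ∑ k ∈ Finset.range (2 * n + 1), b k *
        ∑ l ∈ Finset.range (n + 1), vv l * (φ l * Real.cos (2 * Real.pi * l * (x - k / NN n))) := by
  unfold tp cA cB
  simp only [Finset.mul_sum, Finset.sum_mul, ← Finset.sum_add_distrib]
  rw [Finset.sum_comm]
  refine Finset.sum_congr rfl fun k _ => Finset.sum_congr rfl fun l _ => ?_
  rw [mul_sub, Real.cos_sub]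
  ring

theorem dirichlet_eq (n : ℕ) (x : ℝ) :
    dirichlet n x = ∑ l ∈ Finset.range (n + 1), vv l * Real.cos (2 * Real.pi * l * x) := by
  unfold dirichlet
  rw [Finset.sum_Icc_of_even_eq_range (f := fun l : ℤ => Real.cos (2 * Real.pi * (l:ℝ) * x))]
  · rw [Finset.sum_range_succ', Finset.sum_range_succ']
    simp only [vv]
    simp [Finset.mul_sum]
    ring
  · intro l
    simp only [Int.cast_neg]
    rw [← Real.cos_neg]; congr 1; ring

/-- trigonometric interpolant of a sequence -/
noncomputable def lag (n : ℕ) (b : ℕ → ℝ) : ℝ → ℝ := tp n (cA n b) (cB n b)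

theorem lag_eq (n : ℕ) (b : ℕ → ℝ) (x : ℝ) :
    lag n b x = (1 / NN n) * ∑ k ∈ Finset.range (2 * n + 1), b k * dirichlet n (x - k / NN n) := by
  have := tp_phi n b (fun _ => 1) x
  simp only [one_mul] at this
  simp only [lag, this, dirichlet_eq]

theorem lagrange_eq (n : ℕ) (f : ℝ → ℝ) : lagrange n f = lag n (fun k => f (k / NN n)) := by
  ext x
  rw [lag_eq, lagrange]

theorem cosh_sum (n : ℕ) (s : ℂ) :
    ∑ j ∈ Finset.range (2 * n + 1), Complex.exp s ^ j =
      Complex.exp s ^ n * ∑ l ∈ Finset.range (n + 1), (vv l : ℂ) * Complex.cosh (l * s) := by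
  induction n with
  | zero => simp [vv]
  | succ n ih =>
    rw [show 2 * (n + 1) + 1 = (2 * n + 1) + 1 + 1 by ring, Finset.sum_range_succ, Finset.sum_range_succ']
    rw [Finset.sum_range_succ _ (n + 1), mul_add, pow_succ _ n, mul_right_comm _ (Complex.exp s), ← ih]
    simp only [pow_succ _ (_ : ℕ), ← Finset.sum_mul]
    have hv : (vv (n + 1) : ℂ) = 2 := by simp [vv]
    have h1 : Complex.exp (((n + 1 : ℕ) : ℂ) * s) = Complex.exp s ^ n * Complex.exp s := by
      rw [Complex.exp_nat_mul, pow_succ]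
    have h2 : Complex.exp (-(((n + 1 : ℕ) : ℂ) * s)) * (Complex.exp s ^ n * Complex.exp s) = 1 := by
      rw [← h1, ← Complex.exp_add]; simp
    rw [hv, Complex.cosh, h1]
    have h3 : Complex.exp s ^ (2 * n) = Complex.exp s ^ n * Complex.exp s ^ n := by rw [two_mul, pow_add]
    simp only [pow_zero, h3]
    linear_combination -h2

theorem ss_cosh (n l : ℕ) (y : ℝ) :
    (Complex.cosh (l * ss n y)).re = Real.cosh (fr n l) * Real.cos (2 * Real.pi * l * y) := by
  have : (l : ℂ) * ss n y = ((-(fr n l) : ℝ) : ℂ) + ((2 * Real.pi * l * y : ℝ) : ℂ) * Complex.I := by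
    unfold ss fr NN; push_cast; ring
  rw [this, Complex.cosh_add, Complex.cosh_mul_I, Complex.sinh_mul_I, ← Complex.ofReal_cosh, ← Complex.ofReal_sinh,
    ← Complex.ofReal_cos, ← Complex.ofReal_sin, ← mul_assoc, ← Complex.ofReal_mul, ← Complex.ofReal_mul,
    Complex.add_re, Complex.re_ofReal_mul, Complex.I_re, mul_zero, add_zero, Complex.ofReal_re, Real.cosh_neg]

theorem cosh_lag_le (n : ℕ) (b : ℕ → ℝ) (x : ℝ) :
    |tp n (fun l => Real.cosh (fr n l) * cA n b l) (fun l => Real.cosh (fr n l) * cB n b l) x| ≤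
      (Real.exp 1 * 2) * ‖GG n (fun k => (b k : ℂ) * (cc (k / NN n) ^ n)⁻¹) (uu n x)‖ := by
  have hN := NN_pos n
  set u := uu n x with hu
  have hu0 : u ≠ 0 := Complex.exp_ne_zero _
  have e1 : ∀ k ∈ Finset.range (2 * n + 1), (b k : ℂ) * ∑ l ∈ Finset.range (n + 1), (vv l : ℂ) * Complex.cosh (l * ss n (x - k / NN n))
      = (u ^ n)⁻¹ * (1 - u ^ (2 * n + 1)) * ((b k : ℂ) * (cc (k / NN n) ^ n)⁻¹ * (1 / (1 - u * cc (k / NN n)))) := by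
    intro k _
    have h1 := cosh_sum n (ss n (x - k / NN n))
    change ∑ j ∈ Finset.range (2 * n + 1), uu n (x - k / NN n) ^ j = uu n (x - k / NN n) ^ n * _ at h1
    rw [uu_sub, ← hu] at h1
    generalize (∑ l ∈ Finset.range (n + 1), (vv l : ℂ) * Complex.cosh (l * ss n (x - k / NN n))) = S at h1 ⊢
    have h2 : 1 - u * cc (k / NN n) ≠ 0 := one_sub_ne (by rw [norm_mul, cc_norm, mul_one]; exact uu_norm_lt n x)
    have h3 := mul_neg_geom_sum (u * cc (k / NN n)) (2 * n + 1)
    rw [h1, mul_pow _ _ (2 * n + 1), cc_pow, mul_one, mul_pow] at h3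
    have hc0 : cc (k / NN n) ≠ 0 := Complex.exp_ne_zero _
    rw [← h3]
    generalize cc (k / NN n) = c at *
    field_simp
  have e2 : ((tp n (fun l => Real.cosh (fr n l) * cA n b l) (fun l => Real.cosh (fr n l) * cB n b l) x)) =
      ((u ^ n)⁻¹ * (1 - u ^ (2 * n + 1)) * GG n (fun k => (b k : ℂ) * (cc (k / NN n) ^ n)⁻¹) u).re := by
    rw [GG, mul_left_comm, Finset.mul_sum, ← Finset.sum_congr rfl e1, tp_phi,
      show (1 / (NN n : ℂ)) = ((1 / NN n : ℝ) : ℂ) by push_cast; rfl, Complex.re_ofReal_mul, Complex.re_sum]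
    congr 1
    refine Finset.sum_congr rfl fun k _ => ?_
    rw [Complex.re_ofReal_mul, Complex.re_sum]
    congr 1
    refine Finset.sum_congr rfl fun l _ => ?_
    rw [Complex.re_ofReal_mul, ss_cosh]
  rw [e2]
  refine (Complex.abs_re_le_norm _).trans ?_
  rw [norm_mul, norm_mul]
  apply mul_le_mul_of_nonneg_right _ (norm_nonneg _)
  apply mul_le_mul _ _ (norm_nonneg _) (Real.exp_pos _).le
  · rw [norm_inv, norm_pow, hu, uu_norm, ← Real.exp_nat_mul, ← Real.exp_neg]
    apply Real.exp_le_exp.2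
    unfold NN at *
    rw [mul_neg, neg_neg, mul_one_div, div_le_one hN]
    have : (0:ℝ) ≤ n := by positivity
    linarith
  · refine (norm_sub_le _ _).trans ?_
    rw [norm_one, norm_pow]
    have := pow_le_one₀ (n := 2 * n + 1) (norm_nonneg u) (uu_norm_lt n x).le
    linarith

theorem hardMZ_low {p : ℝ} (hp : 1 < p) (hp2 : p ≤ 2) :
    ∃ C : ℝ, 0 < C ∧ ∀ (n : ℕ) (b : ℕ → ℝ), LpNorm p (lag n b) ≤ C * eb p n b := by
  obtain ⟨C, hC, h⟩ := GG_bound hp hp2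
  refine ⟨7 / 2 * ((Real.exp 1 * 2) * C), by positivity, fun n b => ?_⟩
  have h1 := mult_inv hp (by norm_num) (mult_one_sub_cosh hp n) (cA n b) (cB n b)
  have h2 := h n (fun k => (b k : ℂ) * (cc (k / NN n) ^ n)⁻¹)
  have h3 : eb p n (fun k => ‖(b k : ℂ) * (cc (k / NN n) ^ n)⁻¹‖) = eb p n b := by
    unfold eb
    simp [cc_norm]
  rw [h3] at h2
  have h4 := LpNorm_mono hp ((GG_uu_bm n (fun k => (b k : ℂ) * (cc (k / NN n) ^ n)⁻¹)).const_mul (Real.exp 1 * 2))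
    (fun x => (cosh_lag_le n b x).trans (le_abs_self _))
  rw [LpNorm_const_mul hp, abs_of_pos (by positivity)] at h4
  have h5 := mul_le_mul_of_nonneg_left h2 (show 0 ≤ Real.exp 1 * 2 by positivity)
  have h6 : (1 - 5 / 7 : ℝ)⁻¹ = 7 / 2 := by norm_num
  rw [h6] at h1
  unfold lag
  linarith

theorem cos_sum_nat (n : ℕ) {j : ℕ} (hj : j < 2 * n + 1) :
    (∑ k ∈ Finset.range (2 * n + 1), Real.cos (2 * Real.pi * j * (k / NN n)) = if j = 0 then NN n else 0) ∧
    (∑ k ∈ Finset.range (2 * n + 1), Real.sin (2 * Real.pi * j * (k / NN n)) = 0) := by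
  have h := cc_pow_sum n hj
  have e : ∀ k : ℕ, cc (k / NN n) ^ j = ((Real.cos (2 * Real.pi * j * (k / NN n)) : ℝ) : ℂ) + ((-Real.sin (2 * Real.pi * j * (k / NN n)) : ℝ) : ℂ) * Complex.I := by
    intro k
    rw [cc, ← Complex.exp_nat_mul, ← Real.cos_neg, ← Real.sin_neg, Complex.ofReal_cos, Complex.ofReal_sin, ← Complex.exp_mul_I]
    congr 1; push_cast; ring
  simp only [e] at h
  rw [Finset.sum_add_distrib, ← Finset.sum_mul, ← Complex.ofReal_sum, ← Complex.ofReal_sum] at h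
  constructor
  · have := congrArg Complex.re h
    rw [Complex.add_re, Complex.re_ofReal_mul, Complex.I_re, mul_zero, add_zero, Complex.ofReal_re] at this
    rw [this]
    split_ifs
    · exact Complex.ofReal_re _
    · simp
  · have := congrArg Complex.im h
    rw [Complex.add_im, Complex.im_ofReal_mul, Complex.I_im, mul_one, Complex.ofReal_im, zero_add, Finset.sum_neg_distrib] at this
    have h2 : (if j = 0 then (NN n : ℂ) else 0).im = 0 := by
      split_ifs
      · exact Complex.ofReal_im _
      · simp
    rw [h2] at this
    linarith

theorem cos_sum_int (n : ℕ) {j : ℤ} (hj : j.natAbs < 2 * n + 1) (α : ℝ) :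
    ∑ k ∈ Finset.range (2 * n + 1), Real.cos (2 * Real.pi * j * (k / NN n) + α) = if j = 0 then NN n * Real.cos α else 0 := by
  obtain ⟨h1, h2⟩ := cos_sum_nat n hj
  have h3 : ∑ k ∈ Finset.range (2 * n + 1), Real.cos (2 * Real.pi * j * (k / NN n)) = if j = 0 then NN n else 0 := by
    rcases Int.natAbs_eq j with h | h
    · have : (j : ℝ) = j.natAbs := by rw [h]; simp
      simp only [this, h1, Int.natAbs_eq_zero]
    · have : (j : ℝ) = -(j.natAbs : ℝ) := by rw [h]; simp
      simp only [this, mul_neg, neg_mul, Real.cos_neg, h1, Int.natAbs_eq_zero]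
  have h4 : ∑ k ∈ Finset.range (2 * n + 1), Real.sin (2 * Real.pi * j * (k / NN n)) = 0 := by
    rcases Int.natAbs_eq j with h | h
    · have : (j : ℝ) = j.natAbs := by rw [h]; simp
      simp only [this, h2]
    · have : (j : ℝ) = -(j.natAbs : ℝ) := by rw [h]; simp
      simp only [this, mul_neg, neg_mul, Real.sin_neg, h2, Finset.sum_neg_distrib, neg_zero]
  simp only [Real.cos_add, Finset.sum_sub_distrib, ← Finset.sum_mul, h3, h4]
  split_ifs <;> simp

theorem sin_sum_int (n : ℕ) {j : ℤ} (hj : j.natAbs < 2 * n + 1) (α : ℝ) :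
    ∑ k ∈ Finset.range (2 * n + 1), Real.sin (2 * Real.pi * j * (k / NN n) + α) = if j = 0 then NN n * Real.sin α else 0 := by
  have := cos_sum_int n hj (α - Real.pi / 2)
  simp only [← add_sub_assoc, Real.cos_sub_pi_div_two] at this
  exact this

theorem repro_cos (n : ℕ) {m l : ℕ} (hm : m ≤ n) (hl : l ≤ n) (x : ℝ) :
    vv l * ∑ k ∈ Finset.range (2 * n + 1), Real.cos (2 * Real.pi * m * (k / NN n)) * Real.cos (2 * Real.pi * l * (x - k / NN n)) =
      if l = m then NN n * Real.cos (2 * Real.pi * m * x) else 0 := by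
  have h1 := cos_sum_int n (j := (m : ℤ) - l) (by omega) (2 * Real.pi * l * x)
  have h2 := cos_sum_int n (j := (m : ℤ) + l) (by omega) (-(2 * Real.pi * l * x))
  have e : ∀ k : ℕ, Real.cos (2 * Real.pi * m * (k / NN n)) * Real.cos (2 * Real.pi * l * (x - k / NN n)) =
      (Real.cos (2 * Real.pi * ((m : ℤ) - l : ℤ) * (k / NN n) + 2 * Real.pi * l * x) + Real.cos (2 * Real.pi * ((m : ℤ) + l : ℤ) * (k / NN n) + -(2 * Real.pi * l * x))) / 2 := by
    intro k
    rw [show 2 * Real.pi * ((m : ℤ) - l : ℤ) * (k / NN n) + 2 * Real.pi * l * x = 2 * Real.pi * m * (k / NN n) + 2 * Real.pi * l * (x - k / NN n) by push_cast; ring,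
      show 2 * Real.pi * ((m : ℤ) + l : ℤ) * (k / NN n) + -(2 * Real.pi * l * x) = 2 * Real.pi * m * (k / NN n) - 2 * Real.pi * l * (x - k / NN n) by push_cast; ring,
      Real.cos_add, Real.cos_sub]
    ring
  simp only [e]
  rw [← Finset.sum_div, Finset.sum_add_distrib, h1, h2, Real.cos_neg]
  by_cases h : l = m
  · subst h
    by_cases h0 : l = 0
    · subst h0; simp [vv]
    · have : ¬ ((l : ℤ) + l = 0) := by omega
      simp [vv, h0, this]
      ring
  · have a1 : ¬ ((m : ℤ) - l = 0) := by omega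
    have a2 : ¬ ((m : ℤ) + l = 0) := by omega
    simp only [h, a1, a2, if_false]; simp

theorem repro_sin (n : ℕ) {m l : ℕ} (hm : m ≤ n) (hl : l ≤ n) (x : ℝ) :
    vv l * ∑ k ∈ Finset.range (2 * n + 1), Real.sin (2 * Real.pi * m * (k / NN n)) * Real.cos (2 * Real.pi * l * (x - k / NN n)) =
      if l = m then NN n * Real.sin (2 * Real.pi * m * x) else 0 := by
  have h1 := sin_sum_int n (j := (m : ℤ) - l) (by omega) (2 * Real.pi * l * x)
  have h2 := sin_sum_int n (j := (m : ℤ) + l) (by omega) (-(2 * Real.pi * l * x))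
  have e : ∀ k : ℕ, Real.sin (2 * Real.pi * m * (k / NN n)) * Real.cos (2 * Real.pi * l * (x - k / NN n)) =
      (Real.sin (2 * Real.pi * ((m : ℤ) - l : ℤ) * (k / NN n) + 2 * Real.pi * l * x) + Real.sin (2 * Real.pi * ((m : ℤ) + l : ℤ) * (k / NN n) + -(2 * Real.pi * l * x))) / 2 := by
    intro k
    rw [show 2 * Real.pi * ((m : ℤ) - l : ℤ) * (k / NN n) + 2 * Real.pi * l * x = 2 * Real.pi * m * (k / NN n) + 2 * Real.pi * l * (x - k / NN n) by push_cast; ring,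
      show 2 * Real.pi * ((m : ℤ) + l : ℤ) * (k / NN n) + -(2 * Real.pi * l * x) = 2 * Real.pi * m * (k / NN n) - 2 * Real.pi * l * (x - k / NN n) by push_cast; ring,
      Real.sin_add, Real.sin_sub]
    ring
  simp only [e]
  rw [← Finset.sum_div, Finset.sum_add_distrib, h1, h2, Real.sin_neg]
  by_cases h : l = m
  · subst h
    by_cases h0 : l = 0
    · subst h0; simp [vv]
    · have : ¬ ((l : ℤ) + l = 0) := by omega
      simp [vv, h0, this]
      ring
  · have a1 : ¬ ((m : ℤ) - l = 0) := by omega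
    have a2 : ¬ ((m : ℤ) + l = 0) := by omega
    simp only [h, a1, a2, if_false]; simp

/-- reproduction of trigonometric polynomials -/
theorem lag_tp (n : ℕ) (a b : ℕ → ℝ) : lag n (fun k => tp n a b (k / NN n)) = tp n a b := by
  ext x
  have hN := NN_pos n
  rw [lag_eq]
  simp only [dirichlet_eq]
  have e : ∀ k : ℕ, tp n a b (k / NN n) * ∑ l ∈ Finset.range (n + 1), vv l * Real.cos (2 * Real.pi * l * (x - k / NN n)) =
      ∑ m ∈ Finset.range (n + 1), ∑ l ∈ Finset.range (n + 1),
        (a m * (vv l * (Real.cos (2 * Real.pi * m * (k / NN n)) * Real.cos (2 * Real.pi * l * (x - k / NN n)))) +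
         b m * (vv l * (Real.sin (2 * Real.pi * m * (k / NN n)) * Real.cos (2 * Real.pi * l * (x - k / NN n))))) := by
    intro k
    rw [tp, Finset.sum_mul_sum]
    refine Finset.sum_congr rfl fun m _ => Finset.sum_congr rfl fun l _ => ?_
    ring
  simp only [e]
  rw [Finset.sum_comm, tp, Finset.mul_sum]
  refine Finset.sum_congr rfl fun m hm => ?_
  have hm' : m ≤ n := by simpa [Nat.lt_succ_iff] using hm
  rw [Finset.sum_comm]
  have e2 : ∀ l ∈ Finset.range (n + 1), ∑ k ∈ Finset.range (2 * n + 1), (a m * (vv l * (Real.cos (2 * Real.pi * m * (k / NN n)) * Real.cos (2 * Real.pi * l * (x - k / NN n)))) +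
         b m * (vv l * (Real.sin (2 * Real.pi * m * (k / NN n)) * Real.cos (2 * Real.pi * l * (x - k / NN n))))) =
      if l = m then NN n * (a m * Real.cos (2 * Real.pi * m * x) + b m * Real.sin (2 * Real.pi * m * x)) else 0 := by
    intro l hl
    have hl' : l ≤ n := by simpa [Nat.lt_succ_iff] using hl
    rw [Finset.sum_add_distrib, ← Finset.mul_sum, ← Finset.mul_sum, ← Finset.mul_sum, ← Finset.mul_sum,
      repro_cos n hm' hl', repro_sin n hm' hl']
    split_ifs <;> ring
  rw [Finset.sum_congr rfl e2, Finset.sum_ite_eq', if_pos hm, ← mul_assoc, one_div_mul_cancel hN.ne', one_mul]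

open MeasureTheory Filter Finset

/-- even trigonometric kernel -/
noncomputable def ek (n : ℕ) (w : ℕ → ℝ) (x : ℝ) : ℝ :=
  ∑ l ∈ Finset.range (n + 1), w l * Real.cos (2 * Real.pi * l * x)

theorem ek_tp (n : ℕ) (w : ℕ → ℝ) : ek n w = tp n w (fun _ => 0) := by
  ext x; simp [ek, tp]

theorem ek_bp (n : ℕ) (w : ℕ → ℝ) : BP (ek n w) := by rw [ek_tp]; exact tp_bp _ _ _

theorem ek_neg (n : ℕ) (w : ℕ → ℝ) (x : ℝ) : ek n w (-x) = ek n w x := by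
  simp [ek, mul_neg, Real.cos_neg]

theorem dirichlet_ek (n : ℕ) : dirichlet n = ek n vv := by
  ext x; rw [dirichlet_eq, ek]

theorem cv_tp (n : ℕ) (w : ℕ → ℝ) {g : ℝ → ℝ} (hg : BP g) (x : ℝ) :
    ∫ y in (0:ℝ)..1, ek n w (x - y) * g y =
      tp n (fun l => w l * ∫ y in (0:ℝ)..1, Real.cos (2 * Real.pi * l * y) * g y)
        (fun l => w l * ∫ y in (0:ℝ)..1, Real.sin (2 * Real.pi * l * y) * g y) x := by
  have hc : ∀ l : ℕ, BM (fun y => Real.cos (2 * Real.pi * l * y) * g y) := fun l =>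
    BM.mul ⟨by fun_prop, 1, fun x => Real.abs_cos_le_one _⟩ hg.bm
  have hs : ∀ l : ℕ, BM (fun y => Real.sin (2 * Real.pi * l * y) * g y) := fun l =>
    BM.mul ⟨by fun_prop, 1, fun x => Real.abs_sin_le_one _⟩ hg.bm
  have e : ∀ y, ek n w (x - y) * g y = ∑ l ∈ Finset.range (n + 1),
      ((w l * Real.cos (2 * Real.pi * l * x)) * (Real.cos (2 * Real.pi * l * y) * g y) +
       (w l * Real.sin (2 * Real.pi * l * x)) * (Real.sin (2 * Real.pi * l * y) * g y)) := by
    intro y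
    rw [ek, Finset.sum_mul]
    refine Finset.sum_congr rfl fun l _ => ?_
    rw [mul_sub, Real.cos_sub]; ring
  simp only [e]
  rw [intervalIntegral.integral_finsetSum]
  · unfold tp
    refine Finset.sum_congr rfl fun l _ => ?_
    rw [intervalIntegral.integral_add (((hc l).const_mul _).intervalIntegrable _ _) (((hs l).const_mul _).intervalIntegrable _ _),
      intervalIntegral.integral_const_mul, intervalIntegral.integral_const_mul]
    ring
  · intro l _
    exact (((hc l).const_mul _).add ((hs l).const_mul _)).intervalIntegrable _ _

/-- convolution averages -/
theorem cv_avg (n : ℕ) {g : ℝ → ℝ} (hg : BP g) (x : ℝ) :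
    ∫ y in (0:ℝ)..1, ek n vv (x - y) * g y =
      ∫ y in (0:ℝ)..1, lag n (fun k => g (y + k / NN n)) (x - y) := by
  have hN := NN_pos n
  have hB : ∀ k : ℕ, BP (fun y => ek n vv (x - y) * g y) := by
    intro k
    refine ⟨fun y => ?_, ?_, ?_⟩
    · simp only [hg.per y]
      congr 1
      have := (ek_bp n vv).per (x - (y + 1))
      rw [← this]; congr 1; ring
    · exact ((ek_bp n vv).meas.comp (measurable_const.sub measurable_id)).mul hg.meas
    · exact (((ek_bp n vv).bm.comp (measurable_const.sub measurable_id)).mul hg.bm).bdd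
  simp only [lag_eq, dirichlet_ek]
  rw [intervalIntegral.integral_const_mul, intervalIntegral.integral_finsetSum]
  · have : ∀ k ∈ Finset.range (2 * n + 1), ∫ y in (0:ℝ)..1, g (y + k / NN n) * ek n vv (x - y - k / NN n) = ∫ y in (0:ℝ)..1, ek n vv (x - y) * g y := by
      intro k _
      rw [← integral_shift (hB 0).per (k / NN n)]
      congr 1; ext y
      rw [mul_comm, sub_sub]
    rw [Finset.sum_congr rfl this, Finset.sum_const, Finset.card_range, nsmul_eq_mul, ← mul_assoc]
    have : 1 / NN n * ((2 * n + 1 : ℕ) : ℝ) = 1 := by push_cast; exact one_div_mul_cancel hN.ne'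
    rw [this, one_mul]
  · intro k _
    have := ((hB 0).shift (k / NN n)).bm.intervalIntegrable 0 1
    refine (intervalIntegrable_congr ?_).1 this
    intro y _
    simp only
    rw [mul_comm, sub_sub]

theorem lag_kernel (n : ℕ) {g : ℝ → ℝ} (hg : BP g) :
    BK (fun x y => lag n (fun k => g (y + k / NN n)) (x - y)) := by
  simp only [lag_eq, dirichlet_ek]
  obtain ⟨M, hM⟩ := hg.bdd
  obtain ⟨M', hM'⟩ := (ek_bp n vv).bdd
  have hN := NN_pos n
  refine ⟨?_, (1 / NN n) * ∑ k ∈ Finset.range (2 * n + 1), M * M', fun x y => ?_⟩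
  · refine Measurable.const_mul (Finset.measurable_sum _ fun k _ => ?_) _
    exact (hg.meas.comp (measurable_snd.add_const _)).mul
      ((ek_bp n vv).meas.comp ((measurable_fst.sub measurable_snd).sub_const _))
  · rw [abs_mul, abs_of_pos (by positivity)]
    refine mul_le_mul_of_nonneg_left ?_ (by positivity)
    refine (Finset.abs_sum_le_sum_abs _ _).trans (Finset.sum_le_sum fun k _ => ?_)
    rw [abs_mul]
    exact mul_le_mul (hM _) (hM' _) (abs_nonneg _) ((abs_nonneg _).trans (hM 0))

/-- boundedness of Fourier partial sums from the discrete inequality -/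
theorem Sn_bound {q C : ℝ} (hq : 1 < q) (hC : 0 < C) (n : ℕ)
    (h : ∀ (b : ℕ → ℝ), LpNorm q (lag n b) ≤ C * eb q n b) {g : ℝ → ℝ} (hg : BP g) :
    LpNorm q (fun x => ∫ y in (0:ℝ)..1, ek n vv (x - y) * g y) ≤ C * LpNorm q g := by
  have hN := NN_pos n
  apply LpNorm_le_of_rpow hq (mul_nonneg hC.le (LpNorm_nonneg _ _))
  have hk := lag_kernel n hg
  have h1 := jensen_kernel hq hk
  simp only [cv_avg n hg]
  refine h1.trans ?_
  have hgp : BP (fun x => |g x| ^ q) := hg.rpow_abs (by linarith)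
  have h2 : ∀ y, ∫ x in (0:ℝ)..1, |lag n (fun k => g (y + k / NN n)) (x - y)| ^ q ≤
      C ^ q * ((1 / NN n) * ∑ k ∈ Finset.range (2 * n + 1), |g (y + k / NN n)| ^ q) := by
    intro y
    rw [← LpNorm_rpow hq (fun x => lag n (fun k => g (y + k / NN n)) (x - y))]
    simp only [sub_eq_add_neg]
    rw [LpNorm_shift q (f := lag n (fun k => g (y + k / NN n))) (tp_bp _ _ _).per, ← eb_rpow hq,
      ← Real.mul_rpow hC.le (eb_nonneg _ _ _)]
    exact Real.rpow_le_rpow (LpNorm_nonneg _ _) (h _) (by linarith)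
  have hI : BM (fun y => C ^ q * ((1 / NN n) * ∑ k ∈ Finset.range (2 * n + 1), |g (y + k / NN n)| ^ q)) :=
    ((BM.sum (Finset.range (2 * n + 1)) (f := fun k y => |g (y + (k : ℝ) / NN n)| ^ q)
      fun k _ => (hgp.shift ((k : ℝ) / NN n)).bm).const_mul _).const_mul _
  have h3 : ∫ y in (0:ℝ)..1, ∫ x in (0:ℝ)..1, |lag n (fun k => g (y + k / NN n)) (x - y)| ^ q ≤
      ∫ y in (0:ℝ)..1, C ^ q * ((1 / NN n) * ∑ k ∈ Finset.range (2 * n + 1), |g (y + k / NN n)| ^ q) := by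
    have hL : BM (fun y => ∫ x in (0:ℝ)..1, |lag n (fun k => g (y + k / NN n)) (x - y)| ^ q) := by
      simp only [intervalIntegral.integral_of_le (zero_le_one (α := ℝ))]
      exact (hk.rpow (by linarith)).bm_integral' (ν := mI)
    exact intervalIntegral.integral_mono (μ := volume) zero_le_one (hL.intervalIntegrable _ _)
      (hI.intervalIntegrable _ _) h2
  refine h3.trans (le_of_eq ?_)
  rw [intervalIntegral.integral_const_mul, intervalIntegral.integral_const_mul, intervalIntegral.integral_finsetSum]
  · simp only [integral_shift hgp.per]
    rw [Finset.sum_const, Finset.card_range, nsmul_eq_mul, ← mul_assoc (1 / NN n)]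
    have : 1 / NN n * ((2 * n + 1 : ℕ) : ℝ) = 1 := by push_cast; exact one_div_mul_cancel hN.ne'
    rw [this, one_mul, Real.mul_rpow hC.le (LpNorm_nonneg _ _), LpNorm_rpow hq]
  · intro k _
    exact (hgp.shift _).bm.intervalIntegrable _ _

theorem eb_holder {p q : ℝ} (h : p.HolderConjugate q) (n : ℕ) (b c : ℕ → ℝ) :
    (1 / NN n) * ∑ k ∈ Finset.range (2 * n + 1), b k * c k ≤ eb p n b * eb q n c := by
  have hN := NN_pos n
  have h1 := Real.inner_le_Lp_mul_Lq (Finset.range (2 * n + 1)) b c h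
  unfold eb
  have a1 : 0 ≤ ∑ k ∈ Finset.range (2 * n + 1), |b k| ^ p := by positivity
  have a2 : 0 ≤ ∑ k ∈ Finset.range (2 * n + 1), |c k| ^ q := by positivity
  rw [Real.mul_rpow (by positivity) a1, Real.mul_rpow (by positivity) a2, mul_mul_mul_comm,
    ← Real.rpow_add (by positivity)]
  have : 1 / p + 1 / q = 1 := by simpa using h.inv_add_inv_eq_one
  rw [this, Real.rpow_one]
  exact mul_le_mul_of_nonneg_left h1 (by positivity)

theorem hardMZ_high {p : ℝ} (hp2 : 2 < p) :
    ∃ C : ℝ, 0 < C ∧ ∀ (n : ℕ) (b : ℕ → ℝ), LpNorm p (lag n b) ≤ C * eb p n b := by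
  have hp : 1 < p := by linarith
  have hpq : p.HolderConjugate (p.conjExponent) := Real.HolderConjugate.conjExponent hp
  set q := p.conjExponent with hq'
  have hqe : q = p / (p - 1) := rfl
  have hp1 : 0 < p - 1 := by linarith
  have hq : 1 < q := hpq.symm.lt
  have hq2 : q ≤ 2 := by rw [hqe, div_le_iff₀ hp1]; linarith
  obtain ⟨C, hC, h⟩ := hardMZ_low hq hq2
  refine ⟨7 / 2 * C, by positivity, fun n b => ?_⟩
  have hN := NN_pos n
  set T := lag n b with hT
  have hTb : BP T := tp_bp _ _ _
  set g : ℝ → ℝ := fun x => |T x| ^ (p - 2) * T x with hg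
  have hgb : BP g := by
    have h1 := hTb.rpow_abs (p := p - 2) (by linarith)
    refine ⟨fun x => ?_, (h1.bm.mul hTb.bm).meas, (h1.bm.mul hTb.bm).bdd⟩
    simp only [hg, hTb.per x]
  have gabs : ∀ x, |g x| ^ q = |T x| ^ p := by
    intro x
    have e1 : |g x| = |T x| ^ (p - 1) := by
      simp only [hg, abs_mul]
      rw [abs_of_nonneg (by positivity)]
      have := Real.rpow_add_one' (abs_nonneg (T x)) (y := p - 2) (by linarith)
      rw [← this]; congr 1; ring
    rw [e1, ← Real.rpow_mul (abs_nonneg _), hqe, mul_div_cancel₀ _ hp1.ne']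
  have gT : ∀ x, |T x| ^ p = T x * g x := by
    intro x
    simp only [hg]
    have := Real.rpow_add_natCast' (abs_nonneg (T x)) (y := p - 2) (n := 2) (by push_cast; linarith)
    rw [show p - 2 + ((2:ℕ):ℝ) = p by push_cast; ring] at this
    rw [this, sq_abs]; ring
  set S : ℝ → ℝ := fun x => ∫ y in (0:ℝ)..1, ek n vv (x - y) * g y with hS
  have hS1 : LpNorm q S ≤ C * LpNorm q g := Sn_bound hq hC n (h n) hgb
  have hS2 : eb q n (fun k => S (k / NN n)) ≤ 7 / 2 * LpNorm q S := by
    have e : S = tp n _ _ := funext fun x => cv_tp n vv hgb x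
    have := easyMZ hq n (fun l => vv l * ∫ y in (0:ℝ)..1, Real.cos (2 * Real.pi * l * y) * g y)
        (fun l => vv l * ∫ y in (0:ℝ)..1, Real.sin (2 * Real.pi * l * y) * g y)
    rw [← e, el_eq] at this
    exact this
  have key : ∫ x in (0:ℝ)..1, |T x| ^ p = (1 / NN n) * ∑ k ∈ Finset.range (2 * n + 1), b k * S (k / NN n) := by
    simp only [gT]
    have e : ∀ x, T x * g x = (1 / NN n) * ∑ k ∈ Finset.range (2 * n + 1), b k * (ek n vv (k / NN n - x) * g x) := by
      intro x
      rw [hT, lag_eq, dirichlet_ek, mul_assoc, Finset.sum_mul]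
      congr 1
      refine Finset.sum_congr rfl fun k _ => ?_
      rw [← ek_neg, neg_sub, mul_assoc]
    simp only [e]
    rw [intervalIntegral.integral_const_mul, intervalIntegral.integral_finsetSum]
    · simp only [intervalIntegral.integral_const_mul, hS]
    · intro k _
      exact ((((ek_bp n vv).bm.comp (measurable_const.sub measurable_id)).mul hgb.bm).const_mul _).intervalIntegrable _ _
  have hfin := eb_holder hpq n b (fun k => S (k / NN n))
  rw [← key, ← LpNorm_rpow hp] at hfin
  have hgq : LpNorm q g = (LpNorm p T) ^ (p - 1) := by
    have : LpNorm q g = (∫ x in (0:ℝ)..1, |T x| ^ p) ^ (1 / q) := by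
      unfold LpNorm; simp only [gabs]
    rw [this, ← LpNorm_rpow hp, ← Real.rpow_mul (LpNorm_nonneg _ _), hqe]
    congr 1; field_simp
  rw [hgq] at hS1
  rcases (LpNorm_nonneg p T).eq_or_lt with h0 | h0
  · rw [← h0]
    exact mul_nonneg (by positivity) (eb_nonneg _ _ _)
  · have hX : LpNorm p T ^ p = LpNorm p T * LpNorm p T ^ (p - 1) := by
      rw [← Real.rpow_one_add' h0.le (by linarith)]; congr 1; ring
    have hpos : 0 < LpNorm p T ^ (p - 1) := Real.rpow_pos_of_pos h0 _
    have hb0 := eb_nonneg p n b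
    have : LpNorm p T * LpNorm p T ^ (p - 1) ≤ (7 / 2 * C * eb p n b) * LpNorm p T ^ (p - 1) := by
      rw [← hX]
      refine hfin.trans ?_
      have := mul_le_mul_of_nonneg_left (hS2.trans (mul_le_mul_of_nonneg_left hS1 (by norm_num))) hb0
      linarith
    exact le_of_mul_le_mul_right this hpos

theorem hardMZ {p : ℝ} (hp : 1 < p) :
    ∃ C : ℝ, 0 < C ∧ ∀ (n : ℕ) (b : ℕ → ℝ), LpNorm p (lag n b) ≤ C * eb p n b := by
  rcases le_or_gt p 2 with h | h
  · exact hardMZ_low hp h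
  · exact hardMZ_high h

open MeasureTheory Filter Finset

theorem diff_mul_le {p : ℝ} (hp : 1 < p) {g : ℝ → ℝ} (hg : BP g) (h : ℝ) (m : ℕ) :
    LpNorm p (fun x => g (x + m * h) - g x) ≤ m * LpNorm p (fun x => g (x + h) - g x) := by
  have hd : BP (fun x => g (x + h) - g x) := (hg.shift h).sub hg
  have e : (fun x => g (x + m * h) - g x) = fun x => ∑ i ∈ Finset.range m, (g (x + i * h + h) - g (x + i * h)) := by
    ext x
    have := Finset.sum_range_sub (fun i : ℕ => g (x + i * h)) m
    simp only [Nat.cast_zero, zero_mul, add_zero] at this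
    rw [← this]
    refine Finset.sum_congr rfl fun i _ => ?_
    congr 2; push_cast; ring
  rw [e]
  refine (LpNorm_sum_le hp _ (f := fun (i : ℕ) x => g (x + i * h + h) - g (x + i * h)) (fun i _ => (hd.shift (i * h)).bm)).trans ?_
  have : ∀ i ∈ Finset.range m, LpNorm p (fun x => g (x + i * h + h) - g (x + i * h)) = LpNorm p (fun x => g (x + h) - g x) :=
    fun i _ => LpNorm_shift p hd.per (i * h)
  rw [Finset.sum_congr rfl this, Finset.sum_const, Finset.card_range, nsmul_eq_mul]

theorem d2_mul_le {p : ℝ} (hp : 1 < p) {f : ℝ → ℝ} (hf : BP f) (h : ℝ) (m : ℕ) :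
    LpNorm p (fun x => f (x + m * h) + f (x + -(m * h)) - 2 * f x) ≤
      m ^ 2 * LpNorm p (fun x => f (x + h) + f (x + -h) - 2 * f x) := by
  have h1 := diff_mul_le hp ((hf.shift (m * h)).sub hf) h m
  have h2 := diff_mul_le hp ((hf.shift h).sub hf) h m
  have e1 : LpNorm p (fun x => f (x + m * h) + f (x + -(m * h)) - 2 * f x) =
      LpNorm p (fun x => (f (x + m * h + m * h) - f (x + m * h)) - (f (x + m * h) - f x)) := by
    rw [← LpNorm_shift p (hf.d2 (m * h)).per (m * h)]
    congr 1; ext x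
    rw [add_neg_cancel_right]; ring
  have e2 : LpNorm p (fun x => f (x + h) + f (x + -h) - 2 * f x) =
      LpNorm p (fun x => (f (x + h + h) - f (x + h)) - (f (x + h) - f x)) := by
    rw [← LpNorm_shift p (hf.d2 h).per h]
    congr 1; ext x
    rw [add_neg_cancel_right]; ring
  have e3 : (fun x => f (x + h + m * h) - f (x + h) - (f (x + m * h) - f x)) =
      fun x => f (x + m * h + h) - f (x + m * h) - (f (x + h) - f x) := by
    ext x
    rw [add_right_comm]; ring
  rw [e1, e2]
  rw [e3] at h1
  refine h1.trans ?_
  rw [pow_two, mul_assoc]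
  exact mul_le_mul_of_nonneg_left h2 (by positivity)

theorem d2_le_half {p : ℝ} (hp : 1 < p) {f : ℝ → ℝ} (hf : BP f) {n : ℕ} (hn : 1 ≤ n) {t : ℝ} (h0 : 0 ≤ t) (h1 : t ≤ 1 / 2) :
    LpNorm p (fun x => f (x + t) + f (x + -t) - 2 * f x) ≤
      (2 + n ^ 2 / 4 * (1 - Real.cos (2 * Real.pi * t))) * omegaMod 2 p f (1 / (n : ℝ)) := by
  have hn0 : (0:ℝ) < n := by exact_mod_cast hn
  have hω := omega_nonneg p f (1 / (n : ℝ))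
  set m := ⌊(n : ℝ) * t⌋₊ + 1 with hm
  have hm1 : (n : ℝ) * t < m := by rw [hm]; push_cast; exact Nat.lt_floor_add_one _
  have hm2 : (m : ℝ) ≤ n * t + 1 := by
    rw [hm]; push_cast; linarith [Nat.floor_le (show 0 ≤ (n : ℝ) * t by positivity)]
  have hm0 : (0:ℝ) < m := by rw [hm]; push_cast; positivity
  have hpi := Real.pi_pos
  have hcos : 8 * t ^ 2 ≤ 1 - Real.cos (2 * Real.pi * t) := by
    have e : Real.cos (2 * Real.pi * t) = 1 - 2 * Real.sin (Real.pi * t) ^ 2 := by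
      rw [mul_assoc, Real.cos_two_mul, Real.cos_sq']; ring
    have hs := Real.mul_le_sin (x := Real.pi * t) (by positivity) (by nlinarith)
    have : 2 / Real.pi * (Real.pi * t) = 2 * t := by field_simp
    rw [this] at hs
    rw [e]; nlinarith
  have hc : (m : ℝ) ^ 2 ≤ 2 + n ^ 2 / 4 * (1 - Real.cos (2 * Real.pi * t)) := by
    have : (n : ℝ) ^ 2 / 4 * (8 * t ^ 2) ≤ n ^ 2 / 4 * (1 - Real.cos (2 * Real.pi * t)) :=
      mul_le_mul_of_nonneg_left hcos (by positivity)
    nlinarith [sq_nonneg ((n : ℝ) * t - 1), mul_nonneg hn0.le h0]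
  rcases h0.eq_or_lt with rfl | ht
  · have : (fun x => f (x + 0) + f (x + -0) - 2 * f x) = fun x => 0 * f x := by ext x; simp; ring
    rw [this, LpNorm_const_mul hp, abs_zero, zero_mul]
    exact mul_nonneg ((sq_nonneg _).trans hc) hω
  · have key := d2_mul_le hp hf (t / m) m
    rw [mul_div_cancel₀ _ hm0.ne'] at key
    have hlt : t / m < 1 / n := by
      rw [div_lt_div_iff₀ hm0 hn0]; linarith
    have := le_omega hp hf (h := t / m) (by positivity) hlt
    refine key.trans (mul_le_mul hc this (LpNorm_nonneg _ _) ((sq_nonneg _).trans hc))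

theorem d2_le_one {p : ℝ} (hp : 1 < p) {f : ℝ → ℝ} (hf : BP f) {n : ℕ} (hn : 1 ≤ n) {t : ℝ} (h0 : 0 ≤ t) (h1 : t ≤ 1) :
    LpNorm p (fun x => f (x + t) + f (x + -t) - 2 * f x) ≤
      (2 + n ^ 2 / 4 * (1 - Real.cos (2 * Real.pi * t))) * omegaMod 2 p f (1 / (n : ℝ)) := by
  rcases le_or_gt t (1 / 2) with h | h
  · exact d2_le_half hp hf hn h0 h
  · have := d2_le_half hp hf hn (t := 1 - t) (by linarith) (by linarith)
    have e1 : Real.cos (2 * Real.pi * (1 - t)) = Real.cos (2 * Real.pi * t) := by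
      rw [mul_sub, mul_one, Real.cos_two_pi_sub]
    have e2 : (fun x => f (x + (1 - t)) + f (x + -(1 - t)) - 2 * f x) = fun x => f (x + t) + f (x + -t) - 2 * f x := by
      ext x
      have a1 := hf.per (x + -t)
      have a2 := hf.per (x + -(1 - t))
      rw [show x + -t + 1 = x + (1 - t) by ring] at a1
      rw [show x + -(1 - t) + 1 = x + t by ring] at a2
      rw [a1, ← a2]; ring
    rw [e1, e2] at this
    exact this

theorem int_cos_int (j : ℤ) : ∫ t in (0:ℝ)..1, Real.cos (2 * Real.pi * j * t) = if j = 0 then 1 else 0 := by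
  split_ifs with h
  · simp [h]
  · have hj : (2 * Real.pi * j : ℝ) ≠ 0 := by
      have : (j : ℝ) ≠ 0 := by exact_mod_cast h
      have := Real.pi_pos
      positivity
    rw [intervalIntegral.integral_comp_mul_left (fun x => Real.cos x) hj, integral_cos]
    have : Real.sin (2 * Real.pi * j * 1) = 0 := by
      rw [show (2 * Real.pi * j * 1 : ℝ) = ((2 * j : ℤ) : ℝ) * Real.pi by push_cast; ring]
      exact Real.sin_int_mul_pi _
    rw [this]; simp

theorem int_ek (n : ℕ) (w : ℕ → ℝ) : ∫ t in (0:ℝ)..1, ek n w t = w 0 := by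
  unfold ek
  rw [intervalIntegral.integral_finsetSum]
  · have : ∀ l ∈ Finset.range (n + 1), ∫ t in (0:ℝ)..1, w l * Real.cos (2 * Real.pi * l * t) = if l = 0 then w l else 0 := by
      intro l _
      have := int_cos_int l
      simp only [Int.cast_natCast] at this
      rw [intervalIntegral.integral_const_mul, this]
      simp
    rw [Finset.sum_congr rfl this, Finset.sum_ite_eq', if_pos (by simp)]
  · intro l _
    exact Continuous.intervalIntegrable (by fun_prop) _ _

theorem int_ek_cos {n : ℕ} (hn : 1 ≤ n) (w : ℕ → ℝ) :
    ∫ t in (0:ℝ)..1, ek n w t * Real.cos (2 * Real.pi * t) = w 1 / 2 := by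
  unfold ek
  simp only [Finset.sum_mul]
  rw [intervalIntegral.integral_finsetSum]
  · have : ∀ l ∈ Finset.range (n + 1), ∫ t in (0:ℝ)..1, w l * Real.cos (2 * Real.pi * l * t) * Real.cos (2 * Real.pi * t) = if l = 1 then w l / 2 else 0 := by
      intro l _
      have a1 := int_cos_int (l + 1)
      have a2 := int_cos_int (l - 1)
      have e : ∀ t, w l * Real.cos (2 * Real.pi * l * t) * Real.cos (2 * Real.pi * t) =
        w l / 2 * (Real.cos (2 * Real.pi * ((l + 1 : ℤ) : ℝ) * t) + Real.cos (2 * Real.pi * ((l - 1 : ℤ) : ℝ) * t)) := by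
        intro t
        rw [show 2 * Real.pi * ((l + 1 : ℤ) : ℝ) * t = 2 * Real.pi * l * t + 2 * Real.pi * t by push_cast; ring,
          show 2 * Real.pi * ((l - 1 : ℤ) : ℝ) * t = 2 * Real.pi * l * t - 2 * Real.pi * t by push_cast; ring,
          Real.cos_add, Real.cos_sub]
        ring
      simp only [e]
      rw [intervalIntegral.integral_const_mul, intervalIntegral.integral_add
        (Continuous.intervalIntegrable (by fun_prop) _ _) (Continuous.intervalIntegrable (by fun_prop) _ _), a1, a2]
      have b1 : ¬ ((l : ℤ) + 1 = 0) := by omega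
      by_cases hl : l = 1
      · simp [hl]
      · have b2 : ¬ ((l : ℤ) - 1 = 0) := by omega
        simp [hl, b1, b2]
    rw [Finset.sum_congr rfl this, Finset.sum_ite_eq', if_pos (by simp; omega)]
  · intro l _
    exact Continuous.intervalIntegrable (by fun_prop) _ _

/-- angle -/
noncomputable def th (n : ℕ) : ℝ := Real.pi / (n + 2)

noncomputable def bb (n l : ℕ) : ℝ := Real.sin ((l + 1) * th n)

/-- Fejer-Korovkin coefficients -/
noncomputable def ww (n j : ℕ) : ℝ :=
  ∑ l ∈ Finset.range (n + 1), ∑ m ∈ Finset.range (n + 1),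
    if ((l : ℤ) - m).natAbs = j then bb n l * bb n m else 0

theorem ek_ww (n : ℕ) (x : ℝ) : ek n (ww n) x =
    (∑ l ∈ Finset.range (n + 1), bb n l * Real.cos (2 * Real.pi * l * x)) ^ 2 +
    (∑ l ∈ Finset.range (n + 1), bb n l * Real.sin (2 * Real.pi * l * x)) ^ 2 := by
  rw [pow_two, pow_two, Finset.sum_mul_sum, Finset.sum_mul_sum, ← Finset.sum_add_distrib]
  simp only [ek, ww, Finset.sum_mul]
  rw [Finset.sum_comm]
  refine Finset.sum_congr rfl fun l hl => ?_
  rw [Finset.sum_comm, ← Finset.sum_add_distrib]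
  refine Finset.sum_congr rfl fun m hm => ?_
  simp only [ite_mul, zero_mul]
  have hl' := Finset.mem_range.1 hl
  have hm' := Finset.mem_range.1 hm
  rw [Finset.sum_ite_eq, if_pos (by rw [Finset.mem_range]; omega)]
  have : Real.cos (2 * Real.pi * (((l : ℤ) - m).natAbs : ℝ) * x) = Real.cos (2 * Real.pi * l * x - 2 * Real.pi * m * x) := by
    rcases Int.natAbs_eq ((l : ℤ) - m) with h | h
    · have h2 : (((l : ℤ) - m).natAbs : ℝ) = (l : ℝ) - m := by
        have : (((l : ℤ) - m : ℤ) : ℝ) = (((l : ℤ) - m).natAbs : ℤ) := by rw [← h]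
        push_cast at this; rw [this]; simp
      rw [h2]; congr 1; ring
    · have h2 : (((l : ℤ) - m).natAbs : ℝ) = -((l : ℝ) - m) := by
        have : (((l : ℤ) - m : ℤ) : ℝ) = -(((l : ℤ) - m).natAbs : ℤ) := by rw [h]; simp
        push_cast at this; rw [this]; simp
      rw [h2, ← Real.cos_neg]; congr 1; ring
  rw [this, Real.cos_sub]
  ring

theorem ww_zero (n : ℕ) : ww n 0 = ∑ l ∈ Finset.range (n + 1), bb n l ^ 2 := by
  unfold ww
  refine Finset.sum_congr rfl fun l hl => ?_
  have : ∀ m ∈ Finset.range (n + 1), (if ((l : ℤ) - m).natAbs = 0 then bb n l * bb n m else 0) = if l = m then bb n l * bb n m else 0 := by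
    intro m _
    congr 1
    apply propext; omega
  rw [Finset.sum_congr rfl this, Finset.sum_ite_eq, if_pos hl]; ring

theorem ww_one (n : ℕ) : ww n 1 = 2 * Real.cos (th n) * ww n 0 := by
  rw [ww_zero]
  unfold ww
  rw [Finset.mul_sum]
  refine Finset.sum_congr rfl fun l hl => ?_
  have hl' := Finset.mem_range.1 hl
  have : ∀ m ∈ Finset.range (n + 1), (if ((l : ℤ) - m).natAbs = 1 then bb n l * bb n m else 0) =
      bb n l * ((if l + 1 = m then bb n m else 0) + (if l = m + 1 then bb n m else 0)) := by
    intro m _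
    by_cases h1 : l + 1 = m
    · have h2 : ¬ (l = m + 1) := by omega
      have h3 : ((l : ℤ) - m).natAbs = 1 := by omega
      rw [if_pos h1, if_neg h2, if_pos h3, add_zero]
    · by_cases h2 : l = m + 1
      · have h3 : ((l : ℤ) - m).natAbs = 1 := by omega
        rw [if_neg h1, if_pos h2, if_pos h3, zero_add]
      · have h3 : ¬ ((l : ℤ) - m).natAbs = 1 := by omega
        rw [if_neg h1, if_neg h2, if_neg h3]; simp
  rw [Finset.sum_congr rfl this, ← Finset.mul_sum, Finset.sum_add_distrib]
  have s1 : (∑ m ∈ Finset.range (n + 1), if l + 1 = m then bb n m else 0) = Real.sin ((l + 2) * th n) := by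
    rw [Finset.sum_ite_eq]
    split_ifs with h
    · unfold bb; congr 1; push_cast; ring
    · have : l = n := by rw [Finset.mem_range] at h; omega
      rw [this, th]
      have h2 : ((n : ℝ) + 2) ≠ 0 := by positivity
      rw [mul_div_cancel₀ _ h2, Real.sin_pi]
  have s2 : (∑ m ∈ Finset.range (n + 1), if l = m + 1 then bb n m else 0) = Real.sin (l * th n) := by
    rcases l with _ | k
    · simp
    · simp only [Nat.add_right_cancel_iff]
      rw [Finset.sum_ite_eq, if_pos (by rw [Finset.mem_range]; omega)]
      unfold bb; push_cast; rfl
  rw [s1, s2]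
  unfold bb
  have e1 : ((l : ℝ) + 2) * th n = (l + 1) * th n + th n := by ring
  have e2 : (l : ℝ) * th n = (l + 1) * th n - th n := by ring
  rw [e1, e2, Real.sin_add, Real.sin_sub]
  ring

theorem ww_pos (n : ℕ) : 0 < ww n 0 := by
  rw [ww_zero]
  have h : 0 < bb n 0 := by
    unfold bb th
    have hpi := Real.pi_pos
    apply Real.sin_pos_of_pos_of_lt_pi
    · positivity
    · have : (0:ℝ) < n + 2 := by positivity
      rw [← mul_div_assoc, div_lt_iff₀ this]
      have : (0:ℝ) ≤ n := by positivity
      simp; nlinarith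
  refine lt_of_lt_of_le (show 0 < bb n 0 ^ 2 by positivity) ?_
  exact Finset.single_le_sum (f := fun l => bb n l ^ 2) (fun i _ => sq_nonneg _) (Finset.mem_range.2 (Nat.succ_pos n))

theorem ek_ww_nonneg (n : ℕ) (x : ℝ) : 0 ≤ ek n (ww n) x := by
  rw [ek_ww]; positivity

/-- the weighted moment -/
theorem ww_moment {n : ℕ} (hn : 1 ≤ n) :
    ∫ t in (0:ℝ)..1, ek n (ww n) t / (2 * ww n 0) * (2 + n ^ 2 / 4 * (1 - Real.cos (2 * Real.pi * t))) ≤ 2 := by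
  have hZ := ww_pos n
  have hn0 : (0:ℝ) < n := by exact_mod_cast hn
  have hcont : Continuous (ek n (ww n)) := by
    unfold ek; fun_prop
  have e : ∀ t, ek n (ww n) t / (2 * ww n 0) * (2 + n ^ 2 / 4 * (1 - Real.cos (2 * Real.pi * t))) =
      ((2 + n ^ 2 / 4) / (2 * ww n 0)) * ek n (ww n) t - ((n ^ 2 / 4) / (2 * ww n 0)) * (ek n (ww n) t * Real.cos (2 * Real.pi * t)) := by
    intro t; ring
  simp only [e]
  rw [intervalIntegral.integral_sub (Continuous.intervalIntegrable (by fun_prop) _ _) (Continuous.intervalIntegrable (by fun_prop) _ _),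
    intervalIntegral.integral_const_mul, intervalIntegral.integral_const_mul, int_ek, int_ek_cos hn, ww_one]
  have e2 : (2 + (n:ℝ) ^ 2 / 4) / (2 * ww n 0) * ww n 0 - (n ^ 2 / 4) / (2 * ww n 0) * (2 * Real.cos (th n) * ww n 0 / 2) =
      1 + n ^ 2 / 8 * (1 - Real.cos (th n)) := by
    field_simp; ring
  rw [e2]
  have h1 := Real.one_sub_sq_div_two_le_cos (x := th n)
  have h2 : (n : ℝ) ^ 2 * th n ^ 2 ≤ 10 := by
    have : (n : ℝ) * th n ≤ Real.pi := by
      unfold th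
      rw [mul_div_assoc', div_le_iff₀ (by positivity)]
      nlinarith [Real.pi_pos]
    have h0 : 0 ≤ (n : ℝ) * th n := by unfold th; have := Real.pi_pos; positivity
    have := pow_le_pow_left₀ h0 this 2
    rw [mul_pow] at this
    nlinarith [pi_sq_le]
  nlinarith [mul_le_mul_of_nonneg_left (show 1 - Real.cos (th n) ≤ th n ^ 2 / 2 by linarith) (show 0 ≤ (n:ℝ) ^ 2 / 8 by positivity)]

theorem jackson {p : ℝ} (hp : 1 < p) {f : ℝ → ℝ} (hf : BP f) {n : ℕ} (hn : 1 ≤ n) :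
    ∃ a b : ℕ → ℝ, LpNorm p (fun x => tp n a b x - f x) ≤ 3 * omegaMod 2 p f (1 / (n : ℝ)) := by
  have hZ := ww_pos n
  have hω := omega_nonneg p f (1 / (n : ℝ))
  set K := ek n (ww n) with hK
  set Z := ww n 0 with hZd
  have hKb : BP K := ek_bp _ _
  have hcv := cv_tp n (ww n) hf
  set a := fun l => ww n l * ∫ y in (0:ℝ)..1, Real.cos (2 * Real.pi * l * y) * f y
  set b := fun l => ww n l * ∫ y in (0:ℝ)..1, Real.sin (2 * Real.pi * l * y) * f y
  refine ⟨fun l => Z⁻¹ * a l, fun l => Z⁻¹ * b l, ?_⟩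
  have hker : BK (fun x t => K t / (2 * Z) * (f (x + t) + f (x + -t) - 2 * f x)) := by
    obtain ⟨M, hM⟩ := hf.bdd
    obtain ⟨M', hM'⟩ := hKb.bdd
    refine ⟨?_, M' / (2 * Z) * (M + M + 2 * M), fun x t => ?_⟩
    · exact ((hKb.meas.comp measurable_snd).div_const _).mul
        (((hf.meas.comp (measurable_fst.add measurable_snd)).add
          (hf.meas.comp (measurable_fst.add measurable_snd.neg))).sub ((hf.meas.comp measurable_fst).const_mul 2))
    · rw [abs_mul, abs_div, abs_of_pos (show 0 < 2 * Z by positivity)]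
      have h1 := hM (x + t)
      have h2 := hM (x + -t)
      have h3 := hM x
      rw [abs_le] at h1 h2 h3
      refine mul_le_mul (div_le_div_of_nonneg_right (hM' t) (by positivity)) ?_ (abs_nonneg _) ?_
      · rw [abs_le]; constructor <;> linarith
      · exact div_nonneg ((abs_nonneg _).trans (hM' t)) (by positivity)
  have hrep : ∀ x, tp n (fun l => Z⁻¹ * a l) (fun l => Z⁻¹ * b l) x - f x =
      ∫ t, K t / (2 * Z) * (f (x + t) + f (x + -t) - 2 * f x) ∂mI := by
    intro x
    have hP : BP (fun y => K (x - y) * f y) := by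
      refine ⟨fun y => ?_, ?_, ?_⟩
      · simp only [hf.per y]
        congr 1
        have := hKb.per (x - (y + 1))
        rw [← this]; congr 1; ring
      · exact (hKb.meas.comp (measurable_const.sub measurable_id)).mul hf.meas
      · exact ((hKb.bm.comp (measurable_const.sub measurable_id)).mul hf.bm).bdd
    have e1 : ∫ t in (0:ℝ)..1, K t * f (x + t) = ∫ y in (0:ℝ)..1, K (x - y) * f y := by
      rw [← integral_shift hP.per x]
      congr 1; ext t
      rw [show x - (t + x) = -t by ring, hK, ek_neg, add_comm t x]
    have e2 : ∫ t in (0:ℝ)..1, K t * f (x + -t) = ∫ y in (0:ℝ)..1, K (x - y) * f y := by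
      have := intervalIntegral.integral_comp_sub_left (fun y => K (x - y) * f y) (a := 0) (b := 1) x
      have h2 := hP.per.intervalIntegral_add_eq (x - 1) 0
      rw [show x - 1 + 1 = x - 0 by ring, zero_add, ← this] at h2
      rw [← h2]
      congr 1; ext t
      rw [sub_sub_cancel, sub_eq_add_neg]
    rw [← intervalIntegral.integral_of_le zero_le_one]
    have e3 : ∀ t, K t / (2 * Z) * (f (x + t) + f (x + -t) - 2 * f x) =
        (2 * Z)⁻¹ * ((K t * f (x + t) + K t * f (x + -t)) - 2 * f x * K t) := by intro t; field_simp
    have i1 : BM (fun t => K t * f (x + t)) := hKb.bm.mul (hf.bm.comp (measurable_const.add measurable_id))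
    have i2 : BM (fun t => K t * f (x + -t)) := hKb.bm.mul (hf.bm.comp (measurable_const.add measurable_neg))
    simp only [e3]
    rw [intervalIntegral.integral_const_mul, intervalIntegral.integral_sub ((i1.add i2).intervalIntegrable _ _)
      ((hKb.bm.const_mul _).intervalIntegrable _ _), intervalIntegral.integral_add (i1.intervalIntegrable _ _) (i2.intervalIntegrable _ _),
      e1, e2, hcv, intervalIntegral.integral_const_mul, int_ek, ← tp_mul]
    field_simp
    ring
  set c0 : ℝ → ℝ := fun t => K t / (2 * Z) * (2 + n ^ 2 / 4 * (1 - Real.cos (2 * Real.pi * t))) with hc0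
  have hc0p : ∀ t, 0 ≤ c0 t := fun t => by
    have h1 : 0 ≤ K t := ek_ww_nonneg n t
    have h2 := Real.cos_le_one (2 * Real.pi * t)
    have h3 : 0 ≤ 1 - Real.cos (2 * Real.pi * t) := by linarith
    simp only [hc0]; positivity
  have hc0b : BM c0 := by
    have h1 := hKb.bm.const_mul (2 * Z)⁻¹
    have h2 : BM (fun t => Real.cos (2 * Real.pi * t)) := ⟨by fun_prop, 1, fun x => Real.abs_cos_le_one _⟩
    have := h1.mul ((BM.const 2).add (((BM.const 1).sub h2).const_mul (n ^ 2 / 4)))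
    have e : c0 = fun x => (2 * Z)⁻¹ * K x * (2 + n ^ 2 / 4 * (1 - Real.cos (2 * Real.pi * x))) := by
      ext x; simp only [hc0]; ring
    rw [e]; exact this
  have := minkowski_LpNorm hp (ν := mI) hker (c := fun t => 1 + c0 t) ((BM.const 1).add hc0b)
    (fun t => by linarith [hc0p t]) hω (by
      rw [ae_restrict_iff' measurableSet_Ioc]
      refine ae_of_all _ fun t ht => ?_
      rw [LpNorm_const_mul hp]
      have h1 : 0 ≤ K t := ek_ww_nonneg n t
      rw [abs_of_nonneg (by positivity)]
      have h2 := d2_le_one hp hf hn ht.1.le ht.2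
      have h3 := mul_le_mul_of_nonneg_left h2 (show 0 ≤ K t / (2 * Z) by positivity)
      refine h3.trans ?_
      simp only [hc0]
      rw [← mul_assoc]
      exact mul_le_mul_of_nonneg_right (by linarith) hω)
  simp only [hrep]
  refine this.trans (mul_le_mul_of_nonneg_right ?_ hω)
  rw [integral_add (BM.const 1).integrable hc0b.integrable, ← intervalIntegral.integral_of_le zero_le_one]
  have hm := ww_moment hn
  simp only [integral_const, probReal_univ, smul_eq_mul, one_mul, ← intervalIntegral.integral_of_le (zero_le_one (α := ℝ))]
  simp only [hc0]
  simp
  linarith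

open MeasureTheory Filter Finset

theorem dir_zero (n : ℕ) : dirichlet n 0 = NN n := by
  simp [dirichlet, NN]
  rw [show (n:ℤ) + 1 + n = ((2 * n + 1 : ℕ) : ℤ) by push_cast; ring, Int.toNat_natCast]
  push_cast; ring

theorem dir_node (n : ℕ) {j : ℕ} (hj : j < 2 * n + 1) (h0 : j ≠ 0) : dirichlet n (j / NN n) = 0 := by
  have h := cc_pow_sum n hj
  rw [if_neg h0] at h
  set s : ℂ := -((2 * Real.pi * (j / NN n) : ℝ) : ℂ) * Complex.I with hs
  have h1 := cosh_sum n s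
  have e : ∀ k : ℕ, cc (k / NN n) ^ j = Complex.exp s ^ k := by
    intro k
    rw [cc, ← Complex.exp_nat_mul, ← Complex.exp_nat_mul]
    congr 1; rw [hs]; push_cast; ring
  simp only [e] at h
  rw [h] at h1
  have h2 : ∑ l ∈ Finset.range (n + 1), (vv l : ℂ) * Complex.cosh (l * s) = 0 :=
    (mul_eq_zero.1 h1.symm).resolve_left (pow_ne_zero _ (Complex.exp_ne_zero _))
  have e3 : ∀ l : ℕ, Complex.cosh (l * s) = ((Real.cos (2 * Real.pi * l * (j / NN n)) : ℝ) : ℂ) := by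
    intro l
    rw [← Complex.cosh_neg, Complex.ofReal_cos, ← Complex.cosh_mul_I]
    congr 1; rw [hs]; push_cast; ring
  simp only [e3] at h2
  rw [dirichlet_eq]
  exact_mod_cast h2

theorem lag_node (n : ℕ) (b : ℕ → ℝ) {j : ℕ} (hj : j < 2 * n + 1) : lag n b (j / NN n) = b j := by
  have hN := NN_pos n
  rw [lag_eq, Finset.sum_eq_single_of_mem j (Finset.mem_range.2 hj)]
  · rw [sub_self, dir_zero]; field_simp
  · intro k hk hkj
    have hk' := Finset.mem_range.1 hk
    rcases lt_or_gt_of_ne hkj with h | h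
    · have := dir_node n (j := j - k) (by omega) (by omega)
      rw [Nat.cast_sub h.le] at this
      rw [← sub_div, this, mul_zero]
    · have := dir_node n (j := k - j) (by omega) (by omega)
      rw [Nat.cast_sub h.le, dirichlet_ek, ← ek_neg, ← dirichlet_ek] at this
      rw [← sub_div, show ((j : ℝ) - k) / NN n = -((k - j) / NN n) by ring, this, mul_zero]

theorem lag_sub (n : ℕ) (b c : ℕ → ℝ) (x : ℝ) : lag n (fun k => b k - c k) x = lag n b x - lag n c x := by
  simp only [lag_eq, sub_mul, Finset.sum_sub_distrib, mul_sub]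

theorem el_sub_le {p : ℝ} (hp : 1 < p) (n : ℕ) (f g : ℝ → ℝ) :
    el p n (fun x => f x - g x) ≤ el p n f + el p n g := by
  have := el_add_le hp n f (fun x => -g x)
  have e : el p n (fun x => -g x) = el p n g := by simp only [el_eq, abs_neg]
  rw [e] at this
  simpa only [← sub_eq_add_neg] using this

theorem LpNorm_tri {p : ℝ} (hp : 1 < p) {f g h : ℝ → ℝ} (hf : BP f) (hg : BP g) (hh : BP h) :
    LpNorm p (fun x => f x - h x) ≤ LpNorm p (fun x => f x - g x) + LpNorm p (fun x => g x - h x) := by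
  have := LpNorm_add_le hp (hf.sub hg).bm (hg.sub hh).bm
  simpa using this

/-- difference with its Steklov mean -/
theorem st_diff {p : ℝ} (hp : 1 < p) (n : ℕ) {f g : ℝ → ℝ} (hf : BP f) (hg : BP g) :
    LpNorm p (fun x => st n g x - g x) ≤ 2 * LpNorm p (fun x => f x - g x) + LpNorm p (fun x => st n f x - f x) := by
  have h1 := LpNorm_tri hp (st_bp n hg) (st_bp n hf) hg
  have h2 := LpNorm_tri hp (st_bp n hf) hf hg
  have h3 := st_norm hp n (hf.sub hg)
  have e : LpNorm p (fun x => st n g x - st n f x) = LpNorm p (st n (fun x => f x - g x)) := by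
    rw [LpNorm_sub_comm]; congr 1; ext x; rw [st_sub n hf hg]
  rw [e] at h1
  linarith

theorem st_tp_sub (n : ℕ) (a b : ℕ → ℝ) : (fun x => st n (tp n a b) x - tp n a b x) =
    tp n (fun l => Real.sinc (Real.pi * fr n l) * a l - a l) (fun l => Real.sinc (Real.pi * fr n l) * b l - b l) := by
  ext x; rw [st_tp, tp_sub]

theorem partA {p : ℝ} (hp : 1 < p) : ∃ A1 A2 : ℝ, 0 < A1 ∧ 0 < A2 ∧ ∀ f : ℝ → ℝ, BP f → ∀ n : ℕ, 1 ≤ n →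
    LpNorm p (fun x => f x - lagrange n f x) ≤ A1 * el p n (fun x => st n f x - f x) + A2 * omegaMod 2 p f (1 / (n : ℝ)) := by
  obtain ⟨C, hC, hM⟩ := hardMZ hp
  refine ⟨C, 3 + C * (3 + 7 / 2 * 7), hC, by positivity, fun f hf n hn => ?_⟩
  obtain ⟨a, b, hT⟩ := jackson hp hf hn
  have hω := omega_nonneg p f (1 / (n : ℝ))
  have hTb := tp_bp n a b
  have hL : lagrange n f = lag n (fun k => f (k / NN n)) := lagrange_eq n f
  have hLb : BP (lagrange n f) := by rw [hL]; exact tp_bp _ _ _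
  have h1 := LpNorm_tri hp hf hTb hLb
  have h2 : LpNorm p (fun x => tp n a b x - lagrange n f x) ≤ C * el p n (fun x => tp n a b x - f x) := by
    have := hM n (fun k => tp n a b (k / NN n) - f (k / NN n))
    rw [el_eq]
    refine le_trans (le_of_eq ?_) this
    congr 1; ext x
    rw [lag_sub, lag_tp, hL]
  have h3 : el p n (fun x => tp n a b x - f x) ≤ el p n (fun x => st n f x - f x) +
      (el p n (st n (fun x => f x - tp n a b x)) + el p n (fun x => st n (tp n a b) x - tp n a b x)) := by
    have e : el p n (fun x => tp n a b x - f x) = el p n (fun x => (st n f x - f x) - (st n (fun x => f x - tp n a b x) x + (st n (tp n a b) x - tp n a b x))) := by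
      congr 1; ext x; rw [st_sub n hf hTb]; ring
    rw [e]
    have h := el_sub_le hp n (fun x => st n f x - f x) (fun x => st n (fun x => f x - tp n a b x) x + (st n (tp n a b) x - tp n a b x))
    have h' := el_add_le hp n (st n (fun x => f x - tp n a b x)) (fun x => st n (tp n a b) x - tp n a b x)
    linarith
  have h4 := el_st hp n (hf.sub hTb)
  have h5 : el p n (fun x => st n (tp n a b) x - tp n a b x) ≤ 7 / 2 * LpNorm p (fun x => st n (tp n a b) x - tp n a b x) := by
    rw [st_tp_sub]; exact easyMZ hp n _ _
  have h6 := st_diff hp n hf hTb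
  have h7 := st_sub_self hp hn hf
  rw [LpNorm_sub_comm] at hT
  have h8 : el p n (fun x => tp n a b x - f x) ≤ el p n (fun x => st n f x - f x) + (3 + 7 / 2 * 7) * omegaMod 2 p f (1 / (n : ℝ)) := by
    linarith
  have h9 := mul_le_mul_of_nonneg_left h8 hC.le
  nlinarith

theorem el_lag (p : ℝ) (n : ℕ) (f : ℝ → ℝ) : el p n (fun x => st n f x - f x) = el p n (fun x => st n f x - lagrange n f x) := by
  apply el_congr
  intro k hk
  rw [lagrange_eq, lag_node n _ hk]

theorem partC {p : ℝ} (hp : 1 < p) {f : ℝ → ℝ} (hf : BP f) {n : ℕ} (hn : 1 ≤ n) :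
    el p n (fun x => st n f x - f x) ≤ 8 * LpNorm p (fun x => f x - lagrange n f x) + 4 * omegaMod 2 p f (1 / (n : ℝ)) := by
  have hω := omega_nonneg p f (1 / (n : ℝ))
  rw [el_lag]
  obtain ⟨a, b, hab⟩ : ∃ a b, lagrange n f = tp n a b := ⟨_, _, lagrange_eq n f⟩
  rw [hab]
  have hTb := tp_bp n a b
  have h3 : el p n (fun x => st n f x - tp n a b x) ≤
      (el p n (st n (fun x => f x - tp n a b x)) + el p n (fun x => st n (tp n a b) x - tp n a b x)) := by
    have e : el p n (fun x => st n f x - tp n a b x) = el p n (fun x => (st n (fun x => f x - tp n a b x) x + (st n (tp n a b) x - tp n a b x))) := by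
      congr 1; ext x; rw [st_sub n hf hTb]; ring
    rw [e]
    exact el_add_le hp n (st n (fun x => f x - tp n a b x)) (fun x => st n (tp n a b) x - tp n a b x)
  have h4 := el_st hp n (hf.sub hTb)
  have h5 : el p n (fun x => st n (tp n a b) x - tp n a b x) ≤ 7 / 2 * LpNorm p (fun x => st n (tp n a b) x - tp n a b x) := by
    rw [st_tp_sub]; exact easyMZ hp n _ _
  have h6 := st_diff hp n hf hTb
  have h7 := st_sub_self hp hn hf
  linarith

/-- second differences of a polynomial through the Steklov defect -/
theorem d2_tp {p : ℝ} (hp : 1 < p) {n : ℕ} (hn : 1 ≤ n) {h : ℝ} (h0 : 0 < h) (h1 : h < 1 / (n : ℝ)) (a b : ℕ → ℝ) :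
    LpNorm p (fun x => tp n a b (x + h) + tp n a b (x + -h) - 2 * tp n a b x) ≤
      2 * ((6 * Real.pi) ^ 2 * Real.cosh (3 * Real.pi)) * (7 / 2 * (6 / Real.pi ^ 2)) *
        LpNorm p (fun x => st n (tp n a b) x - tp n a b x) := by
  have hN := NN_pos n
  have hpi := Real.pi_pos
  have hn0 : (0:ℝ) < n := by exact_mod_cast hn
  have hn1 : (1:ℝ) ≤ n := by exact_mod_cast hn
  have hτ : h * NN n ≤ 3 := by
    rw [lt_div_iff₀ hn0] at h1
    unfold NN; nlinarith
  have s1 := second_diff_mult hp n (τ := h * NN n) (by positivity) hτ a b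
  have e1 : (fun x => tp n a b (x + h) + tp n a b (x + -h) - 2 * tp n a b x) =
      fun x => (-2) * tp n (fun l => (1 - Real.cos (2 * Real.pi * fr n l * (h * NN n))) * a l)
        (fun l => (1 - Real.cos (2 * Real.pi * fr n l * (h * NN n))) * b l) x := by
    ext x
    have h2 := tp_avg n a b x h
    have e : ∀ l : ℕ, 2 * Real.pi * fr n l * (h * NN n) = 2 * Real.pi * l * h := by
      intro l; unfold fr NN at *; field_simp
    simp only [e, sub_mul, one_mul]
    rw [← tp_sub, ← h2]; ring
  rw [e1, LpNorm_const_mul hp]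
  have s2 := mult_inv hp (by norm_num) (mult_one_sub_qφ hp n) (fun l => fr n l ^ 2 * a l) (fun l => fr n l ^ 2 * b l)
  have e2 : tp n (fun l => qφ (fr n l) * (fr n l ^ 2 * a l)) (fun l => qφ (fr n l) * (fr n l ^ 2 * b l)) =
      fun x => (-(6 / Real.pi ^ 2)) * (st n (tp n a b) x - tp n a b x) := by
    have := st_tp_sub n a b
    have h3 := congrFun this
    ext x
    have h4 := h3 x
    rw [h4, tp_mul]
    have hq : ∀ l, qφ (fr n l) * fr n l ^ 2 = 6 / Real.pi ^ 2 * (1 - Real.sinc (Real.pi * fr n l)) := by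
      intro l; rw [mul_comm]; exact (qφ_hasSum (fr n l)).2
    simp only [← mul_assoc (qφ _), hq]
    congr 1 <;> · ext l; ring
  rw [e2, LpNorm_const_mul hp, abs_neg, abs_of_pos (show 0 < 6 / Real.pi ^ 2 by positivity)] at s2
  rw [show (1 - 5 / 7 : ℝ)⁻¹ = 7 / 2 by norm_num] at s2
  have hK : 0 ≤ (6 * Real.pi) ^ 2 * Real.cosh (3 * Real.pi) := by
    have := Real.cosh_pos (3 * Real.pi); positivity
  have s3 := s1.trans (mul_le_mul_of_nonneg_left s2 hK)
  rw [show |(-2:ℝ)| = 2 by norm_num]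
  nlinarith

theorem partB {p : ℝ} (hp : 1 < p) : ∃ B : ℝ, 0 < B ∧ ∀ f : ℝ → ℝ, BP f → ∀ n : ℕ, 1 ≤ n →
    omegaMod 2 p f (1 / (n : ℝ)) ≤ B * (LpNorm p (fun x => f x - lagrange n f x) + el p n (fun x => st n f x - f x)) := by
  obtain ⟨C, hC, hM⟩ := hardMZ hp
  set K := 2 * ((6 * Real.pi) ^ 2 * Real.cosh (3 * Real.pi)) * (7 / 2 * (6 / Real.pi ^ 2)) with hK
  have hK0 : 0 < K := by
    have := Real.cosh_pos (3 * Real.pi); have := Real.pi_pos; positivity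
  refine ⟨4 + K * C, by positivity, fun f hf n hn => ?_⟩
  rw [el_lag]
  obtain ⟨a, b, hab⟩ : ∃ a b, lagrange n f = tp n a b := ⟨_, _, lagrange_eq n f⟩
  rw [hab]
  have hTb := tp_bp n a b
  have hE := LpNorm_nonneg p (fun x => f x - tp n a b x)
  have hD := el_nonneg p n (fun x => st n f x - tp n a b x)
  have h1 : LpNorm p (fun x => st n (tp n a b) x - tp n a b x) ≤ C * el p n (fun x => st n (tp n a b) x - tp n a b x) := by
    rw [st_tp_sub, el_eq]
    have := hM n (fun k => tp n (fun l => Real.sinc (Real.pi * fr n l) * a l - a l) (fun l => Real.sinc (Real.pi * fr n l) * b l - b l) (k / NN n))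
    rw [lag_tp] at this
    exact this
  have h2 : el p n (fun x => st n (tp n a b) x - tp n a b x) ≤ el p n (fun x => st n f x - tp n a b x) + LpNorm p (fun x => f x - tp n a b x) := by
    have e : el p n (fun x => st n (tp n a b) x - tp n a b x) = el p n (fun x => (st n f x - tp n a b x) - st n (fun x => f x - tp n a b x) x) := by
      congr 1; ext x; rw [st_sub n hf hTb]; ring
    rw [e]
    have h := el_sub_le hp n (fun x => st n f x - tp n a b x) (st n (fun x => f x - tp n a b x))
    have h4 := el_st hp n (hf.sub hTb)
    linarith
  apply omega_le hf (by positivity)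
  intro h h0 hlt
  have hd := d2_tp hp hn h0 hlt a b
  rw [← hK] at hd
  have hg := hf.sub hTb
  have t1 : LpNorm p (fun x => f (x + h) + f (x + -h) - 2 * f x) ≤
      LpNorm p (fun x => (f (x + h) - tp n a b (x + h)) + (f (x + -h) - tp n a b (x + -h)) - 2 * (f x - tp n a b x)) +
      LpNorm p (fun x => tp n a b (x + h) + tp n a b (x + -h) - 2 * tp n a b x) := by
    refine le_trans (le_of_eq ?_) (LpNorm_add_le hp (hg.d2 h).bm (hTb.d2 h).bm)
    congr 1; ext x; ring
  have t2 := LpNorm_sub_le hp ((hg.shift h).add (hg.shift (-h))).bm (hg.const_mul 2).bm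
  have t3 := LpNorm_add_le hp (hg.shift h).bm (hg.shift (-h)).bm
  rw [LpNorm_shift p hg.per h, LpNorm_shift p hg.per (-h)] at t3
  rw [LpNorm_const_mul hp, show |(2:ℝ)| = 2 by norm_num] at t2
  have t4 := mul_le_mul_of_nonneg_left (h1.trans (mul_le_mul_of_nonneg_left h2 hC.le)) hK0.le
  have t5 : LpNorm p (fun x => f (x + h) + f (x + -h) - 2 * f x) ≤ 4 * LpNorm p (fun x => f x - tp n a b x) +
      K * (C * (el p n (fun x => st n f x - tp n a b x) + LpNorm p (fun x => f x - tp n a b x))) := by linarith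
  nlinarith

theorem main17 (p : ℝ) (hp : 1 < p) :
    ∃ μ1 μ2 κ1 κ2 : ℝ, 0 < μ1 ∧ 0 < μ2 ∧ 0 < κ1 ∧ 0 < κ2 ∧
      ∀ f : ℝ → ℝ, BP f → ∀ n : ℕ, 1 ≤ n →
        LpNorm p (fun x => f x - lagrange n f x) ≤ μ1 * el p n (fun x => st n f x - f x) + κ1 * omegaMod 2 p f (1 / (n : ℝ)) ∧
          max (κ2 * omegaMod 2 p f (1 / (n : ℝ)) - μ1 * el p n (fun x => st n f x - f x))
              (μ2 * el p n (fun x => st n f x - f x) - κ1 * omegaMod 2 p f (1 / (n : ℝ))) ≤ LpNorm p (fun x => f x - lagrange n f x) := by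
  obtain ⟨A1, A2, hA1, hA2, hA⟩ := partA hp
  obtain ⟨B, hB, hBB⟩ := partB hp
  refine ⟨A1 + 1, 1 / 8, A2 + 1, 1 / B, by positivity, by norm_num, by positivity, by positivity, fun f hf n hn => ?_⟩
  have hω := omega_nonneg p f (1 / (n : ℝ))
  have hD := el_nonneg p n (fun x => st n f x - f x)
  have a := hA f hf n hn
  have b := hBB f hf n hn
  have c := partC hp hf hn
  refine ⟨by nlinarith, max_le ?_ ?_⟩
  · have : 1 / B * omegaMod 2 p f (1 / (n : ℝ)) ≤ LpNorm p (fun x => f x - lagrange n f x) + el p n (fun x => st n f x - f x) := by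
      rw [one_div_mul_eq_div, div_le_iff₀ hB]; linarith
    nlinarith
  · nlinarith


theorem stmt17 (p : ℝ) (hp : 1 < p) :
    ∃ μ1 μ2 κ1 κ2 : ℝ, 0 < μ1 ∧ 0 < μ2 ∧ 0 < κ1 ∧ 0 < κ2 ∧
      ∀ f : ℝ → ℝ, MemLpT p f → (∃ M : ℝ, ∀ x, |f x| ≤ M) → ∀ n : ℕ, 1 ≤ n →
        LpNorm p (fun x => f x - lagrange n f x) ≤ μ1 * ellp p (2 * n + 1) (fun k => (k : ℝ) / (2 * (n : ℝ) + 1)) (fun x => steklov 1 (1 / (2 * (n : ℝ) + 1)) f x - f x) + κ1 * omegaMod 2 p f (1 / (n : ℝ)) ∧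
          max (κ2 * omegaMod 2 p f (1 / (n : ℝ)) - μ1 * ellp p (2 * n + 1) (fun k => (k : ℝ) / (2 * (n : ℝ) + 1)) (fun x => steklov 1 (1 / (2 * (n : ℝ) + 1)) f x - f x))
              (μ2 * ellp p (2 * n + 1) (fun k => (k : ℝ) / (2 * (n : ℝ) + 1)) (fun x => steklov 1 (1 / (2 * (n : ℝ) + 1)) f x - f x) - κ1 * omegaMod 2 p f (1 / (n : ℝ))) ≤ LpNorm p (fun x => f x - lagrange n f x) := by
  obtain ⟨μ1, μ2, κ1, κ2, h1, h2, h3, h4, h⟩ := main17 p hp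
  refine ⟨μ1, μ2, κ1, κ2, h1, h2, h3, h4, fun f hf hb n hn => ?_⟩
  have := h f ⟨hf.1, hf.2.1, hb⟩ n hn
  simp only [el] at this
  simp only [steklov_eq]
  exact this
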